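/- arXiv:math/0303199 — 4 statements merged into one kernel-verified Lean document; each statement's English description precedes it below -/
import Mathlib

section
/- Let β₁ < β₂ with β₂ − β₁ < 2π and R > 0, and let Ω = {(ρcosθ, ρsinθ) : 0 < ρ < R, β₁ < θ < β₂} ⊂ ℝ² be the open sector of radius R, with edges L(β) = {(ρcosβ, ρsinβ) : 0 < ρ ≤ R}. Let u be a C² solution of the minimal surfaces equation in Ω such that u → +∞ on L(β₁) and u → −∞ on L(β₂). Then: (i) for every α ∈ (β₁, β₂) there exist M, M′ ∈ ℝ such that u ≤ M on {(ρcosθ, ρsinθ) : 0 < ρ ≤ R/4, α ≤ θ < β₂} and u ≥ M′ on {(ρcosθ, ρsinθ) : 0 < ρ ≤ R/4, β₁ < θ ≤ α}; and (ii) for every M ∈ ℝ there exist α, α′ ∈ (β₁, β₂) such that u ≥ M on {(ρcosθ, ρsinθ) : 0 < ρ ≤ R/4, β₁ < θ ≤ α} and u ≤ M on {(ρcosθ, ρsinθ) : 0 < ρ ≤ R/4, α′ ≤ θ < β₂}. -/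
open Real Filter Set Topology MeasureTheory

/-- Partial derivative in the first (x) variable. -/
noncomputable def pd1 (u : ℝ × ℝ → ℝ) (z : ℝ × ℝ) : ℝ := deriv (fun t => u (t, z.2)) z.1

/-- Partial derivative in the second (y) variable. -/
noncomputable def pd2 (u : ℝ × ℝ → ℝ) (z : ℝ × ℝ) : ℝ := deriv (fun t => u (z.1, t)) z.2

/-- `W = √(1 + p² + q²)` for the function `u`. -/
noncomputable def Wg (u : ℝ × ℝ → ℝ) (z : ℝ × ℝ) : ℝ :=
  Real.sqrt (1 + pd1 u z ^ 2 + pd2 u z ^ 2)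

/-- `u` is a C² solution of the minimal surfaces equation
`(1+q²)r − 2pq·s + (1+p²)t = 0` on `Ω`. -/
def IsMSE (u : ℝ × ℝ → ℝ) (Ω : Set (ℝ × ℝ)) : Prop :=
  ContDiffOn ℝ 2 u Ω ∧ ∀ z ∈ Ω,
    (1 + pd2 u z ^ 2) * pd1 (pd1 u) z
      - 2 * pd1 u z * pd2 u z * pd2 (pd1 u) z
      + (1 + pd1 u z ^ 2) * pd2 (pd2 u) z = 0

/-- Euclidean length of a planar vector. -/
noncomputable def len (v : ℝ × ℝ) : ℝ := Real.sqrt (v.1 ^ 2 + v.2 ^ 2)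

/-- Euclidean open disk in the plane. -/
def eball (P : ℝ × ℝ) (ρ : ℝ) : Set (ℝ × ℝ) := {z | len (z - P) < ρ}

/-- The set of points with polar radius in `Pρ` and polar angle in `Pθ`. -/
def polarSet (Pρ Pθ : Set ℝ) : Set (ℝ × ℝ) :=
  (fun p : ℝ × ℝ => (p.1 * Real.cos p.2, p.1 * Real.sin p.2)) '' (Pρ ×ˢ Pθ)

/-- polar map -/
noncomputable def pol (p : ℝ × ℝ) : ℝ × ℝ := (p.1 * Real.cos p.2, p.1 * Real.sin p.2)

lemma pol_cont : Continuous pol := by unfold pol; fun_prop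

lemma pol_nhds (x : ℝ × ℝ) (hx : 0 < x.1) : Filter.map pol (𝓝 x) = 𝓝 (pol x) := by
  have h1 : HasFDerivAt pol (fderivPolarCoordSymm x) x := hasFDerivAt_polarCoord_symm x
  have h2 : ContDiffAt ℝ 1 pol x := by unfold pol; fun_prop
  have h3 := h2.hasStrictFDerivAt' h1 (by norm_num)
  refine h3.map_nhds_eq_of_surj ?_
  have hd : (fderivPolarCoordSymm x).det ≠ 0 := by
    rw [det_fderivPolarCoordSymm]; exact hx.ne'
  have := (LinearMap.equivOfDetNeZero _ hd).surjective
  exact LinearMap.range_eq_top.2 this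

lemma polarSet_eq (A B : Set ℝ) : polarSet A B = pol '' (A ×ˢ B) := rfl

/-- existence of a maximum -/
lemma exists_max {K G : Set (ℝ × ℝ)} (hK : IsCompact K) (hGK : G ⊆ K) (hne : G.Nonempty)
    (f : ℝ × ℝ → ℝ) (hc : ContinuousOn f G)
    (hb : ∀ x ∈ K, x ∉ G → Tendsto f (𝓝[G] x) atBot) :
    ∃ x ∈ G, ∀ y ∈ G, f y ≤ f x := by
  obtain ⟨z, hz⟩ := hne
  have hcl : IsClosed {x | x ∈ G ∧ f z ≤ f x} := by
    rw [← closure_subset_iff_isClosed]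
    intro x hx
    have hfr : ∃ᶠ y in 𝓝[G] x, f z ≤ f y := by
      rw [mem_closure_iff_frequently] at hx
      rw [frequently_nhdsWithin_iff]
      exact hx.mono fun y hy => ⟨hy.2, hy.1⟩
    have hxK : x ∈ K := hK.isClosed.closure_subset_iff.2 (fun y hy => hGK hy.1) hx
    by_cases hxG : x ∈ G
    · refine ⟨hxG, ?_⟩
      by_contra hlt
      push Not at hlt
      have := (hc x hxG).eventually (gt_mem_nhds hlt)
      obtain ⟨y, h1, h2⟩ := (hfr.and_eventually this).exists
      exact absurd h1 (not_le.2 h2)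
    · have := (hb x hxK hxG).eventually (eventually_lt_atBot (f z))
      obtain ⟨y, h1, h2⟩ := (hfr.and_eventually this).exists
      exact absurd h1 (not_le.2 h2)
  have hcomp : IsCompact {x | x ∈ G ∧ f z ≤ f x} :=
    hK.of_isClosed_subset hcl (fun y hy => hGK hy.1)
  obtain ⟨x, hx, hm⟩ := hcomp.exists_isMaxOn ⟨z, hz, le_rfl⟩ (hc.mono fun y hy => hy.1)
  refine ⟨x, hx.1, fun y hy => ?_⟩
  by_cases h : f z ≤ f y
  · exact hm ⟨hy, h⟩
  · exact (not_le.1 h).le.trans hx.2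

/-- second derivative test -/
lemma second_test (f f' : ℝ → ℝ) (D : ℝ) (hf : ∀ᶠ t in 𝓝 (0:ℝ), HasDerivAt f (f' t) t)
    (hD : HasDerivAt f' D 0) (hm : ∀ᶠ t in 𝓝 (0:ℝ), f t ≤ f 0) : f' 0 = 0 ∧ D ≤ 0 := by
  have hmax : IsLocalMax f 0 := hm
  have h0 : f' 0 = 0 := hmax.hasDerivAt_eq_zero hf.self_of_nhds
  refine ⟨h0, ?_⟩
  by_contra hpos
  push Not at hpos
  have e1 : deriv f =ᶠ[𝓝 0] f' := hf.mono fun t ht => ht.deriv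
  have hdd : deriv (deriv f) 0 = D := by rw [e1.deriv_eq]; exact hD.deriv
  have hmin : IsLocalMin f 0 := isLocalMin_of_deriv_deriv_pos (by rw [hdd]; exact hpos)
    (by rw [e1.self_of_nhds]; exact h0) hf.self_of_nhds.continuousAt
  have hc : f =ᶠ[𝓝 0] fun _ => f 0 := by
    filter_upwards [hmax, hmin] with t h1 h2 using le_antisymm h1 h2
  have : deriv (deriv f) 0 = 0 := by
    have h1 : deriv f =ᶠ[𝓝 0] deriv (fun _ => f 0) := hc.deriv
    rw [h1.deriv_eq]; simp
  linarith [hdd ▸ this]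

lemma line_tendsto (z v : ℝ × ℝ) : Tendsto (fun t : ℝ => z + t • v) (𝓝 0) (𝓝 z) := by
  have : Continuous (fun t : ℝ => z + t • v) := by fun_prop
  simpa using this.tendsto 0

/-- touching a solution from above by a strict supersolution is impossible -/
lemma touch (u w : ℝ × ℝ → ℝ) (z : ℝ × ℝ) (hu : ContDiffAt ℝ 2 u z)
    (heq : (1 + pd2 u z ^ 2) * pd1 (pd1 u) z
      - 2 * pd1 u z * pd2 u z * pd2 (pd1 u) z
      + (1 + pd1 u z ^ 2) * pd2 (pd2 u) z = 0)
    (p q : ℝ) (D : ℝ × ℝ → ℝ)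
    (hw : ∀ v : ℝ × ℝ, ∃ g : ℝ → ℝ, (∀ᶠ t in 𝓝 (0:ℝ), HasDerivAt (fun t : ℝ => w (z + t • v)) (g t) t)
      ∧ g 0 = p * v.1 + q * v.2 ∧ HasDerivAt g (D v) 0)
    (hmax : ∀ᶠ y in 𝓝 z, u y - w y ≤ u z - w z)
    (hD : D (1, 0) + D (0, 1) + D (q, -p) < 0) : False := by
  have hdiff : ∀ᶠ y in 𝓝 z, DifferentiableAt ℝ u y := by
    have h := hu.eventually (by simp)
    exact h.mono fun y hy => hy.differentiableAt (by norm_num)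
  have hd2 : DifferentiableAt ℝ (fderiv ℝ u) z :=
    (hu.fderiv_right (m := 1) (by norm_num)).differentiableAt (by norm_num)
  set H := fderiv ℝ (fderiv ℝ u) z with hH
  have hlined : ∀ (v : ℝ × ℝ) (t : ℝ), HasDerivAt (fun t : ℝ => z + t • v) v t := by
    intro v t
    simpa using ((hasDerivAt_id t).smul_const v).const_add z
  have hu1 : ∀ v : ℝ × ℝ, ∀ᶠ t in 𝓝 (0:ℝ),
      HasDerivAt (fun t : ℝ => u (z + t • v)) (fderiv ℝ u (z + t • v) v) t := by
    intro v
    filter_upwards [(line_tendsto z v).eventually hdiff] with t ht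
    exact ht.hasFDerivAt.comp_hasDerivAt t (hlined v t)
  have hu2 : ∀ v v' : ℝ × ℝ, HasDerivAt (fun t : ℝ => fderiv ℝ u (z + t • v) v') (H v v') 0 := by
    intro v v'
    have h0 : HasFDerivAt (fderiv ℝ u) H (z + (0:ℝ) • v) := by simpa using hd2.hasFDerivAt
    have h1 := h0.comp_hasDerivAt 0 (hlined v 0)
    have h2 := h1.clm_apply (hasDerivAt_const (0:ℝ) v')
    simpa using h2
  have hpd1 : ∀ᶠ y in 𝓝 z, pd1 u y = fderiv ℝ u y (1, 0) := by
    filter_upwards [hdiff] with y hy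
    have : HasDerivAt (fun t : ℝ => (t, y.2)) ((1:ℝ), (0:ℝ)) y.1 :=
      (hasDerivAt_id y.1).prodMk (hasDerivAt_const _ _)
    exact (hy.hasFDerivAt.comp_hasDerivAt y.1 this).deriv
  have hpd2 : ∀ᶠ y in 𝓝 z, pd2 u y = fderiv ℝ u y (0, 1) := by
    filter_upwards [hdiff] with y hy
    have : HasDerivAt (fun t : ℝ => (y.1, t)) ((0:ℝ), (1:ℝ)) y.2 :=
      (hasDerivAt_const _ _).prodMk (hasDerivAt_id y.2)
    exact (hy.hasFDerivAt.comp_hasDerivAt y.2 this).deriv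
  have hs1 : ∀ F : ℝ × ℝ → ℝ, ∀ v' : ℝ × ℝ, (∀ᶠ y in 𝓝 z, F y = fderiv ℝ u y v') →
      pd1 F z = H (1, 0) v' := by
    intro F v' hF
    have h1 : HasDerivAt (fun t : ℝ => (t, z.2)) ((1:ℝ), (0:ℝ)) z.1 :=
      (hasDerivAt_id z.1).prodMk (hasDerivAt_const _ _)
    have h2 : HasDerivAt (fun t : ℝ => fderiv ℝ u (t, z.2) v') (H (1,0) v') z.1 := by
      have := (HasFDerivAt.comp_hasDerivAt z.1 (l := fderiv ℝ u) hd2.hasFDerivAt h1).clm_apply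
        (hasDerivAt_const z.1 v')
      simpa using this
    have h3 : (fun t : ℝ => F (t, z.2)) =ᶠ[𝓝 z.1] (fun t : ℝ => fderiv ℝ u (t, z.2) v') :=
      h1.continuousAt.tendsto.eventually hF
    unfold pd1
    rw [h3.deriv_eq, h2.deriv]
  have hs2 : ∀ F : ℝ × ℝ → ℝ, ∀ v' : ℝ × ℝ, (∀ᶠ y in 𝓝 z, F y = fderiv ℝ u y v') →
      pd2 F z = H (0, 1) v' := by
    intro F v' hF
    have h1 : HasDerivAt (fun t : ℝ => (z.1, t)) ((0:ℝ), (1:ℝ)) z.2 :=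
      (hasDerivAt_const _ _).prodMk (hasDerivAt_id z.2)
    have h2 : HasDerivAt (fun t : ℝ => fderiv ℝ u (z.1, t) v') (H (0,1) v') z.2 := by
      have := (HasFDerivAt.comp_hasDerivAt z.2 (l := fderiv ℝ u) hd2.hasFDerivAt h1).clm_apply
        (hasDerivAt_const z.2 v')
      simpa using this
    have h3 : (fun t : ℝ => F (z.1, t)) =ᶠ[𝓝 z.2] (fun t : ℝ => fderiv ℝ u (z.1, t) v') :=
      h1.continuousAt.tendsto.eventually hF
    unfold pd2
    rw [h3.deriv_eq, h2.deriv]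
  have hsymm : H (0,1) (1,0) = H (1,0) (0,1) :=
    (hu.isSymmSndFDerivAt (by simp)) (0,1) (1,0)
  rw [hs1 _ _ hpd1, hs2 _ _ hpd1, hs2 _ _ hpd2, hpd1.self_of_nhds, hpd2.self_of_nhds] at heq
  have key : ∀ v : ℝ × ℝ, fderiv ℝ u z v = p * v.1 + q * v.2 ∧ H v v ≤ D v := by
    intro v
    obtain ⟨g, hg1, hg2, hg3⟩ := hw v
    have := second_test (fun t => u (z + t • v) - w (z + t • v))
      (fun t => fderiv ℝ u (z + t • v) v - g t) (H v v - D v)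
      (by filter_upwards [hu1 v, hg1] with t h1 h2 using h1.sub h2)
      ((hu2 v v).sub hg3)
      (by simpa using (line_tendsto z v).eventually hmax)
    simp only [zero_smul, add_zero, hg2] at this
    exact ⟨by linarith [this.1], by linarith [this.2]⟩
  have k1 := key (1, 0)
  have k2 := key (0, 1)
  have k3 := (key (q, -p)).2
  simp only [mul_one, mul_zero, add_zero, zero_add] at k1 k2
  have hv : ((q, -p) : ℝ × ℝ) = q • ((1:ℝ), (0:ℝ)) + (-p) • ((0:ℝ), (1:ℝ)) := by simp
  have hexp : H (q, -p) (q, -p) = q^2 * H (1,0) (1,0) - 2 * p * q * H (0,1) (1,0)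
      + p^2 * H (0,1) (0,1) := by
    rw [hv]
    simp only [map_add, map_smul, _root_.add_apply, _root_.smul_apply, smul_eq_mul]
    rw [hsymm]; ring
  rw [k1.1, k2.1] at heq
  rw [hexp] at k3
  linarith [k1.2, k2.2]

/-- No touching with the hyperboloid barrier. -/
lemma no_touch_hyp (u : ℝ × ℝ → ℝ) (z : ℝ × ℝ) (hu : ContDiffAt ℝ 2 u z)
    (heq : (1 + pd2 u z ^ 2) * pd1 (pd1 u) z
      - 2 * pd1 u z * pd2 u z * pd2 (pd1 u) z
      + (1 + pd1 u z ^ 2) * pd2 (pd2 u) z = 0)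
    (a b c : ℝ) (hc : 0 < c) (m : ℝ × ℝ → ℝ)
    (hm : ∀ y, m y = (y.1 - a) ^ 2 + (y.2 - b) ^ 2 - c) (hz : 0 ≤ m z)
    (hmax : ∀ᶠ y in 𝓝 z, 0 ≤ m y → u y + √(m y) ≤ u z + √(m z)) : False := by
  have hmc : Continuous m := by
    have : m = fun y => (y.1 - a) ^ 2 + (y.2 - b) ^ 2 - c := funext hm
    rw [this]; fun_prop
  rcases hz.lt_or_eq with hpos | h0
  · set s := √(m z) with hs
    have hspos : 0 < s := Real.sqrt_pos.2 hpos
    have hss : s ^ 2 = m z := Real.sq_sqrt hz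
    have hline : ∀ (v : ℝ × ℝ) (t : ℝ), m (z + t • v) =
        m z + 2 * t * ((z.1 - a) * v.1 + (z.2 - b) * v.2) + t ^ 2 * (v.1 ^ 2 + v.2 ^ 2) := by
      intro v t
      rw [hm, hm]; simp; ring
    refine touch u (fun y => - √(m y)) z hu heq (-(z.1 - a) / s) (-(z.2 - b) / s)
      (fun v => -((v.1 ^ 2 + v.2 ^ 2) / s - ((z.1 - a) * v.1 + (z.2 - b) * v.2) ^ 2 / s ^ 3))
      ?_ ?_ ?_
    · intro v
      set d := (z.1 - a) * v.1 + (z.2 - b) * v.2 with hd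
      set l := v.1 ^ 2 + v.2 ^ 2 with hl
      have hmd : ∀ t : ℝ, HasDerivAt (fun t : ℝ => m (z + t • v)) (2 * d + 2 * t * l) t := by
        intro t
        have h1 : (fun t : ℝ => m (z + t • v)) = fun t => m z + 2 * t * d + t ^ 2 * l :=
          funext (hline v)
        rw [h1]
        have h2 := (((((hasDerivAt_id t).const_mul 2).mul_const d).const_add (m z)).add
          (((hasDerivAt_id t).pow 2).mul_const l))
        convert! h2 using 1
        simp
      have hsq : ∀ t : ℝ, 0 < m (z + t • v) →
          HasDerivAt (fun t : ℝ => √(m (z + t • v))) ((d + t * l) / √(m (z + t • v))) t := by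
        intro t ht
        convert (hmd t).sqrt ht.ne' using 1
        have := Real.sqrt_pos.2 ht
        field_simp
      refine ⟨fun t => -((d + t * l) / √(m (z + t • v))), ?_, ?_, ?_⟩
      · have : ∀ᶠ y in 𝓝 z, 0 < m y := hmc.continuousAt.eventually (lt_mem_nhds hpos)
        filter_upwards [(line_tendsto z v).eventually this] with t ht
        exact (hsq t ht).neg
      · simp only [zero_mul, add_zero, zero_smul, ← hs, hd]
        field_simp
        ring
      · have h1 := hsq 0 (by simpa using hpos)
        have h2 : HasDerivAt (fun t : ℝ => d + t * l) l 0 := by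
          simpa using ((hasDerivAt_id (0:ℝ)).mul_const l).const_add d
        have h3 := (h2.div h1 (by simpa [← hs] using hspos.ne')).neg
        convert! h3 using 1
        simp only [zero_mul, add_zero, zero_smul, ← hs]
        field_simp
    · have : ∀ᶠ y in 𝓝 z, 0 < m y := hmc.continuousAt.eventually (lt_mem_nhds hpos)
      filter_upwards [this, hmax] with y h1 h2
      have := h2 h1.le
      simp only [sub_neg_eq_add]
      exact this
    · have : -(((1:ℝ) ^ 2 + 0 ^ 2) / s - ((z.1 - a) * 1 + (z.2 - b) * 0) ^ 2 / s ^ 3) +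
        -(((0:ℝ) ^ 2 + 1 ^ 2) / s - ((z.1 - a) * 0 + (z.2 - b) * 1) ^ 2 / s ^ 3) +
        -(((-(z.2 - b) / s) ^ 2 + (-(-(z.1 - a) / s)) ^ 2) / s -
          ((z.1 - a) * (-(z.2 - b) / s) + (z.2 - b) * (-(-(z.1 - a) / s))) ^ 2 / s ^ 3) = -(2 / s) := by
        field_simp
        ring
      simp only []
      rw [this]
      have : 0 < 2 / s := by positivity
      linarith
  · -- boundary case
    have hzc : (z.1 - a) ^ 2 + (z.2 - b) ^ 2 = c := by have := hm z; linarith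
    set v : ℝ × ℝ := (z.1 - a, z.2 - b) with hv
    have hline : ∀ t : ℝ, m (z + t • v) = c * (2 * t + t ^ 2) := by
      intro t
      rw [hm, ← hzc]; simp [hv]; ring
    have hd : HasDerivAt (fun t : ℝ => u (z + t • v)) (fderiv ℝ u z v) 0 := by
      have h1 : HasFDerivAt u (fderiv ℝ u z) (z + (0:ℝ) • v) := by
        simpa using (hu.differentiableAt (by norm_num)).hasFDerivAt
      have h2 : HasDerivAt (fun t : ℝ => z + t • v) v 0 := by
        simpa using ((hasDerivAt_id (0:ℝ)).smul_const v).const_add z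
      exact h1.comp_hasDerivAt 0 h2
    obtain ⟨C, hC⟩ := hd.isBigO_sub.bound
    have hev := (line_tendsto z v).eventually hmax
    have hsmall : ∀ᶠ t in 𝓝 (0:ℝ), t * C ^ 2 < 2 * c := by
      have : Continuous fun t : ℝ => t * C ^ 2 := by fun_prop
      have h := this.continuousAt (x := 0)
      exact h.eventually (gt_mem_nhds (by simpa using hc))
    have hall : ∀ᶠ t in 𝓝[>] (0:ℝ), False := by
      filter_upwards [nhdsWithin_le_nhds hC, nhdsWithin_le_nhds hev, nhdsWithin_le_nhds hsmall,
        self_mem_nhdsWithin] with t h1 h2 h3 h4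
      have ht : 0 < t := h4
      have hmp : 0 ≤ m (z + t • v) := by rw [hline]; positivity
      have h5 := h2 hmp
      rw [← h0, Real.sqrt_zero] at h5
      have h6 := Real.sq_sqrt hmp
      have h7 := Real.sqrt_nonneg (m (z + t • v))
      simp only [zero_smul, add_zero, sub_zero, Real.norm_eq_abs, abs_of_pos ht] at h1
      have h8 := neg_abs_le (u (z + t • v) - u z)
      have h9 : √(m (z + t • v)) ≤ C * t := by linarith
      have h10 : √(m (z + t • v)) ^ 2 ≤ (C * t) ^ 2 := by gcongr
      rw [h6, hline] at h10
      nlinarith [mul_lt_mul_of_pos_left h3 ht, mul_pos hc (pow_pos ht 2)]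
    have := hall.exists
    simp at this

/-- No touching with the wedge barrier. -/
lemma no_touch_wedge (u : ℝ × ℝ → ℝ) (z : ℝ × ℝ) (hu : ContDiffAt ℝ 2 u z)
    (heq : (1 + pd2 u z ^ 2) * pd1 (pd1 u) z
      - 2 * pd1 u z * pd2 u z * pd2 (pd1 u) z
      + (1 + pd1 u z ^ 2) * pd2 (pd2 u) z = 0)
    (s c ε A k : ℝ) (hsc : s ^ 2 + c ^ 2 = 1) (hk : 0 < k)
    (N T : ℝ × ℝ → ℝ) (hN : ∀ y, N y = s * y.1 - c * y.2) (hT : ∀ y, T y = c * y.1 + s * y.2 - ε)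
    (hNz : 0 ≤ N z) (hNT : N z < T z)
    (hmax : ∀ᶠ y in 𝓝 z, u y - (A + k * (N y / (N y + T y))) ≤ u z - (A + k * (N z / (N z + T z)))) :
    False := by
  have hE : 0 < N z + T z := by linarith
  set E := N z + T z with hEd
  have hNl : ∀ (v : ℝ × ℝ) (t : ℝ), N (z + t • v) = N z + t * (s * v.1 - c * v.2) := by
    intro v t; rw [hN, hN]; simp; ring
  have hTl : ∀ (v : ℝ × ℝ) (t : ℝ), N (z + t • v) + T (z + t • v)
      = E + t * ((s * v.1 - c * v.2) + (c * v.1 + s * v.2)) := by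
    intro v t; rw [hEd, hN, hN, hT, hT]; simp; ring
  let om : ℝ × ℝ → ℝ := fun v =>
    (s * v.1 - c * v.2) * E - N z * ((s * v.1 - c * v.2) + (c * v.1 + s * v.2))
  refine touch u (fun y => A + k * (N y / (N y + T y))) z hu heq (k * om (1, 0) / E ^ 2)
    (k * om (0, 1) / E ^ 2)
    (fun v => - (2 * k * om v * ((s * v.1 - c * v.2) + (c * v.1 + s * v.2)) / E ^ 3)) ?_ hmax ?_
  · intro v
    set Nv := s * v.1 - c * v.2 with hNv
    set Ev := Nv + (c * v.1 + s * v.2) with hEv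
    have hlin : ∀ (x y t : ℝ), HasDerivAt (fun t : ℝ => x + t * y) y t := by
      intro x y t
      simpa using ((hasDerivAt_id t).mul_const y).const_add x
    have hpos : ∀ᶠ t in 𝓝 (0:ℝ), 0 < E + t * Ev := by
      have : Continuous fun t : ℝ => E + t * Ev := by fun_prop
      exact (this.continuousAt (x := 0)).eventually (lt_mem_nhds (by simpa using hE))
    refine ⟨fun t => k * om v / (E + t * Ev) ^ 2, ?_, ?_, ?_⟩
    · filter_upwards [hpos] with t ht
      have h1 : (fun t : ℝ => A + k * (N (z + t • v) / (N (z + t • v) + T (z + t • v)))) =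
          fun t => A + k * ((N z + t * Nv) / (E + t * Ev)) := by
        funext t; rw [hTl, hNl]
      rw [h1]
      convert! ((((hlin (N z) Nv t).div (hlin E Ev t) ht.ne').const_mul k).const_add A) using 1
      simp only [om, ← hNv, ← hEv]
      field_simp
      ring
    · simp only [om, hEv, hNv, zero_mul, add_zero]
      field_simp
      ring
    · have h2 := ((hasDerivAt_const (0:ℝ) (k * om v)).div ((hlin E Ev 0).pow 2)
        (by simpa using hE.ne'))
      convert! h2 using 1
      simp
      field_simp
  · have : -(2 * k * om (1,0) * ((s * 1 - c * 0) + (c * 1 + s * 0)) / E ^ 3) +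
      -(2 * k * om (0,1) * ((s * 0 - c * 1) + (c * 0 + s * 1)) / E ^ 3) +
      -(2 * k * om (k * om (0, 1) / E ^ 2, -(k * om (1, 0) / E ^ 2)) *
        ((s * (k * om (0, 1) / E ^ 2) - c * -(k * om (1, 0) / E ^ 2)) +
        (c * (k * om (0, 1) / E ^ 2) + s * -(k * om (1, 0) / E ^ 2))) / E ^ 3)
      = -(2 * k * (s ^ 2 + c ^ 2) * (E - 2 * N z) / E ^ 3) := by
      have h0 : om (k * om (0, 1) / E ^ 2, -(k * om (1, 0) / E ^ 2)) = 0 := by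
        simp only [om]; field_simp; ring
      rw [h0]
      simp only [om]
      field_simp
      ring
    simp only []
    rw [this, hsc]
    have : 0 < 2 * k * 1 * (E - 2 * N z) / E ^ 3 := by
      have : 0 < E - 2 * N z := by linarith
      positivity
    linarith

lemma interior_pt {β₁ β₂ R : ℝ} {u : ℝ × ℝ → ℝ}
    (hu : IsMSE u (polarSet (Ioo 0 R) (Ioo β₁ β₂))) (x : ℝ × ℝ)
    (hx : x ∈ Ioo 0 R ×ˢ Ioo β₁ β₂) : ContDiffAt ℝ 2 u (pol x) ∧
      (1 + pd2 u (pol x) ^ 2) * pd1 (pd1 u) (pol x)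
      - 2 * pd1 u (pol x) * pd2 u (pol x) * pd2 (pd1 u) (pol x)
      + (1 + pd1 u (pol x) ^ 2) * pd2 (pd2 u) (pol x) = 0 := by
  refine ⟨hu.1.contDiffAt ?_, hu.2 _ ⟨x, hx, rfl⟩⟩
  rw [← pol_nhds x hx.1.1, polarSet_eq]
  exact image_mem_map ((isOpen_Ioo.prod isOpen_Ioo).mem_nhds hx)

lemma upol_cont {β₁ β₂ R : ℝ} {u : ℝ × ℝ → ℝ}
    (hu : IsMSE u (polarSet (Ioo 0 R) (Ioo β₁ β₂))) :
    ContinuousOn (fun p => u (pol p)) (Ioo 0 R ×ˢ Ioo β₁ β₂) := by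
  intro x hx
  have h := (interior_pt hu x hx).1.continuousAt
  exact (ContinuousAt.comp (f := pol) h pol_cont.continuousAt).continuousWithinAt

lemma edge_tendsto {β₁ β₂ R : ℝ} {u : ℝ × ℝ → ℝ}
    (hminus : ∀ z ∈ polarSet (Ioc 0 R) {β₂},
      Tendsto u (𝓝[polarSet (Ioo 0 R) (Ioo β₁ β₂)] z) atBot)
    (x : ℝ × ℝ) (h1 : x.1 ∈ Ioc 0 R) (h2 : x.2 = β₂) :
    Tendsto (fun p => u (pol p)) (𝓝[Ioo 0 R ×ˢ Ioo β₁ β₂] x) atBot := by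
  refine (hminus (pol x) ⟨x, ⟨h1, h2⟩, rfl⟩).comp ?_
  exact pol_cont.continuousAt.continuousWithinAt.tendsto_nhdsWithin
    (fun p hp => ⟨p, hp, rfl⟩)

lemma arc_bound {β₁ β₂ R : ℝ} {u : ℝ × ℝ → ℝ}
    (hu : IsMSE u (polarSet (Ioo 0 R) (Ioo β₁ β₂)))
    (hminus : ∀ z ∈ polarSet (Ioc 0 R) {β₂},
      Tendsto u (𝓝[polarSet (Ioo 0 R) (Ioo β₁ β₂)] z) atBot)
    (r γ : ℝ) (hr : 0 < r) (hrR : r < R) (hγ : β₁ < γ) (hγ2 : γ < β₂) :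
    ∃ C, ∀ θ ∈ Ico γ β₂, u (pol (r, θ)) ≤ C := by
  have hsub : ({r} ×ˢ Ico γ β₂ : Set (ℝ × ℝ)) ⊆ Ioo 0 R ×ˢ Ioo β₁ β₂ := by
    rintro ⟨a, b⟩ ⟨h1, h2⟩
    simp only [mem_singleton_iff] at h1
    subst h1
    exact ⟨⟨hr, hrR⟩, ⟨hγ.trans_le h2.1, h2.2⟩⟩
  obtain ⟨x, hx, hm⟩ := exists_max (K := {r} ×ˢ Icc γ β₂) (G := {r} ×ˢ Ico γ β₂)
    (isCompact_singleton.prod isCompact_Icc) (prod_mono_right Ico_subset_Icc_self)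
    ⟨(r, γ), rfl, le_rfl, hγ2⟩ (fun p => u (pol p)) ((upol_cont hu).mono hsub) (by
      rintro ⟨a, b⟩ ⟨h1, h2⟩ h3
      simp only [mem_singleton_iff] at h1
      subst h1
      have hb : b = β₂ := by
        by_contra hne
        exact h3 ⟨rfl, h2.1, lt_of_le_of_ne h2.2 hne⟩
      exact (edge_tendsto hminus (a, b) ⟨hr, hrR.le⟩ hb).mono_left (nhdsWithin_mono _ hsub))
  exact ⟨_, fun θ hθ => hm (r, θ) ⟨rfl, hθ⟩⟩

/-- Upper bound in a half-plane-like subsector. -/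
lemma upper_core {β₁ β₂ R : ℝ} {u : ℝ × ℝ → ℝ} (hR : 0 < R)
    (hu : IsMSE u (polarSet (Ioo 0 R) (Ioo β₁ β₂)))
    (hminus : ∀ z ∈ polarSet (Ioc 0 R) {β₂},
      Tendsto u (𝓝[polarSet (Ioo 0 R) (Ioo β₁ β₂)] z) atBot)
    (θ₀ : ℝ) (h1 : β₁ < θ₀) (h2 : θ₀ < β₂) :
    ∃ M, ∀ ρ ∈ Ioc 0 (R / 4), ∀ θ ∈ Ico θ₀ β₂, θ ≤ θ₀ + π → u (pol (ρ, θ)) ≤ M := by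
  set r := R / 4 with hr
  have hr0 : 0 < r := by positivity
  have hrR : r < R := by rw [hr]; linarith
  obtain ⟨η, hη0, hη1, hη2⟩ : ∃ η : ℝ, 0 < η ∧ η ≤ π / 2 ∧ β₁ < θ₀ - η := by
    refine ⟨min (π / 2) ((θ₀ - β₁) / 2), lt_min (by positivity) (by linarith), min_le_left _ _, ?_⟩
    have := min_le_right (π / 2) ((θ₀ - β₁) / 2)
    linarith
  have hsin : 0 < Real.sin η := Real.sin_pos_of_pos_of_lt_pi hη0 (by linarith [Real.pi_pos])
  set c := r / Real.sin η with hc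
  have hc0 : 0 < c := by positivity
  have hcs : c * Real.sin η = r := by rw [hc]; field_simp
  set γ := θ₀ - η with hγ
  have hγ2 : γ < β₂ := by linarith
  obtain ⟨C, hC⟩ := arc_bound hu hminus r γ hr0 hrR hη2 hγ2
  set B := √(r ^ 2 + 2 * c * r) with hB
  refine ⟨C + B, ?_⟩
  intro ρ hρ θ hθ hθπ
  set ε := ρ ^ 2 with hε
  have hε0 : 0 < ε := by have := hρ.1; positivity
  let mm : ℝ × ℝ → ℝ := fun p => p.1 ^ 2 + 2 * c * p.1 * Real.sin (p.2 - θ₀) - ε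
  have hmmc : Continuous mm := by simp only [mm]; fun_prop
  let m : ℝ × ℝ → ℝ := fun y => (y.1 - c * Real.sin θ₀) ^ 2 + (y.2 - (-c * Real.cos θ₀)) ^ 2 - (c ^ 2 + ε)
  have hm : ∀ p, m (pol p) = mm p := by
    intro p
    simp only [m, mm, pol, Real.sin_sub]
    have e1 := Real.sin_sq_add_cos_sq p.2
    have e2 := Real.sin_sq_add_cos_sq θ₀
    linear_combination p.1 ^ 2 * e1 + c ^ 2 * e2
  set δ := ε / (r + 2 * c) with hδ
  have hδ0 : 0 < δ := by positivity
  let K : Set (ℝ × ℝ) := (Icc δ r ×ˢ Icc γ β₂) ∩ {p | 0 ≤ mm p}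
  let G : Set (ℝ × ℝ) := K ∩ {p | p.2 < β₂}
  have hK : IsCompact K :=
    (isCompact_Icc.prod isCompact_Icc).inter_right (isClosed_le continuous_const hmmc)
  have hG : ∀ p : ℝ × ℝ, 0 < p.1 → p.1 ≤ r → γ ≤ p.2 → p.2 < β₂ → 0 ≤ mm p → p ∈ G := by
    intro p h1 h2 h3 h4 h5
    refine ⟨⟨⟨⟨?_, h2⟩, h3, h4.le⟩, h5⟩, h4⟩
    rw [hδ, div_le_iff₀ (by positivity)]
    have h6 : 0 ≤ p.1 ^ 2 + 2 * c * p.1 * Real.sin (p.2 - θ₀) - ε := h5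
    have h7 := mul_le_mul_of_nonneg_left (Real.sin_le_one (p.2 - θ₀)) (by positivity : 0 ≤ 2 * c * p.1)
    nlinarith
  have hsub : G ⊆ Ioo 0 R ×ˢ Ioo β₁ β₂ := by
    rintro p ⟨⟨⟨h1, h2⟩, h3⟩, h4⟩
    exact ⟨⟨hδ0.trans_le h1.1, h1.2.trans_lt hrR⟩, hη2.trans_le h2.1, h4⟩
  have hmB : ∀ p ∈ G, √(mm p) ≤ B := by
    rintro p ⟨⟨⟨h1, h2⟩, h3⟩, h4⟩
    apply Real.sqrt_le_sqrt
    have hp : 0 < p.1 := hδ0.trans_le h1.1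
    have h7 := mul_le_mul_of_nonneg_left (Real.sin_le_one (p.2 - θ₀)) (by positivity : 0 ≤ 2 * c * p.1)
    have h8 : p.1 ^ 2 ≤ r ^ 2 := by have := h1.2; gcongr
    have h9 := mul_le_mul_of_nonneg_left h1.2 (by positivity : 0 ≤ 2 * c)
    simp only [mm]
    linarith
  have hmem : ((ρ, θ) : ℝ × ℝ) ∈ G := by
    refine hG _ hρ.1 hρ.2 (by simp only [hγ]; linarith [hθ.1]) hθ.2 ?_
    have : 0 ≤ Real.sin (θ - θ₀) :=
      Real.sin_nonneg_of_nonneg_of_le_pi (by linarith [hθ.1]) (by linarith)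
    have hρ0 := hρ.1
    have : 0 ≤ 2 * c * ρ * Real.sin (θ - θ₀) := by positivity
    simp only [mm, hε]
    linarith
  obtain ⟨x, hxG, hmax⟩ := exists_max (K := K) (G := G) hK inter_subset_left ⟨_, hmem⟩
    (fun p => u (pol p) + √(mm p))
    (((upol_cont hu).mono hsub).add (by fun_prop)) (by
      intro x hxK hxG
      have hx2 : x.2 = β₂ := by
        by_contra hne
        exact hxG ⟨hxK, lt_of_le_of_ne hxK.1.2.2 hne⟩
      have hx1 := hxK.1.1
      have ht := (edge_tendsto hminus x ⟨hδ0.trans_le hx1.1, hx1.2.trans hrR.le⟩ hx2).mono_left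
        (nhdsWithin_mono _ hsub)
      refine tendsto_atBot_mono' _ ?_ (tendsto_atBot_add_const_right _ B ht)
      filter_upwards [self_mem_nhdsWithin] with p hp
      have := hmB p hp
      linarith)
  have hfin : u (pol x) + √(mm x) ≤ C + B := by
    have hx1 := hxG.1.1.1
    have hx2 := hxG.1.1.2
    have hx3 : 0 ≤ mm x := hxG.1.2
    have hx4 : x.2 < β₂ := hxG.2
    have hx0 : 0 < x.1 := hδ0.trans_le hx1.1
    rcases hx1.2.lt_or_eq with hlt | heq
    · exfalso
      have hγx : γ < x.2 := by
        refine lt_of_le_of_ne hx2.1 fun h => ?_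
        have h5 : x.2 - θ₀ = -η := by rw [← h, hγ]; ring
        simp only [mm, h5, Real.sin_neg] at hx3
        have : 2 * c * x.1 * -Real.sin η = - (2 * x.1 * r) := by rw [← hcs]; ring
        rw [this] at hx3
        nlinarith
      have hint := interior_pt hu x (hsub hxG)
      refine no_touch_hyp u (pol x) hint.1 hint.2 (c * Real.sin θ₀) (-c * Real.cos θ₀) (c ^ 2 + ε)
        (by positivity) m (fun y => rfl) (by rw [hm]; exact hx3) ?_
      rw [← pol_nhds x hx0, eventually_map]
      have hnb : Ioo 0 r ×ˢ Ioo γ β₂ ∈ 𝓝 x :=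
        (isOpen_Ioo.prod isOpen_Ioo).mem_nhds ⟨⟨hx0, hlt⟩, hγx, hx4⟩
      filter_upwards [hnb] with p hp hmp
      rw [hm] at hmp ⊢
      rw [hm]
      exact hmax p (hG p hp.1.1 hp.1.2.le hp.2.1.le hp.2.2 hmp)
    · have e : x = (r, x.2) := Prod.ext heq rfl
      have := hC x.2 ⟨hx2.1, hx4⟩
      rw [← e] at this
      linarith [hmB x hxG]
  have h5 := hmax _ hmem
  have h6 := Real.sqrt_nonneg (mm (ρ, θ))
  linarith

lemma upper_i {β₁ β₂ R : ℝ} {u : ℝ × ℝ → ℝ} (h2π : β₂ - β₁ < 2 * π) (hR : 0 < R)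
    (hu : IsMSE u (polarSet (Ioo 0 R) (Ioo β₁ β₂)))
    (hminus : ∀ z ∈ polarSet (Ioc 0 R) {β₂},
      Tendsto u (𝓝[polarSet (Ioo 0 R) (Ioo β₁ β₂)] z) atBot)
    (α : ℝ) (hα : α ∈ Ioo β₁ β₂) :
    ∃ M, ∀ ρ ∈ Ioc 0 (R / 4), ∀ θ ∈ Ico α β₂, u (pol (ρ, θ)) ≤ M := by
  obtain ⟨M1, h1⟩ := upper_core hR hu hminus α hα.1 hα.2
  by_cases h : β₂ - π ≤ α
  · exact ⟨M1, fun ρ hρ θ hθ => h1 ρ hρ θ hθ (by linarith [hθ.2])⟩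
  · push Not at h
    obtain ⟨M2, h2⟩ := upper_core hR hu hminus (β₂ - π) (by linarith [hα.1]) (by linarith [Real.pi_pos])
    refine ⟨max M1 M2, fun ρ hρ θ hθ => ?_⟩
    by_cases hc : θ ≤ α + π
    · exact (h1 ρ hρ θ hθ hc).trans (le_max_left _ _)
    · push Not at hc
      exact (h2 ρ hρ θ ⟨by linarith [hα.1], hθ.2⟩ (by linarith [hθ.2])).trans (le_max_right _ _)

lemma upper_ii {β₁ β₂ R : ℝ} {u : ℝ × ℝ → ℝ} (hβ : β₁ < β₂) (h2π : β₂ - β₁ < 2 * π) (hR : 0 < R)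
    (hu : IsMSE u (polarSet (Ioo 0 R) (Ioo β₁ β₂)))
    (hminus : ∀ z ∈ polarSet (Ioc 0 R) {β₂},
      Tendsto u (𝓝[polarSet (Ioo 0 R) (Ioo β₁ β₂)] z) atBot)
    (M : ℝ) :
    ∃ α ∈ Ioo β₁ β₂, ∀ ρ ∈ Ioc 0 (R / 4), ∀ θ ∈ Ico α β₂, u (pol (ρ, θ)) ≤ M := by
  obtain ⟨C, hCM, hC⟩ : ∃ C, M ≤ C ∧ ∀ ρ ∈ Ioc 0 (R / 4), ∀ θ ∈ Ico ((β₁ + β₂) / 2) β₂,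
      u (pol (ρ, θ)) ≤ C := by
    obtain ⟨C, hC⟩ := upper_i h2π hR hu hminus ((β₁ + β₂) / 2) ⟨by linarith, by linarith⟩
    exact ⟨max M C, le_max_left _ _, fun ρ hρ θ hθ => (hC ρ hρ θ hθ).trans (le_max_right _ _)⟩
  set r := R / 4 with hr
  have hr0 : 0 < r := by positivity
  have hrR : r < R := by rw [hr]; linarith
  -- smallness on the arc
  obtain ⟨d, hd0, hd⟩ : ∃ d > 0, ∀ θ ∈ Ioo (β₂ - d) β₂, θ ∈ Ioo β₁ β₂ → u (pol (r, θ)) ≤ M - 1 := by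
    have h := (edge_tendsto hminus (r, β₂) ⟨hr0, hrR.le⟩ rfl).eventually (eventually_le_atBot (M - 1))
    rw [eventually_nhdsWithin_iff] at h
    have hc : Continuous fun θ : ℝ => ((r, θ) : ℝ × ℝ) := by fun_prop
    have h' := (hc.tendsto β₂).eventually h
    rw [Metric.eventually_nhds_iff] at h'
    obtain ⟨d, hd0, hd⟩ := h'
    refine ⟨d, hd0, fun θ hθ hθ2 => hd ?_ ⟨⟨hr0, hrR⟩, hθ2⟩⟩
    rw [Real.dist_eq, abs_lt]
    exact ⟨by linarith [hθ.1], by linarith [hθ.2]⟩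
  obtain ⟨φ, hφ0, hφ1, hφ2, hφ3⟩ : ∃ φ : ℝ, 0 < φ ∧ φ < π / 4 ∧ φ < d ∧ φ < (β₂ - β₁) / 2 := by
    refine ⟨min (π / 4) (min d ((β₂ - β₁) / 2)) / 2, ?_, ?_, ?_, ?_⟩
    · have : 0 < min (π / 4) (min d ((β₂ - β₁) / 2)) :=
        lt_min (by positivity) (lt_min hd0 (by linarith))
      linarith
    all_goals
      have h1 : 0 < min (π / 4) (min d ((β₂ - β₁) / 2)) :=
        lt_min (by positivity) (lt_min hd0 (by linarith))
      have h2 := min_le_left (π / 4) (min d ((β₂ - β₁) / 2))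
      have h3 := min_le_right (π / 4) (min d ((β₂ - β₁) / 2))
      have h4 := min_le_left d ((β₂ - β₁) / 2)
      have h5 := min_le_right d ((β₂ - β₁) / 2)
      linarith
  have hpi := Real.pi_pos
  set τ := Real.tan φ with hτ
  have hτ0 : 0 < τ := Real.tan_pos_of_pos_of_lt_pi_div_two hφ0 (by linarith)
  have hτ1 : τ < 1 := by
    rw [← Real.tan_pi_div_four]
    exact Real.tan_lt_tan_of_lt_of_lt_pi_div_two (by linarith) (by linarith) hφ1
  have hcosφ : 0 < Real.cos φ := Real.cos_pos_of_mem_Ioo ⟨by linarith, by linarith⟩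
  have hsinφ : Real.sin φ = τ * Real.cos φ := (Real.tan_mul_cos hcosφ.ne').symm
  set k := (C - M + 1) * (1 + τ) / τ with hk
  have hk0 : 0 < k := by
    have : 0 < C - M + 1 := by linarith
    positivity
  -- comparison
  have comp : ∀ ε > 0, ∀ ρ ∈ Ioc 0 r, ∀ θ ∈ Ico (β₂ - φ) β₂,
      ρ * Real.sin (β₂ - θ) ≤ τ * (ρ * Real.cos (β₂ - θ) - ε) →
      u (pol (ρ, θ)) ≤ (M - 1) + k * (ρ * Real.sin (β₂ - θ) /
        (ρ * Real.sin (β₂ - θ) + (ρ * Real.cos (β₂ - θ) - ε))) := by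
    intro ε hε ρ hρ θ hθ hρθ
    let N : ℝ × ℝ → ℝ := fun y => Real.sin β₂ * y.1 - Real.cos β₂ * y.2
    let T : ℝ × ℝ → ℝ := fun y => Real.cos β₂ * y.1 + Real.sin β₂ * y.2 - ε
    let NN : ℝ × ℝ → ℝ := fun p => p.1 * Real.sin (β₂ - p.2)
    let TT : ℝ × ℝ → ℝ := fun p => p.1 * Real.cos (β₂ - p.2) - ε
    have hNN : ∀ p, N (pol p) = NN p := by
      intro p; simp only [N, NN, pol, Real.sin_sub]; ring
    have hTT : ∀ p, T (pol p) = TT p := by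
      intro p; simp only [T, TT, pol, Real.cos_sub]; ring
    have hNc : Continuous NN := by simp only [NN]; fun_prop
    have hTc : Continuous TT := by simp only [TT]; fun_prop
    let K : Set (ℝ × ℝ) := (Icc ε r ×ˢ Icc (β₂ - φ) β₂) ∩ {p | NN p ≤ τ * TT p}
    let G : Set (ℝ × ℝ) := K ∩ {p | p.2 < β₂}
    have hK : IsCompact K :=
      (isCompact_Icc.prod isCompact_Icc).inter_right (isClosed_le hNc (continuous_const.mul hTc))
    have hNpos : ∀ p : ℝ × ℝ, 0 < p.1 → β₂ - φ ≤ p.2 → p.2 < β₂ → 0 < NN p := by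
      intro p h1 h2 h3
      exact mul_pos h1 (Real.sin_pos_of_pos_of_lt_pi (by linarith) (by linarith))
    have hG : ∀ p : ℝ × ℝ, 0 < p.1 → p.1 ≤ r → β₂ - φ ≤ p.2 → p.2 < β₂ → NN p ≤ τ * TT p → p ∈ G := by
      intro p h1 h2 h3 h4 h5
      refine ⟨⟨⟨⟨?_, h2⟩, h3, h4.le⟩, h5⟩, h4⟩
      have h6 : 0 < τ * TT p := (hNpos p h1 h3 h4).trans_le h5
      have h7 : 0 < TT p := pos_of_mul_pos_right h6 hτ0.le
      have h8 := mul_le_mul_of_nonneg_left (Real.cos_le_one (β₂ - p.2)) h1.le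
      simp only [TT] at h7
      linarith
    have hpos : ∀ p ∈ G, 0 < p.1 ∧ 0 < NN p ∧ 0 < TT p := by
      rintro p ⟨⟨⟨h1, h2⟩, h3⟩, h4⟩
      have h0 := hε.trans_le h1.1
      have h5 := hNpos p h0 h2.1 h4
      exact ⟨h0, h5, pos_of_mul_pos_right (h5.trans_le h3) hτ0.le⟩
    have hsub : G ⊆ Ioo 0 R ×ˢ Ioo β₁ β₂ := by
      rintro p ⟨⟨⟨h1, h2⟩, h3⟩, h4⟩
      exact ⟨⟨hε.trans_le h1.1, h1.2.trans_lt hrR⟩, by linarith [h2.1], h4⟩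
    have hmem : ((ρ, θ) : ℝ × ℝ) ∈ G := hG _ hρ.1 hρ.2 hθ.1 hθ.2 hρθ
    obtain ⟨x, hxG, hmax⟩ := exists_max (K := K) (G := G) hK inter_subset_left ⟨_, hmem⟩
      (fun p => u (pol p) - ((M - 1) + k * (NN p / (NN p + TT p))))
      (((upol_cont hu).mono hsub).sub (continuousOn_const.add (continuousOn_const.mul
        (hNc.continuousOn.div (hNc.add hTc).continuousOn (fun p hp => by
          have := hpos p hp
          exact (add_pos this.2.1 this.2.2).ne'))))) (by
        intro x hxK hxG
        have hx2 : x.2 = β₂ := by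
          by_contra hne
          exact hxG ⟨hxK, lt_of_le_of_ne hxK.1.2.2 hne⟩
        have hx1 := hxK.1.1
        have ht := (edge_tendsto hminus x ⟨hε.trans_le hx1.1, hx1.2.trans hrR.le⟩ hx2).mono_left
          (nhdsWithin_mono _ hsub)
        refine tendsto_atBot_mono' _ ?_ (tendsto_atBot_add_const_right _ (-(M - 1)) ht)
        filter_upwards [self_mem_nhdsWithin] with p hp
        obtain ⟨-, h1, h2⟩ := hpos p hp
        have : 0 ≤ k * (NN p / (NN p + TT p)) := by positivity
        linarith)
    have hfin : u (pol x) - ((M - 1) + k * (NN x / (NN x + TT x))) ≤ 0 := by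
      have hx1 := hxG.1.1.1
      have hx2 := hxG.1.1.2
      have hx3 : NN x ≤ τ * TT x := hxG.1.2
      have hx4 : x.2 < β₂ := hxG.2
      obtain ⟨hx0, hxN, hxT⟩ := hpos x hxG
      have hwpos : 0 ≤ k * (NN x / (NN x + TT x)) := by positivity
      rcases hx1.2.lt_or_eq with hlt | heq
      · rcases hx3.lt_or_eq with hlt3 | heq3
        · exfalso
          have hγx : β₂ - φ < x.2 := by
            refine lt_of_le_of_ne hx2.1 fun h => ?_
            have h5 : β₂ - x.2 = φ := by rw [← h]; ring
            simp only [NN, TT, h5, hsinφ] at hlt3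
            nlinarith [mul_pos hτ0 hε]
          have hint := interior_pt hu x (hsub hxG)
          refine no_touch_wedge u (pol x) hint.1 hint.2 (Real.sin β₂) (Real.cos β₂) ε (M - 1) k
            (Real.sin_sq_add_cos_sq β₂) hk0 N T (fun y => rfl) (fun y => rfl)
            (by rw [hNN]; exact hxN.le) (by rw [hNN, hTT]; nlinarith) ?_
          rw [← pol_nhds x hx0, eventually_map]
          have hnb : Ioo 0 r ×ˢ Ioo (β₂ - φ) β₂ ∈ 𝓝 x :=
            (isOpen_Ioo.prod isOpen_Ioo).mem_nhds ⟨⟨hx0, hlt⟩, hγx, hx4⟩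
          have hnb2 : ∀ᶠ p in 𝓝 x, NN p < τ * TT p :=
            (isOpen_lt hNc (continuous_const.mul hTc)).mem_nhds hlt3
          filter_upwards [hnb, hnb2] with p hp hp2
          rw [hNN, hTT, hNN, hTT]
          exact hmax p (hG p hp.1.1 hp.1.2.le hp.2.1.le hp.2.2 hp2.le)
        · have h5 := hC x.1 ⟨hx0, hx1.2⟩ x.2 ⟨by linarith [hx2.1], hx4⟩
          have h6 : k * (NN x / (NN x + TT x)) = C - M + 1 := by
            rw [heq3, hk]
            field_simp
            ring
          rw [h6]
          have h7 : ((x.1, x.2) : ℝ × ℝ) = x := rfl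
          rw [h7] at h5
          linarith
      · have e : x = (r, x.2) := Prod.ext heq rfl
        have := hd x.2 ⟨by linarith [hx2.1], hx4⟩ ⟨by linarith [hx2.1], hx4⟩
        rw [← e] at this
        linarith
    have h5 := hmax _ hmem
    have h6 := h5.trans hfin
    simp only [NN, TT] at h6
    linarith
  -- conclusion
  set κ := min (τ / 2) (1 / (2 * k)) with hκ
  have hκ0 : 0 < κ := lt_min (by positivity) (by positivity)
  set ω := min φ (Real.arctan κ) with hω
  have hω0 : 0 < ω := lt_min hφ0 (Real.arctan_pos.2 hκ0)
  have hωφ : ω ≤ φ := min_le_left _ _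
  refine ⟨β₂ - ω, ⟨by linarith, by linarith⟩, ?_⟩
  intro ρ hρ θ hθ
  have hw0 : 0 < β₂ - θ := by linarith [hθ.2]
  have hw1 : β₂ - θ ≤ ω := by linarith [hθ.1]
  have hcos : 0 < Real.cos (β₂ - θ) := Real.cos_pos_of_mem_Ioo ⟨by linarith, by linarith⟩
  have hsin : 0 < Real.sin (β₂ - θ) := Real.sin_pos_of_pos_of_lt_pi hw0 (by linarith)
  have htan : Real.sin (β₂ - θ) ≤ κ * Real.cos (β₂ - θ) := by
    have h1 : Real.tan (β₂ - θ) ≤ κ := by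
      rw [← Real.tan_arctan κ]
      refine Real.strictMonoOn_tan.monotoneOn ⟨by linarith, by linarith⟩
        ⟨Real.neg_pi_div_two_lt_arctan _, Real.arctan_lt_pi_div_two _⟩
        (hw1.trans (min_le_right _ _))
    rw [← Real.tan_mul_cos hcos.ne']
    exact mul_le_mul_of_nonneg_right h1 hcos.le
  have hρ0 := hρ.1
  set S := ρ * Real.sin (β₂ - θ) with hS
  set Q := ρ * Real.cos (β₂ - θ) with hQ
  have hS0 : 0 < S := by positivity
  have hQ0 : 0 < Q := by positivity
  have hSQ : S ≤ κ * Q := by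
    have := mul_le_mul_of_nonneg_left htan hρ0.le
    rw [hS, hQ]; linarith
  have hκ1 : κ ≤ τ / 2 := min_le_left _ _
  have hκ2 : κ ≤ 1 / (2 * k) := min_le_right _ _
  have h := comp (Q / 2) (by positivity) ρ hρ θ ⟨by linarith [hθ.1], hθ.2⟩ (by
    rw [← hS, ← hQ]
    nlinarith [mul_le_mul_of_nonneg_right hκ1 hQ0.le])
  rw [← hS, ← hQ] at h
  have h3 : k * (S / (S + (Q - Q / 2))) ≤ 1 := by
    have h4 : k * κ ≤ 1 / 2 := by
      have := mul_le_mul_of_nonneg_left hκ2 hk0.le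
      have e : k * (1 / (2 * k)) = 1 / 2 := by field_simp
      linarith
    have h5 : 0 < S + (Q - Q / 2) := by linarith
    rw [← mul_div_assoc, div_le_one h5]
    have h6 := mul_le_mul_of_nonneg_left hSQ hk0.le
    have h7 := mul_le_mul_of_nonneg_right h4 hQ0.le
    linarith
  linarith

/-- reflection -/
def refl2 (y : ℝ × ℝ) : ℝ × ℝ := (y.1, -y.2)

lemma pd1_refl (F : ℝ × ℝ → ℝ) (y : ℝ × ℝ) :
    pd1 (fun y => -F (refl2 y)) y = -pd1 F (refl2 y) := by
  simp [pd1, refl2]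

lemma pd2_refl (F : ℝ × ℝ → ℝ) (y : ℝ × ℝ) :
    pd2 (fun y => F (refl2 y)) y = -pd2 F (refl2 y) := by
  simp only [pd2, refl2]
  exact deriv_comp_neg (fun t => F (y.1, t)) y.2

lemma pd2_refl_neg (F : ℝ × ℝ → ℝ) (y : ℝ × ℝ) :
    pd2 (fun y => -F (refl2 y)) y = pd2 F (refl2 y) := by
  rw [pd2_refl (fun y => -F y) y]
  simp [pd2]

lemma pol_refl (ρ θ : ℝ) : pol (ρ, -θ) = refl2 (pol (ρ, θ)) := by
  simp [pol, refl2]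

lemma refl2_refl2 (y : ℝ × ℝ) : refl2 (refl2 y) = y := by simp [refl2]

lemma refl2_mem (A B B' : Set ℝ) (hB : ∀ θ ∈ B, -θ ∈ B') (y : ℝ × ℝ) (hy : y ∈ polarSet A B) :
    refl2 y ∈ polarSet A B' := by
  obtain ⟨⟨ρ, θ⟩, h, rfl⟩ := hy
  exact ⟨(ρ, -θ), ⟨h.1, hB θ h.2⟩, pol_refl ρ θ⟩

lemma mse_refl {β₁ β₂ R : ℝ} {u : ℝ × ℝ → ℝ}
    (hu : IsMSE u (polarSet (Ioo 0 R) (Ioo β₁ β₂))) :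
    IsMSE (fun y => -u (refl2 y)) (polarSet (Ioo 0 R) (Ioo (-β₂) (-β₁))) := by
  have hmem : ∀ y ∈ polarSet (Ioo 0 R) (Ioo (-β₂) (-β₁)),
      refl2 y ∈ polarSet (Ioo 0 R) (Ioo β₁ β₂) :=
    refl2_mem _ _ _ (fun θ hθ => ⟨by linarith [hθ.2], by linarith [hθ.1]⟩)
  have hc : ContDiff ℝ 2 refl2 := by unfold refl2; fun_prop
  refine ⟨(hu.1.comp hc.contDiffOn hmem).neg, fun z hz => ?_⟩
  have h := hu.2 _ (hmem z hz)
  have e1 : pd1 (fun y => -u (refl2 y)) = fun y => -pd1 u (refl2 y) := funext (pd1_refl u)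
  have e2 : pd2 (fun y => -u (refl2 y)) = fun y => pd2 u (refl2 y) := funext (pd2_refl_neg u)
  rw [e1, e2, pd1_refl, pd2_refl_neg, pd2_refl]
  linear_combination -h

lemma edge_refl {β₁ β₂ R : ℝ} {u : ℝ × ℝ → ℝ}
    (hplus : ∀ z ∈ polarSet (Ioc 0 R) {β₁},
      Tendsto u (𝓝[polarSet (Ioo 0 R) (Ioo β₁ β₂)] z) atTop) :
    ∀ z ∈ polarSet (Ioc 0 R) {-β₁},
      Tendsto (fun y => -u (refl2 y)) (𝓝[polarSet (Ioo 0 R) (Ioo (-β₂) (-β₁))] z) atBot := by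
  intro z hz
  have hz' : refl2 z ∈ polarSet (Ioc 0 R) {β₁} :=
    refl2_mem _ _ _ (fun θ hθ => by simp only [mem_singleton_iff] at hθ ⊢; linarith) z hz
  have hc : Continuous refl2 := by unfold refl2; fun_prop
  refine tendsto_neg_atTop_atBot.comp ((hplus _ hz').comp ?_)
  exact hc.continuousAt.continuousWithinAt.tendsto_nhdsWithin
    (refl2_mem _ _ _ (fun θ hθ => ⟨by linarith [hθ.2], by linarith [hθ.1]⟩))

/-- Boundedness of a solution of the minimal surfaces equation near the vertex of a
sector on which it takes the boundary values `+∞` on the edge `θ = β₁` and `−∞` on the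
edge `θ = β₂` (Lemma on pseudo Scherk comparison): on every strictly smaller subsector
of radius `R/4` the solution is bounded on the appropriate side, and it tends to `±∞`
uniformly in sufficiently thin subsectors along the corresponding edges. -/
theorem sector_bounds
    (β₁ β₂ R : ℝ) (hβ : β₁ < β₂) (h2π : β₂ - β₁ < 2 * π) (hR : 0 < R)
    (Ω : Set (ℝ × ℝ)) (hΩ : Ω = polarSet (Ioo 0 R) (Ioo β₁ β₂))
    (u : ℝ × ℝ → ℝ) (hu : IsMSE u Ω)
    (hplus : ∀ z ∈ polarSet (Ioc 0 R) {β₁}, Tendsto u (𝓝[Ω] z) atTop)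
    (hminus : ∀ z ∈ polarSet (Ioc 0 R) {β₂}, Tendsto u (𝓝[Ω] z) atBot) :
    (∀ α ∈ Ioo β₁ β₂, ∃ M M' : ℝ,
      (∀ z ∈ polarSet (Ioc 0 (R / 4)) (Ico α β₂), u z ≤ M) ∧
      (∀ z ∈ polarSet (Ioc 0 (R / 4)) (Ioc β₁ α), M' ≤ u z)) ∧
    (∀ M : ℝ, ∃ α ∈ Ioo β₁ β₂, ∃ α' ∈ Ioo β₁ β₂,
      (∀ z ∈ polarSet (Ioc 0 (R / 4)) (Ioc β₁ α), M ≤ u z) ∧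
      (∀ z ∈ polarSet (Ioc 0 (R / 4)) (Ico α' β₂), u z ≤ M)) := by
  subst hΩ
  have hv := mse_refl hu
  have hvm := edge_refl hplus
  have hpiv : -β₁ - -β₂ < 2 * π := by linarith
  refine ⟨fun α hα => ?_, fun M => ?_⟩
  · obtain ⟨M, hM⟩ := upper_i h2π hR hu hminus α hα
    obtain ⟨M', hM'⟩ := upper_i hpiv hR hv hvm (-α) ⟨by linarith [hα.2], by linarith [hα.1]⟩
    refine ⟨M, -M', ?_, ?_⟩
    · rintro _ ⟨⟨ρ, θ⟩, ⟨h1, h2⟩, rfl⟩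
      exact hM ρ h1 θ h2
    · rintro _ ⟨⟨ρ, θ⟩, ⟨h1, h2⟩, rfl⟩
      have := hM' ρ h1 (-θ) ⟨by linarith [h2.2], by linarith [h2.1]⟩
      rw [pol_refl, refl2_refl2] at this
      simp only [pol] at this
      linarith
  · obtain ⟨α', hα', h'⟩ := upper_ii hβ h2π hR hu hminus M
    obtain ⟨α, hα, h⟩ := upper_ii (by linarith) hpiv hR hv hvm (-M)
    refine ⟨-α, ⟨by linarith [hα.2], by linarith [hα.1]⟩, α', hα', ?_, ?_⟩
    · rintro _ ⟨⟨ρ, θ⟩, ⟨h1, h2⟩, rfl⟩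
      have := h ρ h1 (-θ) ⟨by linarith [h2.2], by linarith [h2.1]⟩
      rw [pol_refl, refl2_refl2] at this
      simp only [pol] at this
      linarith
    · rintro _ ⟨⟨ρ, θ⟩, ⟨h1, h2⟩, rfl⟩
      exact h' ρ h1 θ h2
end

section
/- For every M > 0 and every d > 0 there exists R > 0, depending only on M and d, with the following property: for every open set Ω ⊆ ℝ², every C² solution u of the minimal surfaces equation in Ω, and every P ∈ Ω with dist(P, ∂Ω) ≥ d and W(P) ≤ M, one has W(Q) ≤ 2M for every Q in the open disk of center P and radius R. In particular, if (u_n) is a sequence of solutions on Ω and (W_n(P)) is bounded by M, then (W_n) is uniformly bounded by 2M on D(P, R). -/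
open Real Filter Set Topology MeasureTheory

/-- The symmetric real-linear map of `ℂ = ℝ²` with matrix `(a b; b c)`. -/
noncomputable def symL (a b c : ℝ) : ℂ →L[ℝ] ℂ :=
  a • (Complex.reCLM.smulRight (1:ℂ)) +
  b • (Complex.imCLM.smulRight (1:ℂ) + Complex.reCLM.smulRight Complex.I) +
  c • (Complex.imCLM.smulRight Complex.I)

lemma symL_re (a b c : ℝ) (v : ℂ) : (symL a b c v).re = a * v.re + b * v.im := by
  simp [symL]

lemma symL_im (a b c : ℝ) (v : ℂ) : (symL a b c v).im = b * v.re + c * v.im := by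
  simp [symL]

/-- Invertibility of `symL`. -/
noncomputable def symE (a b c : ℝ) (h : a * c - b ^ 2 ≠ 0) : ℂ ≃L[ℝ] ℂ :=
  ContinuousLinearEquiv.equivOfInverse (symL a b c)
    (symL (c / (a * c - b ^ 2)) (-b / (a * c - b ^ 2)) (a / (a * c - b ^ 2)))
    (by
      intro v
      generalize hD : a * c - b ^ 2 = D at *
      apply Complex.ext <;> simp only [symL_re, symL_im] <;> field_simp <;> rw [← hD] <;> ring)
    (by
      intro v
      generalize hD : a * c - b ^ 2 = D at *
      apply Complex.ext <;> simp only [symL_re, symL_im] <;> field_simp <;> rw [← hD] <;> ring)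

lemma symE_coe (a b c : ℝ) (h : a * c - b ^ 2 ≠ 0) :
    ((symE a b c h : ℂ ≃L[ℝ] ℂ) : ℂ →L[ℝ] ℂ) = symL a b c := by
  ext v; rfl

lemma norm_symL_le (a b c K : ℝ) (ha : |a| ≤ K) (hb : |b| ≤ K) (hc : |c| ≤ K) (v : ℂ) :
    ‖symL a b c v‖ ≤ 4 * K * ‖v‖ := by
  have hK : 0 ≤ K := (abs_nonneg _).trans ha
  refine (Complex.norm_le_abs_re_add_abs_im _).trans ?_
  rw [symL_re, symL_im]
  have h1 := Complex.abs_re_le_norm v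
  have h2 := Complex.abs_im_le_norm v
  have e : ∀ x y : ℝ, |x| ≤ K → |y| ≤ ‖v‖ → |x * y| ≤ K * ‖v‖ := by
    intro x y hx hy
    rw [abs_mul]
    exact mul_le_mul hx hy (abs_nonneg _) hK
  have := abs_add_le (a * v.re) (b * v.im)
  have := abs_add_le (b * v.re) (c * v.im)
  linarith [e _ _ ha h1, e _ _ hb h2, e _ _ hb h1, e _ _ hc h2]

lemma expanding {P : ℂ} {d : ℝ} {F : ℂ → ℂ} {a b c : ℂ → ℝ}
    (hF : ∀ z ∈ Metric.ball P d, HasFDerivAt F (symL (1 + a z) (b z) (1 + c z)) z)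
    (hdet : ∀ z ∈ Metric.ball P d, a z * c z - b z ^ 2 = 1)
    (ha : ∀ z ∈ Metric.ball P d, 0 < a z)
    {z w : ℂ} (hz : z ∈ Metric.ball P d) (hw : w ∈ Metric.ball P d) :
    dist z w ≤ dist (F z) (F w) := by
  set v := z - w with hv
  have hseg : ∀ t ∈ Icc (0:ℝ) 1, w + (t:ℂ) * v ∈ Metric.ball P d := by
    intro t ht
    have := (convex_ball P d).add_smul_sub_mem hw hz ht
    simpa [hv] using this
  let g : ℝ → ℝ := fun t => (F (w + (t:ℂ) * v) * starRingEnd ℂ v).re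
  have hg : ∀ t ∈ Icc (0:ℝ) 1, HasDerivAt g
      ((symL (1 + a (w + (t:ℂ) * v)) (b (w + (t:ℂ) * v)) (1 + c (w + (t:ℂ) * v)) v
        * starRingEnd ℂ v).re) t := by
    intro t ht
    have h1 : HasDerivAt (fun t : ℝ => w + (t:ℂ) * v) v t := by
      have := ((Complex.ofRealCLM.hasDerivAt (x := t)).mul_const v).const_add w
      simpa using this
    have h2 := (hF _ (hseg t ht)).comp_hasDerivAt t h1
    have h3 := h2.mul_const (starRingEnd ℂ v)
    exact Complex.reCLM.hasFDerivAt.comp_hasDerivAt t h3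
  obtain ⟨t, ht, hs⟩ := exists_hasDerivAt_eq_slope g _ (zero_lt_one)
    (fun t ht => (hg t ht).continuousAt.continuousWithinAt)
    (fun t ht => hg t (Ioo_subset_Icc_self ht))
  have hm := hseg t (Ioo_subset_Icc_self ht)
  set y := w + (t:ℂ) * v
  have hlow : ‖v‖ ^ 2 ≤ (symL (1 + a y) (b y) (1 + c y) v * starRingEnd ℂ v).re := by
    rw [Complex.mul_re, symL_re, symL_im, Complex.conj_re, Complex.conj_im, Complex.sq_norm,
      Complex.normSq_apply]
    have h1 := ha y hm
    have h2 := hdet y hm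
    have h3 : 0 ≤ a y * (a y * v.re ^ 2 + 2 * b y * v.re * v.im + c y * v.im ^ 2) := by
      have : a y * (a y * v.re ^ 2 + 2 * b y * v.re * v.im + c y * v.im ^ 2)
        = (a y * v.re + b y * v.im) ^ 2 + (a y * c y - b y ^ 2) * v.im ^ 2 := by ring
      rw [this, h2]; positivity
    have h4 := nonneg_of_mul_nonneg_right h3 h1
    nlinarith
  have hup : g 1 - g 0 ≤ ‖F z - F w‖ * ‖v‖ := by
    have : g 1 - g 0 = ((F z - F w) * starRingEnd ℂ v).re := by
      simp only [g, hv, sub_mul]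
      simp
    rw [this]
    refine (Complex.re_le_norm _).trans ?_
    simp
  rw [hs] at hlow
  have h5 : ‖v‖ * ‖v‖ ≤ ‖F z - F w‖ * ‖v‖ := by
    have : (g 1 - g 0) / (1 - 0) = g 1 - g 0 := by ring
    rw [this] at hlow
    nlinarith
  rw [dist_eq_norm, dist_eq_norm]
  by_cases h0 : ‖v‖ = 0
  · rw [← hv, h0]; positivity
  · exact le_of_mul_le_mul_right h5 (lt_of_le_of_ne (norm_nonneg _) (Ne.symm h0))

lemma surj_ball {P : ℂ} {d : ℝ} (hd : 0 < d) {F : ℂ → ℂ} {a b c : ℂ → ℝ}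
    (hF : ∀ z ∈ Metric.ball P d, HasFDerivAt F (symL (1 + a z) (b z) (1 + c z)) z)
    (hac : ContinuousOn a (Metric.ball P d)) (hbc : ContinuousOn b (Metric.ball P d))
    (hcc : ContinuousOn c (Metric.ball P d))
    (hdet : ∀ z ∈ Metric.ball P d, a z * c z - b z ^ 2 = 1)
    (ha : ∀ z ∈ Metric.ball P d, 0 < a z)
    (hc : ∀ z ∈ Metric.ball P d, 0 < c z) :
    Metric.ball (F P) d ⊆ F '' Metric.ball P d := by
  have hP : P ∈ Metric.ball P d := Metric.mem_ball_self hd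
  have hFc : ContinuousOn F (Metric.ball P d) :=
    fun z hz => (hF z hz).continuousAt.continuousWithinAt
  refine (convex_ball (F P) d).isPreconnected.subset_of_closure_inter_subset ?_ ?_ ?_
  · rw [isOpen_iff_mem_nhds]
    rintro _ ⟨z, hz, rfl⟩
    have hn : Metric.ball P d ∈ 𝓝 z := Metric.isOpen_ball.mem_nhds hz
    have hs : HasStrictFDerivAt F (symL (1 + a z) (b z) (1 + c z)) z := by
      refine hasStrictFDerivAt_of_hasFDerivAt_of_continuousAt
        (f' := fun z => symL (1 + a z) (b z) (1 + c z)) ?_ ?_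
      · filter_upwards [hn] with y hy using hF y hy
      · have h1 := hac.continuousAt hn
        have h2 := hbc.continuousAt hn
        have h3 := hcc.continuousAt hn
        unfold symL
        fun_prop
    have hne : (1 + a z) * (1 + c z) - b z ^ 2 ≠ 0 := by
      have := hdet z hz
      have := ha z hz
      have := hc z hz
      nlinarith
    rw [← symE_coe _ _ _ hne] at hs
    rw [← hs.map_nhds_eq_of_equiv]
    exact Filter.image_mem_map hn
  · exact ⟨F P, Metric.mem_ball_self hd, P, hP, rfl⟩
  · rintro ζ ⟨hζ, hζ'⟩
    rw [Metric.mem_ball] at hζ'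
    obtain ⟨ρ, hρ1, hρ2⟩ := exists_between hζ'
    have hK : IsCompact (F '' Metric.closedBall P ρ) :=
      (isCompact_closedBall P ρ).image_of_continuousOn
        (hFc.mono (Metric.closedBall_subset_ball hρ2))
    have : ζ ∈ closure (F '' Metric.closedBall P ρ) := by
      rw [mem_closure_iff_nhds] at hζ ⊢
      intro t ht
      obtain ⟨y, ⟨hyt, hyb⟩, z, hz, rfl⟩ := hζ (t ∩ Metric.ball (F P) ρ)
        (Filter.inter_mem ht (Metric.isOpen_ball.mem_nhds hρ1))
      refine ⟨F z, hyt, z, ?_, rfl⟩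
      exact (expanding hF hdet ha hz hP).trans (Metric.mem_ball.1 hyb).le
    rw [hK.isClosed.closure_eq] at this
    exact Set.image_mono (Metric.closedBall_subset_ball hρ2) this

lemma exists_hol {P : ℂ} {d : ℝ} (hd : 0 < d) {F : ℂ → ℂ} {a b c : ℂ → ℝ}
    (hF : ∀ z ∈ Metric.ball P d, HasFDerivAt F (symL (1 + a z) (b z) (1 + c z)) z)
    (hac : ContinuousOn a (Metric.ball P d)) (hbc : ContinuousOn b (Metric.ball P d))
    (hcc : ContinuousOn c (Metric.ball P d))
    (hdet : ∀ z ∈ Metric.ball P d, a z * c z - b z ^ 2 = 1)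
    (ha : ∀ z ∈ Metric.ball P d, 0 < a z)
    (hc : ∀ z ∈ Metric.ball P d, 0 < c z) :
    ∃ h : ℂ → ℂ, DifferentiableOn ℂ h (Metric.ball (F P) d) ∧
      ∀ z ∈ Metric.ball P d, F z ∈ Metric.ball (F P) d →
        h (F z) = (⟨(c z - a z) / (2 + a z + c z), 2 * b z / (2 + a z + c z)⟩ : ℂ) := by
  have hsurj := surj_ball hd hF hac hbc hcc hdet ha hc
  have hsurj' : ∀ ζ ∈ Metric.ball (F P) d, ∃ z, z ∈ Metric.ball P d ∧ F z = ζ :=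
    fun ζ hζ => hsurj hζ
  choose! G hG1 hG2 using hsurj'
  let w : ℂ → ℂ := fun ζ => starRingEnd ℂ (2 * G ζ - ζ)
  have hinj : ∀ z ∈ Metric.ball P d, F z ∈ Metric.ball (F P) d → G (F z) = z := by
    intro z hz hFz
    have := expanding hF hdet ha (hG1 _ hFz) hz
    rw [hG2 _ hFz, dist_self] at this
    exact dist_le_zero.1 this
  have hder : ∀ ζ ∈ Metric.ball (F P) d, HasDerivAt w
      (⟨(c (G ζ) - a (G ζ)) / (2 + a (G ζ) + c (G ζ)),
        2 * b (G ζ) / (2 + a (G ζ) + c (G ζ))⟩ : ℂ) ζ := by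
    intro ζ hζ
    have hn : Metric.ball (F P) d ∈ 𝓝 ζ := Metric.isOpen_ball.mem_nhds hζ
    have hz := hG1 ζ hζ
    have h0 := hdet _ hz
    have h1 := ha _ hz
    have h2 := hc _ hz
    have hne : (1 + a (G ζ)) * (1 + c (G ζ)) - b (G ζ) ^ 2 ≠ 0 := by nlinarith
    have hcont : ContinuousAt G ζ := by
      have hl : LipschitzOnWith 1 G (Metric.ball (F P) d) := by
        refine LipschitzOnWith.of_dist_le_mul fun x hx y hy => ?_
        have := expanding hF hdet ha (hG1 _ hx) (hG1 _ hy)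
        rw [hG2 _ hx, hG2 _ hy] at this
        simpa using this
      exact hl.continuousOn.continuousAt hn
    have hF' := hF _ hz
    rw [← symE_coe _ _ _ hne] at hF'
    have hG' := HasFDerivAt.of_local_left_inverse hcont hF'
      (by filter_upwards [hn] with y hy using hG2 y hy)
    have hw : HasFDerivAt w _ ζ :=
      (Complex.conjCLE.toContinuousLinearMap.hasFDerivAt).comp ζ
        ((hG'.const_mul 2).sub (hasFDerivAt_id ζ))
    rw [hasDerivAt_iff_hasFDerivAt]
    refine hasFDerivAt_of_restrictScalars ℝ hw ?_
    have hD : (1 + a (G ζ)) * (1 + c (G ζ)) - b (G ζ) ^ 2 = 2 + a (G ζ) + c (G ζ) := by linarith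
    have hD' : 2 + a (G ζ) + c (G ζ) ≠ 0 := by positivity
    have hsy : ∀ v, (symE (1 + a (G ζ)) (b (G ζ)) (1 + c (G ζ)) hne).symm v
      = symL ((1 + c (G ζ)) / (2 + a (G ζ) + c (G ζ))) (-b (G ζ) / (2 + a (G ζ) + c (G ζ)))
        ((1 + a (G ζ)) / (2 + a (G ζ) + c (G ζ))) v := by
      intro v
      rw [← hD]; rfl
    refine ContinuousLinearMap.ext fun v => ?_
    apply Complex.ext
    · simp [hsy, symL_re, symL_im]
      field_simp
      ring
    · simp [hsy, symL_re, symL_im]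
      field_simp
      ring
  refine ⟨deriv w, ?_, ?_⟩
  · exact DifferentiableOn.deriv
      (fun ζ hζ => (hder ζ hζ).differentiableAt.differentiableWithinAt) Metric.isOpen_ball
  · intro z hz hFz
    rw [(hder _ hFz).deriv, hinj z hz hFz]

lemma pd1_eq {f : ℝ × ℝ → ℝ} {z : ℝ × ℝ} {D : ℝ × ℝ →L[ℝ] ℝ} (h : HasFDerivAt f D z) :
    pd1 f z = D (1, 0) := by
  have h1 : HasDerivAt (fun t : ℝ => (t, z.2)) ((1:ℝ), (0:ℝ)) z.1 :=
    (hasDerivAt_id _).prodMk (hasDerivAt_const _ _)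
  have h2 : HasDerivAt (fun t => f (t, z.2)) (D (1, 0)) z.1 :=
    HasFDerivAt.comp_hasDerivAt (l := f) z.1 (by exact h) h1
  exact h2.deriv

lemma pd2_eq {f : ℝ × ℝ → ℝ} {z : ℝ × ℝ} {D : ℝ × ℝ →L[ℝ] ℝ} (h : HasFDerivAt f D z) :
    pd2 f z = D (0, 1) := by
  have h1 : HasDerivAt (fun t : ℝ => (z.1, t)) ((0:ℝ), (1:ℝ)) z.2 :=
    (hasDerivAt_const _ _).prodMk (hasDerivAt_id _)
  have h2 : HasDerivAt (fun t => f (z.1, t)) (D (0, 1)) z.2 :=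
    HasFDerivAt.comp_hasDerivAt (l := f) z.2 (by exact h) h1
  exact h2.deriv

lemma pd_deriv {u : ℝ × ℝ → ℝ} {Ω : Set (ℝ × ℝ)} (hΩ : IsOpen Ω) (hu : ContDiffOn ℝ 2 u Ω)
    {z : ℝ × ℝ} (hz : z ∈ Ω) : ∃ D1 D2 : ℝ × ℝ →L[ℝ] ℝ,
    HasFDerivAt (pd1 u) D1 z ∧ HasFDerivAt (pd2 u) D2 z ∧ D1 (0, 1) = D2 (1, 0) := by
  have hn := hΩ.mem_nhds hz
  have hdiff : ∀ y ∈ Ω, HasFDerivAt u (fderiv ℝ u y) y := fun y hy =>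
    ((hu.contDiffAt (hΩ.mem_nhds hy)).differentiableAt (by norm_num)).hasFDerivAt
  have h2 : HasFDerivAt (fderiv ℝ u) (fderiv ℝ (fderiv ℝ u) z) z :=
    (((hu.contDiffAt hn).fderiv_right (m := 1) (by norm_num)).differentiableAt
      (by norm_num)).hasFDerivAt
  have hsym := (hu.contDiffAt hn).isSymmSndFDerivAt (by simp)
  have ev : ∀ v : ℝ × ℝ, HasFDerivAt (fun y => fderiv ℝ u y v)
      ((ContinuousLinearMap.apply ℝ ℝ v).comp (fderiv ℝ (fderiv ℝ u) z)) z := fun v =>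
    (ContinuousLinearMap.apply ℝ ℝ v).hasFDerivAt.comp z h2
  refine ⟨_, _, (ev (1, 0)).congr_of_eventuallyEq ?_, (ev (0, 1)).congr_of_eventuallyEq ?_, ?_⟩
  · filter_upwards [hn] with y hy using pd1_eq (hdiff y hy)
  · filter_upwards [hn] with y hy using pd2_eq (hdiff y hy)
  · simpa using hsym (0, 1) (1, 0)

lemma form_closed {p q : ℂ → ℝ} {z : ℂ} {r s t : ℝ}
    (hp : HasFDerivAt p (r • Complex.reCLM + s • Complex.imCLM) z)
    (hq : HasFDerivAt q (s • Complex.reCLM + t • Complex.imCLM) z)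
    (hm : (1 + q z ^ 2) * r - 2 * p z * q z * s + (1 + p z ^ 2) * t = 0) :
    ∃ D : ℂ →L[ℝ] ℂ →L[ℝ] ℂ,
      HasFDerivAt (fun y => symL ((1 + p y ^ 2) / √(1 + p y ^ 2 + q y ^ 2))
        (p y * q y / √(1 + p y ^ 2 + q y ^ 2))
        ((1 + q y ^ 2) / √(1 + p y ^ 2 + q y ^ 2))) D z ∧ ∀ v w, D v w = D w v := by
  have hpos : 0 < 1 + p z ^ 2 + q z ^ 2 := by positivity
  have hp2 : HasFDerivAt (fun y => 1 + p y ^ 2)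
      ((2 * p z * r) • Complex.reCLM + (2 * p z * s) • Complex.imCLM) z := by
    refine ((hp.pow 2).const_add 1).congr_fderiv ?_
    ext <;> simp <;> ring
  have hq2 : HasFDerivAt (fun y => 1 + q y ^ 2)
      ((2 * q z * s) • Complex.reCLM + (2 * q z * t) • Complex.imCLM) z := by
    refine ((hq.pow 2).const_add 1).congr_fderiv ?_
    ext <;> simp <;> ring
  have hpq : HasFDerivAt (fun y => p y * q y)
      ((r * q z + p z * s) • Complex.reCLM + (s * q z + p z * t) • Complex.imCLM) z := by
    refine (hp.mul hq).congr_fderiv ?_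
    ext <;> simp <;> ring
  set W := √(1 + p z ^ 2 + q z ^ 2) with hW
  have hWpos : 0 < W := Real.sqrt_pos.2 hpos
  have hW2 : W ^ 2 = 1 + p z ^ 2 + q z ^ 2 := Real.sq_sqrt hpos.le
  have hWd : HasFDerivAt (fun y => √(1 + p y ^ 2 + q y ^ 2))
      (((p z * r + q z * s) / W) • Complex.reCLM + ((p z * s + q z * t) / W) • Complex.imCLM) z := by
    refine ((hp2.add (hq.pow 2)).sqrt hpos.ne').congr_fderiv ?_
    simp only [Pi.add_apply]
    rw [← hW]
    ext <;> simp <;> field_simp <;> ring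
  have quot : ∀ (f : ℂ → ℝ) (x y : ℝ), HasFDerivAt f (x • Complex.reCLM + y • Complex.imCLM) z →
      HasFDerivAt (fun y => f y / √(1 + p y ^ 2 + q y ^ 2))
       (((x * W ^ 2 - f z * (p z * r + q z * s)) / W ^ 3) • Complex.reCLM +
        ((y * W ^ 2 - f z * (p z * s + q z * t)) / W ^ 3) • Complex.imCLM) z := by
    intro f x y hf
    have hi := (hasDerivAt_inv (hW ▸ hWpos.ne')).comp_hasFDerivAt z hWd
    refine (hf.mul hi).congr_fderiv ?_
    simp only [Function.comp_apply]
    rw [← hW]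
    ext <;> simp <;> field_simp <;> ring
  have h1 := quot _ _ _ hp2
  have h2 := quot _ _ _ hpq
  have h3 := quot _ _ _ hq2
  refine ⟨_, ((h1.smul_const (Complex.reCLM.smulRight (1:ℂ))).add (h2.smul_const
    (Complex.imCLM.smulRight (1:ℂ) + Complex.reCLM.smulRight Complex.I))).add
    (h3.smul_const (Complex.imCLM.smulRight Complex.I)), ?_⟩
  have e1 : 2 * p z * s * W ^ 2 - (1 + p z ^ 2) * (p z * s + q z * t)
      = (r * q z + p z * s) * W ^ 2 - p z * q z * (p z * r + q z * s) := by
    rw [hW2]; linear_combination (-q z) * hm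
  have e2 : 2 * q z * s * W ^ 2 - (1 + q z ^ 2) * (p z * r + q z * s)
      = (s * q z + p z * t) * W ^ 2 - p z * q z * (p z * s + q z * t) := by
    rw [hW2]; linear_combination (-p z) * hm
  rw [e1, e2]
  intro v w
  apply Complex.ext <;> simp <;> ring

lemma exists_F {u : ℝ × ℝ → ℝ} {Ω : Set (ℝ × ℝ)} (hΩ : IsOpen Ω) (hu : IsMSE u Ω)
    {P : ℂ} {d : ℝ} (hP : ∀ z ∈ Metric.ball P d, (z.re, z.im) ∈ Ω) :
    ContinuousOn (fun z : ℂ => pd1 u (z.re, z.im)) (Metric.ball P d) ∧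
    ContinuousOn (fun z : ℂ => pd2 u (z.re, z.im)) (Metric.ball P d) ∧
    ∃ F : ℂ → ℂ, ∀ z ∈ Metric.ball P d, HasFDerivAt F (symL
      (1 + (1 + pd1 u (z.re, z.im) ^ 2) / Wg u (z.re, z.im))
      (pd1 u (z.re, z.im) * pd2 u (z.re, z.im) / Wg u (z.re, z.im))
      (1 + (1 + pd2 u (z.re, z.im) ^ 2) / Wg u (z.re, z.im))) z := by
  have key : ∀ z ∈ Metric.ball P d, ∃ r s t : ℝ,
      HasFDerivAt (fun z : ℂ => pd1 u (z.re, z.im)) (r • Complex.reCLM + s • Complex.imCLM) z ∧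
      HasFDerivAt (fun z : ℂ => pd2 u (z.re, z.im)) (s • Complex.reCLM + t • Complex.imCLM) z ∧
      (1 + pd2 u (z.re, z.im) ^ 2) * r - 2 * pd1 u (z.re, z.im) * pd2 u (z.re, z.im) * s
        + (1 + pd1 u (z.re, z.im) ^ 2) * t = 0 := by
    intro z hz
    obtain ⟨D1, D2, h1, h2, h3⟩ := pd_deriv hΩ hu.1 (hP z hz)
    have hm := hu.2 _ (hP z hz)
    rw [pd1_eq h1, pd2_eq h1, pd2_eq h2] at hm
    have hc : HasFDerivAt (fun z : ℂ => (z.re, z.im)) (Complex.reCLM.prod Complex.imCLM) z :=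
      Complex.reCLM.hasFDerivAt.prodMk Complex.imCLM.hasFDerivAt
    have ex : ∀ (D : ℝ × ℝ →L[ℝ] ℝ) (v : ℝ × ℝ), D v = v.1 * D (1, 0) + v.2 * D (0, 1) := by
      intro D v
      have : v = v.1 • ((1:ℝ), (0:ℝ)) + v.2 • ((0:ℝ), (1:ℝ)) := by ext <;> simp
      conv_lhs => rw [this]
      rw [map_add, map_smul, map_smul, smul_eq_mul, smul_eq_mul]
    refine ⟨D1 (1, 0), D1 (0, 1), D2 (0, 1), ?_, ?_, hm⟩
    · refine (HasFDerivAt.comp (g := pd1 u) z h1 hc).congr_fderiv ?_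
      refine ContinuousLinearMap.ext fun v => ?_
      simp only [ContinuousLinearMap.comp_apply]
      rw [ex]; simp; ring
    · refine (HasFDerivAt.comp (g := pd2 u) z h2 hc).congr_fderiv ?_
      refine ContinuousLinearMap.ext fun v => ?_
      simp only [ContinuousLinearMap.comp_apply]
      rw [ex, h3]; simp; ring
  refine ⟨fun z hz => ?_, fun z hz => ?_, ?_⟩
  · obtain ⟨r, s, t, h1, h2, h3⟩ := key z hz
    exact h1.continuousAt.continuousWithinAt
  · obtain ⟨r, s, t, h1, h2, h3⟩ := key z hz
    exact h2.continuousAt.continuousWithinAt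
  choose! r s t h1 h2 h3 using key
  have key2 := fun z hz => form_closed (h1 z hz) (h2 z hz) (h3 z hz)
  obtain ⟨Ψ, hΨ⟩ := (convex_ball P d).exists_forall_hasFDerivAt_of_fderiv_symmetric
    Metric.isOpen_ball (fun z hz => by
      obtain ⟨D, hD, -⟩ := key2 z hz
      exact hD.differentiableAt.differentiableWithinAt) (fun z hz v w => by
      obtain ⟨D, hD, hs⟩ := key2 z hz
      rw [hD.fderiv]; exact hs v w)
  refine ⟨fun z => z + Ψ z, fun z hz => ?_⟩
  refine ((hasFDerivAt_id z).add (hΨ z hz)).congr_fderiv ?_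
  refine ContinuousLinearMap.ext fun v => ?_
  apply Complex.ext
  · simp [symL_re, Wg]; ring
  · simp [symL_im, Wg]; ring

lemma one_le_Wg (u : ℝ × ℝ → ℝ) (z : ℝ × ℝ) : 1 ≤ Wg u z := by
  unfold Wg
  rw [Real.one_le_sqrt]
  nlinarith [sq_nonneg (pd1 u z), sq_nonneg (pd2 u z)]

lemma Wg_sq (u : ℝ × ℝ → ℝ) (z : ℝ × ℝ) : Wg u z ^ 2 = 1 + pd1 u z ^ 2 + pd2 u z ^ 2 :=
  Real.sq_sqrt (by positivity)

lemma norm_h {p q W : ℝ} (hW : 1 ≤ W) (h2 : W ^ 2 = 1 + p ^ 2 + q ^ 2) :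
    ‖(⟨((1 + q ^ 2) / W - (1 + p ^ 2) / W) / (2 + (1 + p ^ 2) / W + (1 + q ^ 2) / W),
      2 * (p * q / W) / (2 + (1 + p ^ 2) / W + (1 + q ^ 2) / W)⟩ : ℂ)‖ = (W - 1) / (W + 1) := by
  have h0 : 0 < W := by linarith
  have hD : 2 + (1 + p ^ 2) / W + (1 + q ^ 2) / W = (W + 1) ^ 2 / W := by
    field_simp
    linear_combination -h2
  rw [hD]
  have hn : 0 ≤ (W - 1) / (W + 1) := div_nonneg (by linarith) (by linarith)
  rw [← Real.sqrt_sq hn, Complex.norm_def, Complex.normSq_mk]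
  congr 1
  field_simp
  have e : (W - 1) ^ 2 * (W + 1) ^ 2 = (p ^ 2 + q ^ 2) ^ 2 := by
    have : (W - 1) ^ 2 * (W + 1) ^ 2 = (W ^ 2 - 1) ^ 2 := by ring
    rw [this, h2]; ring
  linear_combination -e

lemma final_step {M d : ℝ} (hM : 0 < M) (hd : 0 < d) {Ω : Set (ℝ × ℝ)} (hΩ : IsOpen Ω)
    {u : ℝ × ℝ → ℝ} (hu : IsMSE u Ω) {P : ℂ}
    (hP : ∀ z ∈ Metric.ball P d, (z.re, z.im) ∈ Ω) (hWP : Wg u (P.re, P.im) ≤ M)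
    {Q : ℂ} (hQ : ‖Q - P‖ < d * M / ((M + 1) * (2 * M + 1)) / (4 * (1 + 2 * M))) :
    Wg u (Q.re, Q.im) ≤ 2 * M := by
  obtain ⟨hpc, hqc, F, hF⟩ := exists_F hΩ hu hP
  set p : ℂ → ℝ := fun z => pd1 u (z.re, z.im) with hp
  set q : ℂ → ℝ := fun z => pd2 u (z.re, z.im) with hq
  set W : ℂ → ℝ := fun z => Wg u (z.re, z.im) with hW
  have hW1 : ∀ z, 1 ≤ W z := fun z => one_le_Wg u _
  have hW0 : ∀ z, 0 < W z := fun z => zero_lt_one.trans_le (hW1 z)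
  have hW2 : ∀ z, W z ^ 2 = 1 + p z ^ 2 + q z ^ 2 := fun z => Wg_sq u _
  have hWc : ContinuousOn W (Metric.ball P d) := by
    have : W = fun z => √(1 + p z ^ 2 + q z ^ 2) := rfl
    rw [this]
    fun_prop
  have hac : ContinuousOn (fun z => (1 + p z ^ 2) / W z) (Metric.ball P d) :=
    ContinuousOn.div (by fun_prop) hWc (fun z _ => (hW0 z).ne')
  have hbc : ContinuousOn (fun z => p z * q z / W z) (Metric.ball P d) :=
    ContinuousOn.div (by fun_prop) hWc (fun z _ => (hW0 z).ne')
  have hcc : ContinuousOn (fun z => (1 + q z ^ 2) / W z) (Metric.ball P d) :=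
    ContinuousOn.div (by fun_prop) hWc (fun z _ => (hW0 z).ne')
  have hdet : ∀ z ∈ Metric.ball P d, (1 + p z ^ 2) / W z * ((1 + q z ^ 2) / W z)
      - (p z * q z / W z) ^ 2 = 1 := by
    intro z _
    have := hW0 z
    field_simp
    linear_combination -hW2 z
  have ha : ∀ z ∈ Metric.ball P d, 0 < (1 + p z ^ 2) / W z :=
    fun z _ => div_pos (by positivity) (hW0 z)
  have hc : ∀ z ∈ Metric.ball P d, 0 < (1 + q z ^ 2) / W z :=
    fun z _ => div_pos (by positivity) (hW0 z)
  have hF' : ∀ z ∈ Metric.ball P d, HasFDerivAt F (symL (1 + (1 + p z ^ 2) / W z)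
      (p z * q z / W z) (1 + (1 + q z ^ 2) / W z)) z := hF
  have hsurj := surj_ball hd (a := fun z => (1 + p z ^ 2) / W z) (b := fun z => p z * q z / W z)
    (c := fun z => (1 + q z ^ 2) / W z) hF' hac hbc hcc hdet ha hc
  obtain ⟨h, hh, hval⟩ := exists_hol hd (a := fun z => (1 + p z ^ 2) / W z)
    (b := fun z => p z * q z / W z)
    (c := fun z => (1 + q z ^ 2) / W z) hF' hac hbc hcc hdet ha hc
  have hnorm : ∀ z ∈ Metric.ball P d, F z ∈ Metric.ball (F P) d →
      ‖h (F z)‖ = (W z - 1) / (W z + 1) := by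
    intro z hz hFz
    rw [hval z hz hFz]
    exact norm_h (hW1 z) (hW2 z)
  have hle1 : ∀ z, (W z - 1) / (W z + 1) ≤ 1 := by
    intro z
    have := hW0 z
    rw [div_le_one (by linarith)]; linarith
  have hPm : P ∈ Metric.ball P d := Metric.mem_ball_self hd
  have hFP : F P ∈ Metric.ball (F P) d := Metric.mem_ball_self hd
  have hmaps : MapsTo h (Metric.ball (F P) d) (Metric.closedBall (h (F P)) 2) := by
    intro ζ hζ
    obtain ⟨z, hz, rfl⟩ := hsurj hζ
    rw [Metric.mem_closedBall, dist_eq_norm]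
    refine (norm_sub_le _ _).trans ?_
    rw [hnorm z hz hζ, hnorm P hPm hFP]
    linarith [hle1 z, hle1 P]
  set r := d * M / ((M + 1) * (2 * M + 1)) with hr
  have hr0 : 0 < r := by positivity
  have hrd : r < d := by
    rw [hr, div_lt_iff₀ (by positivity)]
    nlinarith [mul_pos hd hM, mul_pos (mul_pos hd hM) hM]
  have hbound : ∀ z ∈ Metric.ball P d, ‖F z - F P‖ ≤ r → W z ≤ 2 * M := by
    intro z hz hzr
    have hFz : F z ∈ Metric.ball (F P) d := by
      rw [Metric.mem_ball, dist_eq_norm]; linarith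
    have h1 := Complex.dist_le_div_mul_dist_of_mapsTo_ball hh hmaps hFz
    rw [dist_eq_norm, dist_eq_norm] at h1
    have h2 : ‖h (F z)‖ ≤ ‖h (F P)‖ + 2 / d * r := by
      have h3 := norm_sub_norm_le (h (F z)) (h (F P))
      have h4 : 2 / d * ‖F z - F P‖ ≤ 2 / d * r := by gcongr
      linarith
    rw [hnorm z hz hFz, hnorm P hPm hFP] at h2
    have h5 : (W P - 1) / (W P + 1) ≤ (M - 1) / (M + 1) := by
      have := hW0 P
      rw [div_le_div_iff₀ (by linarith) (by linarith)]
      have : W P ≤ M := hWP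
      nlinarith
    have h6 : (M - 1) / (M + 1) + 2 / d * r = (2 * M - 1) / (2 * M + 1) := by
      rw [hr]; field_simp; ring
    have h7 : (W z - 1) / (W z + 1) ≤ (2 * M - 1) / (2 * M + 1) := by linarith
    have := hW0 z
    rw [div_le_div_iff₀ (by linarith) (by linarith)] at h7
    nlinarith
  have hRr : r / (4 * (1 + 2 * M)) < r := by
    rw [div_lt_iff₀ (by positivity)]; nlinarith
  have hRd : ‖Q - P‖ < d := by linarith
  set v := Q - P with hv
  have hseg : ∀ t ∈ Icc (0:ℝ) 1, P + (t:ℂ) * v ∈ Metric.ball P d := by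
    intro t ht
    rw [Metric.mem_ball, dist_eq_norm, add_sub_cancel_left, norm_mul, Complex.norm_real,
      Real.norm_of_nonneg ht.1]
    nlinarith [norm_nonneg v, ht.2]
  have hder : ∀ t ∈ Icc (0:ℝ) 1, HasDerivAt (fun t : ℝ => F (P + (t:ℂ) * v) - F P)
      (symL (1 + (1 + p (P + (t:ℂ) * v) ^ 2) / W (P + (t:ℂ) * v))
      (p (P + (t:ℂ) * v) * q (P + (t:ℂ) * v) / W (P + (t:ℂ) * v))
      (1 + (1 + q (P + (t:ℂ) * v) ^ 2) / W (P + (t:ℂ) * v)) v) t := by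
    intro t ht
    have h1 : HasDerivAt (fun t : ℝ => P + (t:ℂ) * v) v t := by
      have := ((Complex.ofRealCLM.hasDerivAt (x := t)).mul_const v).const_add P
      simpa using this
    exact ((hF' _ (hseg t ht)).comp_hasDerivAt t h1).sub_const _
  have hfence := image_norm_le_of_norm_deriv_right_lt_deriv_boundary
    (f := fun t : ℝ => F (P + (t:ℂ) * v) - F P) (a := 0) (b := 1) (B := fun t => r * t)
    (B' := fun _ => r)
    (fun t ht => (hder t ht).continuousAt.continuousWithinAt)
    (fun t ht => (hder t (Ico_subset_Icc_self ht)).hasDerivWithinAt)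
    (by simp) (fun t => by simpa using (hasDerivAt_id t).const_mul r) (by
      intro t ht heq
      have hy := hseg t (Ico_subset_Icc_self ht)
      have hWy := hbound _ hy (by
        rw [heq]
        nlinarith [ht.2])
      have hWy0 := hW0 (P + (t:ℂ) * v)
      have hWy2 := hW2 (P + (t:ℂ) * v)
      generalize P + (t:ℂ) * v = y at *
      have g1 : |1 + (1 + p y ^ 2) / W y| ≤ 1 + 2 * M := by
        rw [abs_of_pos (by positivity)]
        have : (1 + p y ^ 2) / W y ≤ W y := by
          rw [div_le_iff₀ hWy0]; nlinarith [sq_nonneg (q y)]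
        linarith
      have g3 : |1 + (1 + q y ^ 2) / W y| ≤ 1 + 2 * M := by
        rw [abs_of_pos (by positivity)]
        have : (1 + q y ^ 2) / W y ≤ W y := by
          rw [div_le_iff₀ hWy0]; nlinarith [sq_nonneg (p y)]
        linarith
      have g2 : |p y * q y / W y| ≤ 1 + 2 * M := by
        rw [abs_div, abs_of_pos hWy0]
        have : |p y * q y| / W y ≤ W y := by
          rw [div_le_iff₀ hWy0, abs_le]
          constructor <;> nlinarith [sq_nonneg (p y - q y), sq_nonneg (p y + q y)]
        linarith
      refine (norm_symL_le _ _ _ _ g1 g2 g3 v).trans_lt ?_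
      rw [lt_div_iff₀ (by positivity)] at hQ
      linarith)
  have h1 := hfence (right_mem_Icc.2 zero_le_one)
  have e : P + ((1:ℝ):ℂ) * v = Q := by simp [hv]
  simp only [e, mul_one] at h1
  exact hbound Q (by rw [Metric.mem_ball, dist_eq_norm]; exact hRd) h1

/-- Interior bound for `W`: for every `M > 0` and `d > 0` there is `R > 0`, depending
only on `M` and `d`, such that for any solution `u` of the minimal surfaces equation
on an open set `Ω` and any `P ∈ Ω` at distance at least `d` from `∂Ω` with
`W(P) ≤ M`, one has `W ≤ 2M` on the open disk of center `P` and radius `R`. -/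
theorem W_bound_propagates :
    ∀ M > (0:ℝ), ∀ d > (0:ℝ), ∃ R > (0:ℝ),
      ∀ (Ω : Set (ℝ × ℝ)), IsOpen Ω → ∀ u : ℝ × ℝ → ℝ, IsMSE u Ω →
        ∀ P ∈ Ω, eball P d ⊆ Ω → Wg u P ≤ M →
          ∀ Q ∈ eball P R, Wg u Q ≤ 2 * M := by
  intro M hM d hd
  refine ⟨d * M / ((M + 1) * (2 * M + 1)) / (4 * (1 + 2 * M)), by positivity, ?_⟩
  intro Ω hΩ u hu P _ hPd hWP Q hQ
  have hlen : ∀ z w : ℂ, len ((z.re, z.im) - (w.re, w.im)) = ‖z - w‖ := by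
    intro z w
    rw [Complex.norm_def, Complex.normSq_apply]
    simp [len, pow_two]
  refine final_step (P := ⟨P.1, P.2⟩) (Q := ⟨Q.1, Q.2⟩) hM hd hΩ hu ?_ hWP ?_
  · intro z hz
    apply hPd
    have := hlen z ⟨P.1, P.2⟩
    rw [Metric.mem_ball, dist_eq_norm, ← this] at hz
    exact hz
  · rw [← hlen]; exact hQ
end

section
/- There exists a universal constant c > 0 such that for every open set Ω ⊆ ℝ², every C² solution u of the minimal surfaces equation in Ω, every ρ > 0, and every point Q ∈ Ω whose distance to ∂Ω is at least ρ, the gradient of W = √(1+p²+q²) satisfies ‖∇W(Q)‖ ≤ (c/ρ)·W(Q)². -/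
open Real Filter Set Topology MeasureTheory

open Complex in
lemma mse_closed {a b a1 a2 b2 : ℂ → ℝ} {z0 : ℂ} {ρ : ℝ}
    (ha : ∀ z ∈ Metric.ball z0 ρ, HasFDerivAt a (a1 z • reCLM + a2 z • imCLM) z)
    (hb : ∀ z ∈ Metric.ball z0 ρ, HasFDerivAt b (a2 z • reCLM + b2 z • imCLM) z) :
    ∃ f : ℂ → ℝ, ∀ z ∈ Metric.ball z0 ρ, HasFDerivAt f (a z • reCLM + b z • imCLM) z := by
  have key : ∀ z ∈ Metric.ball z0 ρ, HasFDerivAt (fun z => a z • reCLM + b z • imCLM)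
      ((a1 z • reCLM + a2 z • imCLM).smulRight reCLM
        + (a2 z • reCLM + b2 z • imCLM).smulRight imCLM) z := by
    intro z hz
    exact ((ha z hz).smul_const reCLM).add ((hb z hz).smul_const imCLM)
  refine (convex_ball z0 ρ).exists_forall_hasFDerivAt_of_fderiv_symmetric Metric.isOpen_ball
    (fun z hz => (key z hz).differentiableAt.differentiableWithinAt) ?_
  intro z hz x y
  rw [(key z hz).fderiv]
  simp
  ring

lemma mse_pick {h : ℂ → ℂ} {c l : ℂ} {ρ : ℝ} (hρ : 0 < ρ)
    (hd : DifferentiableOn ℂ h (Metric.ball c ρ)) (hb : ∀ z ∈ Metric.ball c ρ, ‖h z‖ < 1)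
    (hl : HasDerivAt h l c) : ‖l‖ ≤ (1 - ‖h c‖ ^ 2) / ρ := by
  have hc : c ∈ Metric.ball c ρ := Metric.mem_ball_self hρ
  set α := h c with hα
  have hα1 : ‖α‖ < 1 := hb c hc
  have hne : ∀ z ∈ Metric.ball c ρ, 1 - (starRingEnd ℂ) α * h z ≠ 0 := by
    intro z hz h0
    have h1 : (starRingEnd ℂ) α * h z = 1 := by linear_combination -h0
    have h2 : ‖α‖ * ‖h z‖ = 1 := by
      have := congrArg norm h1
      simpa using this
    have := hb z hz
    nlinarith [norm_nonneg α, norm_nonneg (h z)]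
  set k : ℂ → ℂ := fun z => (h z - α) / (1 - (starRingEnd ℂ) α * h z) with hk
  have hkd : DifferentiableOn ℂ k (Metric.ball c ρ) :=
    (hd.sub_const α).div ((hd.const_mul _).const_sub 1) hne
  have hkc : k c = 0 := by simp [hk, hα]
  have hmaps : MapsTo k (Metric.ball c ρ) (Metric.closedBall (k c) 1) := by
    intro z hz
    rw [hkc, mem_closedBall_zero_iff, hk]
    simp only [norm_div]
    rw [div_le_one (norm_pos_iff.mpr (hne z hz))]
    rw [← sq_le_sq₀ (norm_nonneg _) (norm_nonneg _)]
    have h1 : ‖α‖ ^ 2 < 1 := by nlinarith [norm_nonneg α]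
    have h2 : ‖h z‖ ^ 2 < 1 := by nlinarith [norm_nonneg (h z), hb z hz]
    rw [← Complex.normSq_eq_norm_sq] at h1 h2 ⊢
    rw [← Complex.normSq_eq_norm_sq]
    simp only [Complex.normSq_apply, Complex.sub_re, Complex.sub_im, Complex.mul_re,
      Complex.mul_im, Complex.conj_re, Complex.conj_im, Complex.one_re, Complex.one_im] at *
    nlinarith [mul_pos (sub_pos.mpr h1) (sub_pos.mpr h2)]
  have := Complex.norm_deriv_le_div_of_mapsTo_ball hkd hmaps hρ
  have hkder : HasDerivAt k (l / (1 - (starRingEnd ℂ) α * α)) c := by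
    have := (hl.sub_const α).div ((hl.const_mul ((starRingEnd ℂ) α)).const_sub 1) (hne c hc)
    refine this.congr_deriv ?_
    have := hne c hc
    rw [← hα] at this ⊢
    field_simp
    ring
  rw [hkder.deriv, norm_div] at this
  have hn : ‖1 - (starRingEnd ℂ) α * α‖ = 1 - ‖α‖ ^ 2 := by
    rw [← Complex.normSq_eq_conj_mul_self, ← Complex.ofReal_one, ← Complex.ofReal_sub,
      Complex.norm_real, Complex.normSq_eq_norm_sq, Real.norm_of_nonneg]
    nlinarith [norm_nonneg α]
  have hp : 0 < 1 - ‖α‖ ^ 2 := by nlinarith [norm_nonneg α]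
  rw [hn, div_le_iff₀ hp] at this
  calc ‖l‖ ≤ _ := this
    _ = _ := by ring

/-- An expanding `C¹`-type map of a disk covers the disk of the same radius, and a function on the
source which is complex-proportional to it descends to a holomorphic function. -/
lemma mse_descend {T G : ℂ → ℂ} {T' : ℂ → ℂ →L[ℝ] ℂ} {l : ℂ → ℂ} {z0 : ℂ} {ρ : ℝ} (hρ : 0 < ρ)
    (hT : ∀ z ∈ Metric.ball z0 ρ, HasStrictFDerivAt T (T' z) z)
    (hexp : ∀ x ∈ Metric.ball z0 ρ, ∀ y ∈ Metric.ball z0 ρ, ‖x - y‖ ≤ ‖T x - T y‖)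
    (hinj : ∀ z ∈ Metric.ball z0 ρ, ∀ v, T' z v = 0 → v = 0)
    (hG : ∀ z ∈ Metric.ball z0 ρ, HasFDerivAt G (l z • T' z) z)
    (hG1 : ∀ z ∈ Metric.ball z0 ρ, ‖G z‖ < 1) :
    ‖l z0‖ ≤ (1 - ‖G z0‖ ^ 2) / ρ := by
  set U := Metric.ball z0 ρ with hU
  set V := Metric.ball (T z0) ρ with hV
  have hz0 : z0 ∈ U := Metric.mem_ball_self hρ
  have hequiv : ∀ z ∈ U, ∃ e : ℂ ≃L[ℝ] ℂ, (e : ℂ →L[ℝ] ℂ) = T' z := by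
    intro z hz
    have hi : Function.Injective (T' z : ℂ →ₗ[ℝ] ℂ) :=
      (injective_iff_map_eq_zero _).2 (fun v hv => hinj z hz v hv)
    refine ⟨(LinearEquiv.ofInjectiveEndo _ hi).toContinuousLinearEquiv, ?_⟩
    ext
    all_goals simp
  have hopen : IsOpen (T '' U) := by
    rw [isOpen_iff_mem_nhds]
    rintro _ ⟨z, hz, rfl⟩
    obtain ⟨e, he⟩ := hequiv z hz
    have h1 : HasStrictFDerivAt T (e : ℂ →L[ℝ] ℂ) z := he ▸ hT z hz
    rw [← h1.map_nhds_eq_of_equiv]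
    exact image_mem_map (Metric.isOpen_ball.mem_nhds hz)
  have hcov : V ⊆ T '' U := by
    have hpre : IsPreconnected V := (convex_ball _ _).isPreconnected
    refine hpre.subset_of_closure_inter_subset hopen ⟨T z0, Metric.mem_ball_self hρ, z0, hz0, rfl⟩ ?_
    rintro y ⟨hy, hyV⟩
    obtain ⟨w, hw, hlim⟩ := mem_closure_iff_seq_limit.1 hy
    choose x hxU hx using hw
    have hcau : CauchySeq x := by
      have hc := hlim.cauchySeq
      rw [Metric.cauchySeq_iff] at hc ⊢
      intro ε hε
      obtain ⟨N, hN⟩ := hc ε hε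
      refine ⟨N, fun m hm n hn => lt_of_le_of_lt ?_ (hN m hm n hn)⟩
      rw [dist_eq_norm, dist_eq_norm, ← hx, ← hx]
      exact hexp _ (hxU _) _ (hxU _)
    obtain ⟨a, ha⟩ := cauchySeq_tendsto_of_complete hcau
    have haU : a ∈ U := by
      have h1 : Tendsto (fun n => ‖x n - z0‖) atTop (𝓝 ‖a - z0‖) := (ha.sub_const z0).norm
      have h2 : Tendsto (fun n => ‖w n - T z0‖) atTop (𝓝 ‖y - T z0‖) := (hlim.sub_const _).norm
      have h3 : ‖a - z0‖ ≤ ‖y - T z0‖ := by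
        refine le_of_tendsto_of_tendsto' h1 h2 (fun n => ?_)
        rw [← hx]
        exact hexp _ (hxU _) _ hz0
      rw [hU, mem_ball_iff_norm]
      exact lt_of_le_of_lt h3 (mem_ball_iff_norm.1 hyV)
    refine ⟨a, haU, ?_⟩
    have h4 : Tendsto (fun n => T (x n)) atTop (𝓝 (T a)) :=
      (hT a haU).hasFDerivAt.continuousAt.tendsto.comp ha
    simp only [hx] at h4
    exact tendsto_nhds_unique h4 hlim
  have hTinj : InjOn T U := by
    intro x hx y hy hxy
    have := hexp x hx y hy
    rw [hxy, sub_self, norm_zero] at this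
    exact sub_eq_zero.1 (norm_le_zero_iff.1 this)
  set S := Function.invFunOn T U with hS
  have hSU : ∀ w ∈ V, S w ∈ U := fun w hw => Function.invFunOn_mem (hcov hw)
  have hTS : ∀ w ∈ V, T (S w) = w := fun w hw => Function.invFunOn_eq (hcov hw)
  have hST : S (T z0) = z0 :=
    hTinj (hSU _ (Metric.mem_ball_self hρ)) hz0 (hTS _ (Metric.mem_ball_self hρ))
  have hScont : ∀ w ∈ V, ContinuousAt S w := by
    intro w hw
    have : ContinuousOn S V := by
      refine (LipschitzOnWith.of_dist_le_mul (K := 1) ?_).continuousOn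
      intro x hx y hy
      have := hexp _ (hSU x hx) _ (hSU y hy)
      rw [hTS x hx, hTS y hy] at this
      simpa [dist_eq_norm] using this
    exact this.continuousAt (Metric.isOpen_ball.mem_nhds hw)
  have hder : ∀ w ∈ V, HasDerivAt (G ∘ S) (l (S w)) w := by
    intro w hw
    obtain ⟨e, he⟩ := hequiv _ (hSU w hw)
    have h1 : HasFDerivAt T (e : ℂ →L[ℝ] ℂ) (S w) := he ▸ (hT _ (hSU w hw)).hasFDerivAt
    have h2 : HasFDerivAt S (e.symm : ℂ →L[ℝ] ℂ) w :=
      HasFDerivAt.of_local_left_inverse (hScont w hw) h1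
        (Filter.eventually_of_mem (Metric.isOpen_ball.mem_nhds hw) hTS)
    have h3 := (hG _ (hSU w hw)).comp w h2
    rw [hasDerivAt_iff_hasFDerivAt]
    refine hasFDerivAt_of_restrictScalars ℝ h3 ?_
    ext v
    rw [← he]
    simp
    simp [mul_comm]
  have hfin := mse_pick (h := G ∘ S) (c := T z0) (l := l z0) hρ
    (fun w hw => (hder w hw).differentiableAt.differentiableWithinAt)
    (fun w hw => hG1 _ (hSU w hw))
    (by simpa [hST] using hder (T z0) (Metric.mem_ball_self hρ))
  simpa [hST] using hfin

section core
open Complex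


lemma mse_clm_ext {F : Type*} [NormedAddCommGroup F] [NormedSpace ℝ F] {f g : ℂ →L[ℝ] F}
    (h1 : f 1 = g 1) (h2 : f I = g I) : f = g := by
  ext v
  have hv : v = v.re • (1 : ℂ) + v.im • I := by simp [Complex.re_add_im]
  rw [hv, map_add, map_add, map_smul, map_smul, map_smul, map_smul, h1, h2]

lemma mse_re (x y : ℝ) : ((x : ℂ) + (y : ℂ) * I).re = x := by simp
lemma mse_im (x y : ℝ) : ((x : ℂ) + (y : ℂ) * I).im = y := by simp
lemma mse_re' (x y : ℝ) : ((x : ℂ) - (y : ℂ) * I).re = x := by simp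
lemma mse_im' (x y : ℝ) : ((x : ℂ) - (y : ℂ) * I).im = -y := by simp

lemma mse_alg {p q r s W : ℝ} (h0 : W ≠ 0) (h1 : 1 + W ≠ 0) (h2 : W ^ 2 = 1 + p ^ 2 + q ^ 2) :
    (p * r + q * s) / W = (1 + W) ^ 2 *
      (p * (1 + W)⁻¹ * (((1 + W + q ^ 2) * r - p * q * s) * (W * (1 + W) ^ 2)⁻¹)
      + q * (1 + W)⁻¹ * (((1 + W + p ^ 2) * s - p * q * r) * (W * (1 + W) ^ 2)⁻¹)) := by
  field_simp
  ring

lemma mse_alg' {p q s t W : ℝ} (h0 : W ≠ 0) (h1 : 1 + W ≠ 0) (h2 : W ^ 2 = 1 + p ^ 2 + q ^ 2) :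
    (p * s + q * t) / W = (1 + W) ^ 2 *
      (p * (1 + W)⁻¹ * (((1 + W + q ^ 2) * s - p * q * t) * (W * (1 + W) ^ 2)⁻¹)
      + q * (1 + W)⁻¹ * (((1 + W + p ^ 2) * t - p * q * s) * (W * (1 + W) ^ 2)⁻¹)) := by
  field_simp
  ring

lemma mse_CR {p q r s t W K : ℝ} (h0 : W ≠ 0) (h2 : W ^ 2 = 1 + p ^ 2 + q ^ 2)
    (h3 : (1 + q ^ 2) * r - 2 * p * q * s + (1 + p ^ 2) * t = 0) :
    ((1 + W + q ^ 2) * r - p * q * s) * K * (1 + (1 + q ^ 2) * W⁻¹)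
      - ((1 + W + p ^ 2) * s - p * q * r) * K * (p * q * W⁻¹)
    = ((1 + W + q ^ 2) * s - p * q * t) * K * (p * q * W⁻¹)
      - ((1 + W + p ^ 2) * t - p * q * s) * K * (1 + (1 + p ^ 2) * W⁻¹) := by
  field_simp
  have hP : p ^ 2 + q ^ 2 = W ^ 2 - 1 := by linarith
  have e1 : (1 + W + p ^ 2) + (1 + W + q ^ 2) = (1 + W) ^ 2 := by linear_combination hP
  have e2 : (1 + W + p ^ 2) * (1 + W + q ^ 2) - (p * q) ^ 2 = W * (1 + W) ^ 2 := by
    linear_combination (1 + W) * hP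
  linear_combination K * ((1 + W) ^ 2 * h3 + ((1 + q ^ 2 + W) * r + (1 + p ^ 2 + W) * t
    - 2 * p * q * s) * e1 - (r + t) * e2)

/-- Pointwise derivative of `W`. -/
lemma mse_W {p q r s t : ℂ → ℝ} {z : ℂ}
    (hp : HasFDerivAt p (r z • reCLM + s z • imCLM) z)
    (hq : HasFDerivAt q (s z • reCLM + t z • imCLM) z) :
    HasFDerivAt (fun z => √(1 + p z ^ 2 + q z ^ 2))
      (((p z * r z + q z * s z) / √(1 + p z ^ 2 + q z ^ 2)) • reCLM
        + ((p z * s z + q z * t z) / √(1 + p z ^ 2 + q z ^ 2)) • imCLM) z := by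
  have h0 : 0 < 1 + p z ^ 2 + q z ^ 2 := by positivity
  have h1 := (((hp.pow 2).const_add 1).add (hq.pow 2)).sqrt h0.ne'
  refine h1.congr_fderiv ?_
  have hs : √(1 + p z ^ 2 + q z ^ 2) ≠ 0 := (Real.sqrt_pos.2 h0).ne'
  apply mse_clm_ext
  all_goals
    simp
    field_simp

set_option maxHeartbeats 1000000 in
lemma mse_core {p q r s t : ℂ → ℝ} {z0 : ℂ} {ρ : ℝ} (hρ : 0 < ρ)
    (hp : ∀ z ∈ Metric.ball z0 ρ, HasFDerivAt p (r z • reCLM + s z • imCLM) z)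
    (hq : ∀ z ∈ Metric.ball z0 ρ, HasFDerivAt q (s z • reCLM + t z • imCLM) z)
    (hm : ∀ z ∈ Metric.ball z0 ρ,
      (1 + q z ^ 2) * r z - 2 * p z * q z * s z + (1 + p z ^ 2) * t z = 0) :
    |(p z0 * r z0 + q z0 * s z0) / √(1 + p z0 ^ 2 + q z0 ^ 2)|
        ≤ 12 / ρ * √(1 + p z0 ^ 2 + q z0 ^ 2) ^ 2 ∧
    |(p z0 * s z0 + q z0 * t z0) / √(1 + p z0 ^ 2 + q z0 ^ 2)|
        ≤ 12 / ρ * √(1 + p z0 ^ 2 + q z0 ^ 2) ^ 2 := by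
  set U := Metric.ball z0 ρ with hU
  have hz0 : z0 ∈ U := Metric.mem_ball_self hρ
  set W : ℂ → ℝ := fun z => √(1 + p z ^ 2 + q z ^ 2) with hWdef
  have hW : ∀ z ∈ U, HasFDerivAt W (((p z * r z + q z * s z) / W z) • reCLM
        + ((p z * s z + q z * t z) / W z) • imCLM) z := fun z hz => mse_W (hp z hz) (hq z hz)
  have hW2 : ∀ z, W z ^ 2 = 1 + p z ^ 2 + q z ^ 2 := fun z => Real.sq_sqrt (by positivity)
  have hW1 : ∀ z, 1 ≤ W z := fun z => Real.one_le_sqrt.2 (by nlinarith [sq_nonneg (p z), sq_nonneg (q z)])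
  have hW0 : ∀ z, 0 < W z := fun z => lt_of_lt_of_le one_pos (hW1 z)
  have hV : ∀ z ∈ U, HasFDerivAt (fun z => (W z)⁻¹) ((-(W z ^ 2)⁻¹) •
      (((p z * r z + q z * s z) / W z) • reCLM + ((p z * s z + q z * t z) / W z) • imCLM)) z :=
    fun z hz => (hasDerivAt_inv (hW0 z).ne').comp_hasFDerivAt z (hW z hz)
  have hN : ∀ z ∈ U, HasFDerivAt (fun z => (1 + W z)⁻¹) ((-((1 + W z) ^ 2)⁻¹) •
      (((p z * r z + q z * s z) / W z) • reCLM + ((p z * s z + q z * t z) / W z) • imCLM)) z :=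
    fun z hz => (hasDerivAt_inv (by linarith [hW0 z])).comp_hasFDerivAt z ((hW z hz).const_add 1)
  -- the two closed forms
  obtain ⟨A, hA⟩ := mse_closed (z0 := z0) (ρ := ρ)
    (a := fun z => (1 + p z ^ 2) * (W z)⁻¹) (b := fun z => p z * q z * (W z)⁻¹)
    (a1 := fun z => 2 * p z * r z * (W z)⁻¹ - (1 + p z ^ 2) * (p z * r z + q z * s z) / W z ^ 3)
    (a2 := fun z => 2 * p z * s z * (W z)⁻¹ - (1 + p z ^ 2) * (p z * s z + q z * t z) / W z ^ 3)
    (b2 := fun z => (p z * t z + q z * s z) * (W z)⁻¹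
      - p z * q z * (p z * s z + q z * t z) / W z ^ 3)
    (by
      intro z hz
      refine ((((hp z hz).pow 2).const_add 1).mul (hV z hz)).congr_fderiv ?_
      have := (hW0 z).ne'
      apply mse_clm_ext
      all_goals
        simp
        field_simp
        ring)
    (by
      intro z hz
      refine (((hp z hz).mul (hq z hz)).mul (hV z hz)).congr_fderiv ?_
      have := (hW0 z).ne'
      have h2 := hW2 z
      have h3 := hm z hz
      apply mse_clm_ext
      · simp
        field_simp
        rw [h2]
        linear_combination (q z) * h3
      · simp
        field_simp
        ring)
  obtain ⟨B, hB⟩ := mse_closed (z0 := z0) (ρ := ρ)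
    (a := fun z => p z * q z * (W z)⁻¹) (b := fun z => (1 + q z ^ 2) * (W z)⁻¹)
    (a1 := fun z => (p z * s z + q z * r z) * (W z)⁻¹
      - p z * q z * (p z * r z + q z * s z) / W z ^ 3)
    (a2 := fun z => (p z * t z + q z * s z) * (W z)⁻¹
      - p z * q z * (p z * s z + q z * t z) / W z ^ 3)
    (b2 := fun z => 2 * q z * t z * (W z)⁻¹ - (1 + q z ^ 2) * (p z * s z + q z * t z) / W z ^ 3)
    (by
      intro z hz
      refine (((hp z hz).mul (hq z hz)).mul (hV z hz)).congr_fderiv ?_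
      have := (hW0 z).ne'
      apply mse_clm_ext
      all_goals
        simp
        field_simp
        ring)
    (by
      intro z hz
      refine ((((hq z hz).pow 2).const_add 1).mul (hV z hz)).congr_fderiv ?_
      have := (hW0 z).ne'
      have h2 := hW2 z
      have h3 := hm z hz
      apply mse_clm_ext
      · simp
        field_simp
        rw [h2]
        linear_combination (- p z) * h3
      · simp
        field_simp
        ring)
  -- the transform
  set R : ℂ →L[ℝ] ℂ := ofRealCLM.comp reCLM with hR
  set J : ℂ →L[ℝ] ℂ := ofRealCLM.comp imCLM with hJ
  set α : ℂ → ℂ := fun z => ((1 + (1 + p z ^ 2) * (W z)⁻¹ : ℝ) : ℂ)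
    + ((p z * q z * (W z)⁻¹ : ℝ) : ℂ) * I with hα
  set β : ℂ → ℂ := fun z => ((p z * q z * (W z)⁻¹ : ℝ) : ℂ)
    + ((1 + (1 + q z ^ 2) * (W z)⁻¹ : ℝ) : ℂ) * I with hβ
  set T : ℂ → ℂ := fun z => z + (A z : ℂ) + (B z : ℂ) * I with hTdef
  set T' : ℂ → ℂ →L[ℝ] ℂ := fun z => α z • R + β z • J with hT'
  have hTd : ∀ z ∈ U, HasFDerivAt T (T' z) z := by
    intro z hz
    have h1 := ((hasFDerivAt_id (𝕜 := ℝ) z).add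
      (ofRealCLM.hasFDerivAt.comp z (hA z hz))).add
      ((ofRealCLM.hasFDerivAt.comp z (hB z hz)).mul_const I)
    refine h1.congr_fderiv ?_
    apply mse_clm_ext <;> simp [hT', hα, hβ, hR, hJ] <;> ring
  have hTs : ∀ z ∈ U, HasStrictFDerivAt T (T' z) z := by
    intro z hz
    refine hasStrictFDerivAt_of_hasFDerivAt_of_continuousAt
      (Filter.eventually_of_mem (Metric.isOpen_ball.mem_nhds hz) hTd) ?_
    have cp := (hp z hz).continuousAt
    have cq := (hq z hz).continuousAt
    have cV := (hV z hz).continuousAt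
    have ca : ContinuousAt α z := by fun_prop
    have cb : ContinuousAt β z := by fun_prop
    exact (ca.smul continuousAt_const).add (cb.smul continuousAt_const)
  have hquad : ∀ z (x y : ℝ), 0 ≤ ((1 + p z ^ 2) * (W z)⁻¹) * x ^ 2
      + 2 * (p z * q z * (W z)⁻¹) * x * y + ((1 + q z ^ 2) * (W z)⁻¹) * y ^ 2 := by
    intro z x y
    have : 0 ≤ (W z)⁻¹ * (x ^ 2 + y ^ 2 + (p z * x + q z * y) ^ 2) := by
      have := hW0 z
      positivity
    linarith
  have hexp : ∀ x ∈ U, ∀ y ∈ U, ‖x - y‖ ≤ ‖T x - T y‖ := by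
    intro x hx y hy
    set v := x - y with hv
    have hmvt : 0 ≤ v.re * (A x - A y) + v.im * (B x - B y) := by
      obtain ⟨w, hw, hw2⟩ := domain_mvt (f := fun z => v.re * A z + v.im * B z) (s := U)
        (x := y) (y := x)
        (f' := fun z => v.re • (((1 + p z ^ 2) * (W z)⁻¹) • reCLM + (p z * q z * (W z)⁻¹) • imCLM)
          + v.im • ((p z * q z * (W z)⁻¹) • reCLM + ((1 + q z ^ 2) * (W z)⁻¹) • imCLM))
        (fun z hz => (((hA z hz).const_mul _).add ((hB z hz).const_mul _)).hasFDerivWithinAt)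
        (convex_ball _ _) hy hx
      have h5 := hquad w v.re v.im
      rw [← hv] at hw2
      simp at hw2
      nlinarith
    have h6 : ‖v‖ ^ 2 ≤ ‖v‖ * ‖T x - T y‖ := by
      have h7 : (starRingEnd ℂ v * (T x - T y)).re ≤ ‖v‖ * ‖T x - T y‖ := by
        refine (Complex.re_le_norm _).trans ?_
        rw [norm_mul, RCLike.norm_conj]
      refine le_trans ?_ h7
      rw [← Complex.normSq_eq_norm_sq, Complex.normSq_apply]
      have e1 : (T x - T y).re = v.re + (A x - A y) := by simp [hTdef, hv]; ring
      have e2 : (T x - T y).im = v.im + (B x - B y) := by simp [hTdef, hv]; ring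
      rw [Complex.mul_re, e1, e2, Complex.conj_re, Complex.conj_im]
      nlinarith
    rcases (norm_nonneg v).eq_or_lt with h | h
    · rw [← h]; exact norm_nonneg _
    · rw [sq] at h6
      exact le_of_mul_le_mul_left h6 h
  have hinj : ∀ z ∈ U, ∀ v, T' z v = 0 → v = 0 := by
    intro z hz v hv
    have e1 := congrArg Complex.re hv
    have e2 := congrArg Complex.im hv
    have e0 : T' z v = α z * v.re + β z * v.im := by simp [hT', hR, hJ]
    rw [e0] at e1 e2
    rw [add_re, re_mul_ofReal, re_mul_ofReal, zero_re, mse_re, mse_re] at e1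
    rw [add_im, im_mul_ofReal, im_mul_ofReal, zero_im, mse_im, mse_im] at e2
    have h5 := hquad z v.re v.im
    have h7 : v.re ^ 2 + v.im ^ 2 + (((1 + p z ^ 2) * (W z)⁻¹) * v.re ^ 2
        + 2 * (p z * q z * (W z)⁻¹) * v.re * v.im + ((1 + q z ^ 2) * (W z)⁻¹) * v.im ^ 2) = 0 := by
      linear_combination v.re * e1 + v.im * e2
    have h6 : v.re ^ 2 + v.im ^ 2 ≤ 0 := by
      linarith
    apply Complex.ext
    · simp only [Complex.zero_re]; nlinarith [sq_nonneg v.re, sq_nonneg v.im]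
    · simp only [Complex.zero_im]; nlinarith [sq_nonneg v.re, sq_nonneg v.im]
  -- the Gauss map
  set G : ℂ → ℂ := fun z => ((p z * (1 + W z)⁻¹ : ℝ) : ℂ) - ((q z * (1 + W z)⁻¹ : ℝ) : ℂ) * I with hG
  set K : ℂ → ℝ := fun z => (W z * (1 + W z) ^ 2)⁻¹ with hK
  set g1x : ℂ → ℝ := fun z => ((1 + W z + q z ^ 2) * r z - p z * q z * s z) * K z with hg1x
  set g1y : ℂ → ℝ := fun z => ((1 + W z + q z ^ 2) * s z - p z * q z * t z) * K z with hg1y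
  set g2x : ℂ → ℝ := fun z => ((1 + W z + p z ^ 2) * s z - p z * q z * r z) * K z with hg2x
  set g2y : ℂ → ℝ := fun z => ((1 + W z + p z ^ 2) * t z - p z * q z * s z) * K z with hg2y
  set Gx : ℂ → ℂ := fun z => (g1x z : ℂ) - (g2x z : ℂ) * I with hGx
  set Gy : ℂ → ℂ := fun z => (g1y z : ℂ) - (g2y z : ℂ) * I with hGy
  have hg1 : ∀ z ∈ U, HasFDerivAt (fun z => p z * (1 + W z)⁻¹) (g1x z • reCLM + g1y z • imCLM) z := by
    intro z hz
    refine ((hp z hz).mul (hN z hz)).congr_fderiv ?_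
    have := (hW0 z).ne'
    have h1 : 1 + W z ≠ 0 := by linarith [hW0 z]
    have h2 := hW2 z
    apply mse_clm_ext
    · simp [hg1x, hK]
      field_simp
      linear_combination (r z) * h2
    · simp [hg1y, hK]
      field_simp
      linear_combination (s z) * h2
  have hg2 : ∀ z ∈ U, HasFDerivAt (fun z => q z * (1 + W z)⁻¹) (g2x z • reCLM + g2y z • imCLM) z := by
    intro z hz
    refine ((hq z hz).mul (hN z hz)).congr_fderiv ?_
    have := (hW0 z).ne'
    have h1 : 1 + W z ≠ 0 := by linarith [hW0 z]
    have h2 := hW2 z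
    apply mse_clm_ext
    · simp [hg2x, hK]
      field_simp
      linear_combination (s z) * h2
    · simp [hg2y, hK]
      field_simp
      linear_combination (t z) * h2
  have hα0 : ∀ z, α z ≠ 0 := by
    intro z h
    have := congrArg Complex.re h
    simp only [hα, mse_re, zero_re] at this
    have h1 : 0 < (1 + p z ^ 2) * (W z)⁻¹ := by
      have := hW0 z
      positivity
    linarith
  have hCR : ∀ z ∈ U, Gx z * β z = Gy z * α z := by
    intro z hz
    have h0 := (hW0 z).ne'
    have h2 := hW2 z
    have h3 := hm z hz
    apply Complex.ext
    · simp only [mul_re, hGx, hGy, hα, hβ, mse_re, mse_im, mse_re', mse_im', hg1x, hg1y, hg2x, hg2y]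
      field_simp
      ring
    · have := mse_CR (K := K z) h0 h2 h3
      simp only [mul_im, hGx, hGy, hα, hβ, mse_re, mse_im, mse_re', mse_im', hg1x, hg1y, hg2x, hg2y]
      linear_combination this
  have hGd : ∀ z ∈ U, HasFDerivAt G ((Gx z / α z) • T' z) z := by
    intro z hz
    have h1 := (ofRealCLM.hasFDerivAt.comp z (hg1 z hz)).sub
      ((ofRealCLM.hasFDerivAt.comp z (hg2 z hz)).mul_const I)
    refine h1.congr_fderiv ?_
    have e1 : Gx z / α z * α z = Gx z := div_mul_cancel₀ _ (hα0 z)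
    have e2 : Gx z / α z * β z = Gy z := by
      rw [div_mul_eq_mul_div, hCR z hz, mul_div_cancel_right₀ _ (hα0 z)]
    have e3 : (Gx z / α z) • T' z = Gx z • R + Gy z • J := by
      rw [hT', smul_add, smul_smul, smul_smul, e1, e2]
    rw [e3]
    apply mse_clm_ext <;> simp [hGx, hGy, hR, hJ] <;> ring
  have hGn : ∀ z, ‖G z‖ ^ 2 = 1 - 2 / (1 + W z) := by
    intro z
    have h1 : 1 + W z ≠ 0 := by linarith [hW0 z]
    rw [← Complex.normSq_eq_norm_sq, Complex.normSq_apply]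
    simp only [hG, mse_re', mse_im']
    field_simp
    linear_combination - hW2 z
  have hG1 : ∀ z ∈ U, ‖G z‖ < 1 := by
    intro z hz
    have h1 := hGn z
    have h2 : 0 < 2 / (1 + W z) := by
      have := hW0 z
      positivity
    nlinarith [norm_nonneg (G z)]
  have hmain := mse_descend (l := fun z => Gx z / α z) hρ hTs hexp hinj hGd hG1
  have hW1' := hW1 z0
  have hW0' := hW0 z0
  have h2 := hW2 z0
  have hl : ‖Gx z0 / α z0‖ ≤ 2 / (1 + W z0) / ρ := by
    rw [hGn z0] at hmain
    simpa using hmain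
  have hb : |p z0 * q z0 * (W z0)⁻¹| ≤ W z0 := by
    rw [← div_eq_mul_inv, abs_div, abs_of_pos hW0', div_le_iff₀ hW0', abs_le]
    constructor <;> nlinarith [sq_nonneg (p z0 + q z0), sq_nonneg (p z0 - q z0)]
  have ha : |1 + (1 + p z0 ^ 2) * (W z0)⁻¹| ≤ 1 + W z0 := by
    rw [abs_of_nonneg (by positivity), ← div_eq_mul_inv]
    gcongr
    rw [div_le_iff₀ hW0']
    nlinarith [sq_nonneg (q z0)]
  have hc : |1 + (1 + q z0 ^ 2) * (W z0)⁻¹| ≤ 1 + W z0 := by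
    rw [abs_of_nonneg (by positivity), ← div_eq_mul_inv]
    gcongr
    rw [div_le_iff₀ hW0']
    nlinarith [sq_nonneg (p z0)]
  have hαn : ‖α z0‖ ≤ 3 * W z0 := by
    refine (norm_add_le _ _).trans ?_
    rw [norm_mul, Complex.norm_I, mul_one, Complex.norm_real, Complex.norm_real,
      Real.norm_eq_abs, Real.norm_eq_abs]
    linarith
  have hβn : ‖β z0‖ ≤ 3 * W z0 := by
    refine (norm_add_le _ _).trans ?_
    rw [norm_mul, Complex.norm_I, mul_one, Complex.norm_real, Complex.norm_real,
      Real.norm_eq_abs, Real.norm_eq_abs]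
    linarith
  have hgen : ∀ (y γ δ : ℂ), ‖γ‖ ≤ 3 * W z0 → y = Gx z0 / α z0 * γ →
      |(1 + W z0) ^ 2 * (starRingEnd ℂ (G z0) * y).re| ≤ 12 / ρ * W z0 ^ 2 := by
    intro y γ _ hγ hy
    have h3 : |(starRingEnd ℂ (G z0) * y).re| ≤ 1 * (2 / (1 + W z0) / ρ * (3 * W z0)) := by
      refine (Complex.abs_re_le_norm _).trans ?_
      rw [norm_mul, RCLike.norm_conj, hy, norm_mul]
      have := (hG1 z0 hz0).le
      gcongr
    rw [abs_mul, abs_of_nonneg (by positivity)]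
    calc (1 + W z0) ^ 2 * |(starRingEnd ℂ (G z0) * y).re|
        ≤ (1 + W z0) ^ 2 * (1 * (2 / (1 + W z0) / ρ * (3 * W z0))) := by gcongr
      _ = 6 / ρ * ((1 + W z0) * W z0) := by field_simp; ring
      _ ≤ 6 / ρ * (2 * W z0 * W z0) := by gcongr; linarith
      _ = 12 / ρ * W z0 ^ 2 := by ring
  have h1W : 1 + W z0 ≠ 0 := by linarith
  constructor
  · have h5 := hgen (Gx z0) (α z0) 0 hαn (div_mul_cancel₀ _ (hα0 z0)).symm
    have h6 := mse_alg (r := r z0) (s := s z0) hW0'.ne' h1W h2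
    rw [mul_re, conj_re, conj_im] at h5
    simp only [hG, hGx, mse_re', mse_im', hg1x, hg2x, hK, neg_neg, mul_neg, sub_neg_eq_add] at h5
    rw [← h6] at h5
    exact h5
  · have h5 := hgen (Gy z0) (β z0) 0 hβn (by
      rw [div_mul_eq_mul_div, hCR z0 hz0, mul_div_cancel_right₀ _ (hα0 z0)])
    have h6 := mse_alg' (s := s z0) (t := t z0) hW0'.ne' h1W h2
    rw [mul_re, conj_re, conj_im] at h5
    simp only [hG, hGy, mse_re', mse_im', hg1y, hg2y, hK, neg_neg, mul_neg, sub_neg_eq_add] at h5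
    rw [← h6] at h5
    exact h5
end core

lemma mse_hasFDerivAt {f : ℝ × ℝ → ℝ} {z : ℝ × ℝ} (hf : DifferentiableAt ℝ f z) :
    pd1 f z = fderiv ℝ f z (1, 0) ∧ pd2 f z = fderiv ℝ f z (0, 1) := by
  constructor
  · have h1 : HasDerivAt (fun t : ℝ => (t, z.2)) ((1 : ℝ), (0 : ℝ)) z.1 :=
      (hasDerivAt_id z.1).prodMk (hasDerivAt_const z.1 z.2)
    exact (HasFDerivAt.comp_hasDerivAt z.1 (f := fun t : ℝ => (t, z.2)) hf.hasFDerivAt h1).deriv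
  · have h1 : HasDerivAt (fun t : ℝ => (z.1, t)) ((0 : ℝ), (1 : ℝ)) z.2 :=
      (hasDerivAt_const z.2 z.1).prodMk (hasDerivAt_id z.2)
    exact (HasFDerivAt.comp_hasDerivAt z.2 (f := fun t : ℝ => (z.1, t)) hf.hasFDerivAt h1).deriv

open Complex in
lemma mse_toC {f : ℝ × ℝ → ℝ} {w : ℂ} (hf : DifferentiableAt ℝ f (w.re, w.im)) :
    HasFDerivAt (fun w : ℂ => f (w.re, w.im))
      (pd1 f (w.re, w.im) • reCLM + pd2 f (w.re, w.im) • imCLM) w := by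
  obtain ⟨h1, h2⟩ := mse_hasFDerivAt hf
  have h3 : HasFDerivAt (fun w : ℂ => (w.re, w.im)) (reCLM.prod imCLM) w :=
    reCLM.hasFDerivAt.prodMk imCLM.hasFDerivAt
  have h4 := HasFDerivAt.comp w (f := fun w : ℂ => (w.re, w.im)) hf.hasFDerivAt h3
  refine h4.congr_fderiv ?_
  rw [h1, h2]
  apply mse_clm_ext <;> simp

lemma mse_second {u : ℝ × ℝ → ℝ} {Ω : Set (ℝ × ℝ)} (hΩ : IsOpen Ω) (hu : ContDiffOn ℝ 2 u Ω)
    {z : ℝ × ℝ} (hz : z ∈ Ω) :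
    DifferentiableAt ℝ (pd1 u) z ∧ DifferentiableAt ℝ (pd2 u) z ∧
      pd1 (pd2 u) z = pd2 (pd1 u) z := by
  have hd : ∀ y ∈ Ω, DifferentiableAt ℝ u y := fun y hy =>
    (hu.contDiffAt (hΩ.mem_nhds hy)).differentiableAt (by norm_num)
  have hc : ContDiffAt ℝ 2 u z := hu.contDiffAt (hΩ.mem_nhds hz)
  have hfd : DifferentiableAt ℝ (fderiv ℝ u) z :=
    (hc.fderiv_right (m := 1) (by norm_num)).differentiableAt (by norm_num)
  have e1 : pd1 u =ᶠ[𝓝 z] fun y => fderiv ℝ u y (1, 0) :=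
    Filter.eventually_of_mem (hΩ.mem_nhds hz) (fun y hy => (mse_hasFDerivAt (hd y hy)).1)
  have e2 : pd2 u =ᶠ[𝓝 z] fun y => fderiv ℝ u y (0, 1) :=
    Filter.eventually_of_mem (hΩ.mem_nhds hz) (fun y hy => (mse_hasFDerivAt (hd y hy)).2)
  have d1 : HasFDerivAt (pd1 u) ((fderiv ℝ (fderiv ℝ u) z).flip (1, 0)) z :=
    (hfd.hasFDerivAt.clm_apply (hasFDerivAt_const ((1 : ℝ), (0 : ℝ)) z)).congr_of_eventuallyEq e1
      |>.congr_fderiv (by ext <;> simp)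
  have d2 : HasFDerivAt (pd2 u) ((fderiv ℝ (fderiv ℝ u) z).flip (0, 1)) z :=
    (hfd.hasFDerivAt.clm_apply (hasFDerivAt_const ((0 : ℝ), (1 : ℝ)) z)).congr_of_eventuallyEq e2
      |>.congr_fderiv (by ext <;> simp)
  refine ⟨d1.differentiableAt, d2.differentiableAt, ?_⟩
  rw [(mse_hasFDerivAt d2.differentiableAt).1, (mse_hasFDerivAt d1.differentiableAt).2, d1.fderiv,
    d2.fderiv]
  exact (hc.isSymmSndFDerivAt (by simp)) (1, 0) (0, 1)

/-- Interior gradient estimate for `W`: there is a universal constant `c > 0` such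
that for every solution `u` of the minimal surfaces equation on an open set `Ω` and
every point `Q ∈ Ω` at distance at least `ρ` from `∂Ω`,
`‖∇W(Q)‖ ≤ (c/ρ)·W(Q)²`. -/
theorem gradW_bound :
    ∃ c > (0:ℝ), ∀ (Ω : Set (ℝ × ℝ)), IsOpen Ω → ∀ u : ℝ × ℝ → ℝ, IsMSE u Ω →
      ∀ ρ > (0:ℝ), ∀ Q ∈ Ω, eball Q ρ ⊆ Ω →
        Real.sqrt (pd1 (Wg u) Q ^ 2 + pd2 (Wg u) Q ^ 2) ≤ c / ρ * (Wg u Q) ^ 2 := by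
  refine ⟨24, by norm_num, ?_⟩
  intro Ω hΩ u hu ρ hρ Q hQ hball
  obtain ⟨hu2, hmse⟩ := hu
  set z0 : ℂ := ⟨Q.1, Q.2⟩ with hz0
  have hin : ∀ w ∈ Metric.ball z0 ρ, (w.re, w.im) ∈ Ω := by
    intro w hw
    apply hball
    rw [mem_ball_iff_norm, Complex.norm_eq_sqrt_sq_add_sq] at hw
    simpa [eball, len, hz0] using hw
  have hp : ∀ w ∈ Metric.ball z0 ρ, HasFDerivAt (fun w : ℂ => pd1 u (w.re, w.im))
      (pd1 (pd1 u) (w.re, w.im) • Complex.reCLM + pd2 (pd1 u) (w.re, w.im) • Complex.imCLM) w :=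
    fun w hw => mse_toC (mse_second hΩ hu2 (hin w hw)).1
  have hq : ∀ w ∈ Metric.ball z0 ρ, HasFDerivAt (fun w : ℂ => pd2 u (w.re, w.im))
      (pd2 (pd1 u) (w.re, w.im) • Complex.reCLM + pd2 (pd2 u) (w.re, w.im) • Complex.imCLM) w := by
    intro w hw
    have h := mse_second hΩ hu2 (hin w hw)
    rw [← h.2.2]
    exact mse_toC h.2.1
  have hcore := mse_core (r := fun w => pd1 (pd1 u) (w.re, w.im))
    (s := fun w => pd2 (pd1 u) (w.re, w.im)) (t := fun w => pd2 (pd2 u) (w.re, w.im)) hρ hp hq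
    (fun w hw => hmse _ (hin w hw))
  have hself : z0 ∈ Metric.ball z0 ρ := Metric.mem_ball_self hρ
  have hWd := mse_W (r := fun w => pd1 (pd1 u) (w.re, w.im))
    (s := fun w => pd2 (pd1 u) (w.re, w.im)) (t := fun w => pd2 (pd2 u) (w.re, w.im))
    (hp z0 hself) (hq z0 hself)
  have hWdiff : DifferentiableAt ℝ (Wg u) (z0.re, z0.im) := by
    obtain ⟨h1, h2, -⟩ := mse_second hΩ hu2 hQ
    have : DifferentiableAt ℝ (fun z => 1 + pd1 u z ^ 2 + pd2 u z ^ 2) Q := by fun_prop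
    exact this.sqrt (by positivity)
  have hW' := mse_toC hWdiff
  have heq := hWd.unique hW'
  have e1 := DFunLike.congr_fun heq 1
  have e2 := DFunLike.congr_fun heq Complex.I
  simp only [ContinuousLinearMap.add_apply, ContinuousLinearMap.smul_apply, Complex.reCLM_apply,
    Complex.imCLM_apply, Complex.one_re, Complex.one_im, Complex.I_re, Complex.I_im, smul_eq_mul, mul_one, mul_zero, add_zero,
    zero_add] at e1 e2
  obtain ⟨c1, c2⟩ := hcore
  rw [e1] at c1
  rw [e2] at c2
  change |pd1 (Wg u) Q| ≤ 12 / ρ * Wg u Q ^ 2 at c1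
  change |pd2 (Wg u) Q| ≤ 12 / ρ * Wg u Q ^ 2 at c2
  have h5 : Real.sqrt (pd1 (Wg u) Q ^ 2 + pd2 (Wg u) Q ^ 2)
      ≤ |pd1 (Wg u) Q| + |pd2 (Wg u) Q| := by
    rw [Real.sqrt_le_left (by positivity)]
    nlinarith [sq_abs (pd1 (Wg u) Q), sq_abs (pd2 (Wg u) Q),
      mul_nonneg (abs_nonneg (pd1 (Wg u) Q)) (abs_nonneg (pd2 (Wg u) Q))]
  calc _ ≤ _ := h5
    _ ≤ 12 / ρ * Wg u Q ^ 2 + 12 / ρ * Wg u Q ^ 2 := add_le_add c1 c2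
    _ = _ := by ring
end

section
/- Let r > 0 and let (u_n) be a sequence of C² solutions of the minimal surfaces equation on the open disk D(0,r) ⊂ ℝ². Suppose the downward unit normals N_n(0) to the graphs of u_n at the origin converge to the horizontal vector (1,0,0). Then for every α ∈ (0,1) there exists a strictly increasing map θ : ℕ → ℕ such that N_{θ(n)}(0,y) converges to (1,0,0) for Lebesgue-almost every y ∈ [−αr, αr]. -/
open Real Filter Set Topology MeasureTheory

/-- Downward unit normal of the graph of `u` at `z`. -/
noncomputable def Nvec (u : ℝ × ℝ → ℝ) (z : ℝ × ℝ) : ℝ × ℝ × ℝ :=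
  (pd1 u z / Wg u z, pd2 u z / Wg u z, -1 / Wg u z)

/-- The real linear form `v ↦ a v.re + b v.im`. -/
noncomputable def lin (a b : ℝ) : ℂ →L[ℝ] ℝ := a • Complex.reCLM + b • Complex.imCLM

@[simp] lemma lin_apply (a b : ℝ) (v : ℂ) : lin a b v = a * v.re + b * v.im := by
  simp [lin]

/-- The real linear map with the given real and imaginary parts. -/
noncomputable def C2 (A B : ℂ →L[ℝ] ℝ) : ℂ →L[ℝ] ℂ :=
  Complex.ofRealCLM.comp A + Complex.I • Complex.ofRealCLM.comp B

@[simp] lemma C2_re (A B : ℂ →L[ℝ] ℝ) (v : ℂ) : (C2 A B v).re = A v := by simp [C2]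
@[simp] lemma C2_im (A B : ℂ →L[ℝ] ℝ) (v : ℂ) : (C2 A B v).im = B v := by simp [C2]

lemma hasFDerivAt_C2 {f g : ℂ → ℝ} {A B : ℂ →L[ℝ] ℝ} {z : ℂ} (hf : HasFDerivAt f A z)
    (hg : HasFDerivAt g B z) :
    HasFDerivAt (fun z => (f z : ℂ) + Complex.I * (g z : ℂ)) (C2 A B) z := by
  have h1 := Complex.ofRealCLM.hasFDerivAt.comp z hf
  have h2 := (Complex.ofRealCLM.hasFDerivAt.comp z hg).const_smul Complex.I
  exact h1.add h2

lemma lin_norm_le {a b : ℝ} (h : a ^ 2 + b ^ 2 ≤ 1) : ‖lin a b‖ ≤ 1 := by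
  refine ContinuousLinearMap.opNorm_le_bound _ zero_le_one fun v => ?_
  rw [lin_apply, one_mul, Real.norm_eq_abs]
  refine abs_le_of_sq_le_sq ?_ (norm_nonneg v)
  rw [Complex.sq_norm, Complex.normSq_apply]
  nlinarith [sq_nonneg (a * v.im - b * v.re), mul_nonneg (sub_nonneg.2 h) (add_nonneg (sq_nonneg v.re) (sq_nonneg v.im))]

lemma poincare_real {r : ℝ} {A B : ℂ → ℝ}
    (h : ∀ z ∈ Metric.ball (0:ℂ) r, ∃ a b b' c, HasFDerivAt A (lin a b) z ∧ HasFDerivAt B (lin b' c) z ∧ b = b') :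
    ∃ f : ℂ → ℝ, ∀ z ∈ Metric.ball (0:ℂ) r, HasFDerivAt f (lin (A z) (B z)) z := by
  choose! a b b' c hA hB hbb using h
  have hω : ∀ z ∈ Metric.ball (0:ℂ) r, HasFDerivAt (fun z => lin (A z) (B z))
      ((lin (a z) (b z)).smulRight Complex.reCLM + (lin (b' z) (c z)).smulRight Complex.imCLM) z := by
    intro z hz
    exact ((hA z hz).smul_const Complex.reCLM).add ((hB z hz).smul_const Complex.imCLM)
  refine (convex_ball (0:ℂ) r).exists_forall_hasFDerivAt_of_fderiv_symmetric Metric.isOpen_ball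
    (fun z hz => (hω z hz).differentiableAt.differentiableWithinAt) ?_
  intro z hz x y
  rw [(hω z hz).fderiv, hbb z hz]
  simp
  ring

lemma hasDerivAt_re {F : ℂ → ℝ} {L : ℂ →L[ℝ] ℝ} {x y : ℝ} (h : HasFDerivAt F L ⟨x, y⟩) :
    HasDerivAt (fun t : ℝ => F ⟨t, y⟩) (L 1) x := by
  have h1 : HasDerivAt (fun t : ℝ => (⟨t, y⟩ : ℂ)) 1 x := by
    have := (Complex.ofRealCLM.hasDerivAt (x := x)).add_const (Complex.I * y)
    convert! this using 2
    · apply Complex.ext <;> simp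
  exact HasFDerivAt.comp_hasDerivAt x h h1

lemma hasDerivAt_im {F : ℂ → ℝ} {L : ℂ →L[ℝ] ℝ} {x y : ℝ} (h : HasFDerivAt F L ⟨x, y⟩) :
    HasDerivAt (fun t : ℝ => F ⟨x, t⟩) (L Complex.I) y := by
  have h1 : HasDerivAt (fun t : ℝ => (⟨x, t⟩ : ℂ)) Complex.I y := by
    have := ((Complex.ofRealCLM.hasDerivAt (x := y)).const_mul Complex.I).const_add (x : ℂ)
    convert! this using 2
    · apply Complex.ext <;> simp
    · apply Complex.ext <;> simp
  exact HasFDerivAt.comp_hasDerivAt y h h1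

lemma eball_iff {r : ℝ} {z : ℂ} : (z.re, z.im) ∈ eball 0 r ↔ z ∈ Metric.ball (0:ℂ) r := by
  simp only [eball, len, Set.mem_ofPred_eq, sub_zero, mem_ball_zero_iff]
  rw [Complex.norm_def, Complex.normSq_apply]
  simp [sq]

lemma mse_extract {u : ℝ × ℝ → ℝ} {r : ℝ} (hu : IsMSE u (eball 0 r)) :
    ∀ z ∈ Metric.ball (0:ℂ) r,
      HasFDerivAt (fun z : ℂ => u (z.re, z.im)) (lin (pd1 u (z.re, z.im)) (pd2 u (z.re, z.im))) z ∧
      ∃ a b c : ℝ, HasFDerivAt (fun z : ℂ => pd1 u (z.re, z.im)) (lin a b) z ∧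
        HasFDerivAt (fun z : ℂ => pd2 u (z.re, z.im)) (lin b c) z ∧
        (1 + pd2 u (z.re, z.im) ^ 2) * a - 2 * pd1 u (z.re, z.im) * pd2 u (z.re, z.im) * b
          + (1 + pd1 u (z.re, z.im) ^ 2) * c = 0 := by
  obtain ⟨hC, hE⟩ := hu
  set U : ℂ → ℝ := fun z => u (z.re, z.im) with hU
  have hC' : ∀ z ∈ Metric.ball (0:ℂ) r, ContDiffAt ℝ 2 U z := by
    have h1 : ContDiffOn ℝ 2 U (Metric.ball (0:ℂ) r) := by
      refine hC.comp (f := fun z : ℂ => (z.re, z.im)) ?_ ?_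
      · exact (Complex.reCLM.contDiff.prodMk Complex.imCLM.contDiff).contDiffOn
      · intro z hz; exact eball_iff.2 hz
    exact fun z hz => h1.contDiffAt (Metric.isOpen_ball.mem_nhds hz)
  have hd : ∀ z ∈ Metric.ball (0:ℂ) r, HasFDerivAt U (fderiv ℝ U z) z := fun z hz =>
    ((hC' z hz).differentiableAt (by norm_num)).hasFDerivAt
  have hp1 : ∀ z ∈ Metric.ball (0:ℂ) r, pd1 u (z.re, z.im) = fderiv ℝ U z 1 := fun z hz =>
    (hasDerivAt_re (x := z.re) (y := z.im) (hd z hz)).deriv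
  have hp2 : ∀ z ∈ Metric.ball (0:ℂ) r, pd2 u (z.re, z.im) = fderiv ℝ U z Complex.I := fun z hz =>
    (hasDerivAt_im (x := z.re) (y := z.im) (hd z hz)).deriv
  have hlin : ∀ M : ℂ →L[ℝ] ℝ, M = lin (M 1) (M Complex.I) := by
    intro M
    ext v
    have : v = v.re • (1:ℂ) + v.im • Complex.I := by apply Complex.ext <;> simp
    conv_lhs => rw [this]
    rw [map_add, map_smul, map_smul, lin_apply]
    simp [mul_comm]
  intro z hz
  constructor
  · rw [hp1 z hz, hp2 z hz, ← hlin]; exact hd z hz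
  · have hD : HasFDerivAt (fderiv ℝ U) (fderiv ℝ (fderiv ℝ U) z) z :=
      (((hC' z hz).fderiv_right (m := 1) (by norm_num)).differentiableAt (by norm_num)).hasFDerivAt
    have hsym : IsSymmSndFDerivAt ℝ U z := (hC' z hz).isSymmSndFDerivAt (by simp)
    set D := fderiv ℝ (fderiv ℝ U) z with hDdef
    have e1 : HasFDerivAt (fun z : ℂ => pd1 u (z.re, z.im)) (lin (D 1 1) (D Complex.I 1)) z := by
      have := (hD.clm_apply (hasFDerivAt_const (1:ℂ) z))
      rw [hlin (_ + _)] at this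
      refine HasFDerivAt.congr_of_eventuallyEq (f := fun z => fderiv ℝ U z 1) ?_ ?_
      · simpa using this
      · filter_upwards [Metric.isOpen_ball.mem_nhds hz] with w hw using hp1 w hw
    have e2 : HasFDerivAt (fun z : ℂ => pd2 u (z.re, z.im)) (lin (D 1 Complex.I) (D Complex.I Complex.I)) z := by
      have := (hD.clm_apply (hasFDerivAt_const (Complex.I:ℂ) z))
      rw [hlin (_ + _)] at this
      refine HasFDerivAt.congr_of_eventuallyEq (f := fun z => fderiv ℝ U z Complex.I) ?_ ?_
      · simpa using this
      · filter_upwards [Metric.isOpen_ball.mem_nhds hz] with w hw using hp2 w hw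
    have hs : D 1 Complex.I = D Complex.I 1 := hsym 1 Complex.I
    refine ⟨D 1 1, D Complex.I 1, D Complex.I Complex.I, e1, hs ▸ e2, ?_⟩
    have := hE (z.re, z.im) (eball_iff.2 hz)
    have f1 : pd1 (pd1 u) (z.re, z.im) = D 1 1 := by
      have := (hasDerivAt_re (x := z.re) (y := z.im) e1).deriv
      simp at this
      exact this
    have f2 : pd2 (pd1 u) (z.re, z.im) = D Complex.I 1 := by
      have := (hasDerivAt_im (x := z.re) (y := z.im) e1).deriv
      simp at this
      exact this
    have f3 : pd2 (pd2 u) (z.re, z.im) = D Complex.I Complex.I := by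
      have := (hasDerivAt_im (x := z.re) (y := z.im) e2).deriv
      simp at this
      exact this
    rw [f1, f2, f3] at this
    exact this

/-- `W` as a function of `p, q`. -/
noncomputable def ww (p q : ℝ) : ℝ := Real.sqrt (1 + p ^ 2 + q ^ 2)

lemma ww_sq (p q : ℝ) : ww p q ^ 2 = 1 + p ^ 2 + q ^ 2 := Real.sq_sqrt (by positivity)
lemma ww_pos (p q : ℝ) : 0 < ww p q := Real.sqrt_pos.2 (by positivity)

/-- The three closed forms attached to the minimal surface equation. -/
lemma closed_forms {r : ℝ} {P Q : ℂ → ℝ}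
    (h : ∀ z ∈ Metric.ball (0:ℂ) r, ∃ a b c : ℝ, HasFDerivAt P (lin a b) z ∧
        HasFDerivAt Q (lin b c) z ∧
        (1 + Q z ^ 2) * a - 2 * P z * Q z * b + (1 + P z ^ 2) * c = 0) :
    ∃ S X Y : ℂ → ℝ, ∀ z ∈ Metric.ball (0:ℂ) r,
      HasFDerivAt S (lin (-Q z / ww (P z) (Q z)) (P z / ww (P z) (Q z))) z ∧
      HasFDerivAt X (lin ((1 + P z ^ 2) / ww (P z) (Q z)) (P z * Q z / ww (P z) (Q z))) z ∧
      HasFDerivAt Y (lin (P z * Q z / ww (P z) (Q z)) ((1 + Q z ^ 2) / ww (P z) (Q z))) z := by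
  -- derivative of `1 / W`
  have key : ∀ (N : ℝ → ℝ → ℝ) (N1 N2 : ℝ) (z : ℂ) (a b c : ℝ), HasFDerivAt P (lin a b) z →
      HasFDerivAt Q (lin b c) z →
      HasFDerivAt (fun z => N (P z) (Q z)) (lin (N1 * a + N2 * b) (N1 * b + N2 * c)) z →
      HasFDerivAt (fun z => N (P z) (Q z) / ww (P z) (Q z))
        (lin ((N1 * a + N2 * b) / ww (P z) (Q z)
              - N (P z) (Q z) * (P z * a + Q z * b) / ww (P z) (Q z) ^ 3)
             ((N1 * b + N2 * c) / ww (P z) (Q z)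
              - N (P z) (Q z) * (P z * b + Q z * c) / ww (P z) (Q z) ^ 3)) z := by
    intro N N1 N2 z a b c hP hQ hN
    have hWpos := ww_pos (P z) (Q z)
    have hW2 := ww_sq (P z) (Q z)
    have hpos : (1 + P z ^ 2 + Q z ^ 2) ≠ 0 := by positivity
    have hW : HasFDerivAt (fun z => ww (P z) (Q z))
        (lin ((P z * a + Q z * b) / ww (P z) (Q z)) ((P z * b + Q z * c) / ww (P z) (Q z))) z := by
      have h1 := (((hP.pow 2).const_add 1).add (hQ.pow 2)).sqrt hpos
      refine h1.congr_fderiv ?_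
      change (1 / (2 * ww (P z) (Q z))) • _ = _
      ext v
      simp
      field_simp
      ring
    have h2 := hN.mul ((hasDerivAt_inv hWpos.ne').comp_hasFDerivAt z hW)
    simp only [div_eq_mul_inv _ (ww (P _) (Q _))]
    refine h2.congr_fderiv ?_
    ext v
    simp
    field_simp
    ring
  have base : ∀ z ∈ Metric.ball (0:ℂ) r, 0 < ww (P z) (Q z) := fun z _ => ww_pos _ _
  obtain ⟨S, hS⟩ := poincare_real (r := r) (A := fun z => -Q z / ww (P z) (Q z))
    (B := fun z => P z / ww (P z) (Q z)) (by
      intro z hz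
      obtain ⟨a, b, c, hP, hQ, hE⟩ := h z hz
      have k1 := key (fun _ q => -q) 0 (-1) z a b c hP hQ
        (hQ.neg.congr_fderiv (by ext v; simp; ring))
      have k2 := key (fun p _ => p) 1 0 z a b c hP hQ
        (hP.congr_fderiv (by ext v; simp))
      refine ⟨_, _, _, _, k1, k2, ?_⟩
      have hWpos := ww_pos (P z) (Q z)
      have hW2 := ww_sq (P z) (Q z)
      field_simp
      rw [hW2]
      linear_combination -hE)
  obtain ⟨X, hX⟩ := poincare_real (r := r) (A := fun z => (1 + P z ^ 2) / ww (P z) (Q z))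
    (B := fun z => P z * Q z / ww (P z) (Q z)) (by
      intro z hz
      obtain ⟨a, b, c, hP, hQ, hE⟩ := h z hz
      have k1 := key (fun p _ => 1 + p ^ 2) (2 * P z) 0 z a b c hP hQ
        (((hP.pow 2).const_add 1).congr_fderiv (by ext v; simp; ring))
      have k2 := key (fun p q => p * q) (Q z) (P z) z a b c hP hQ
        ((hP.mul hQ).congr_fderiv (by ext v; simp; ring))
      refine ⟨_, _, _, _, k1, k2, ?_⟩
      have hWpos := ww_pos (P z) (Q z)
      have hW2 := ww_sq (P z) (Q z)
      field_simp
      rw [hW2]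
      linear_combination -Q z * hE)
  obtain ⟨Y, hY⟩ := poincare_real (r := r) (A := fun z => P z * Q z / ww (P z) (Q z))
    (B := fun z => (1 + Q z ^ 2) / ww (P z) (Q z)) (by
      intro z hz
      obtain ⟨a, b, c, hP, hQ, hE⟩ := h z hz
      have k1 := key (fun _ q => 1 + q ^ 2) 0 (2 * Q z) z a b c hP hQ
        (((hQ.pow 2).const_add 1).congr_fderiv (by ext v; simp; ring))
      have k2 := key (fun p q => p * q) (Q z) (P z) z a b c hP hQ
        ((hP.mul hQ).congr_fderiv (by ext v; simp; ring))
      refine ⟨_, _, _, _, k2, k1, ?_⟩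
      have hWpos := ww_pos (P z) (Q z)
      have hW2 := ww_sq (P z) (Q z)
      field_simp
      rw [hW2]
      linear_combination P z * hE)
  exact ⟨S, X, Y, fun z hz => ⟨hS z hz, hX z hz, hY z hz⟩⟩

/-- Differential of the Lewy–Nitsche map. -/
noncomputable def LL (p q : ℝ) : ℂ →L[ℝ] ℂ :=
  C2 (lin (1 + (1 + p ^ 2) / ww p q) (p * q / ww p q))
    (lin (p * q / ww p q) (1 + (1 + q ^ 2) / ww p q))

/-- Inverse of the differential of the Lewy–Nitsche map. -/
noncomputable def MM (p q : ℝ) : ℂ →L[ℝ] ℂ :=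
  C2 (lin ((ww p q + 1 + q ^ 2) / (ww p q + 1) ^ 2) (-(p * q) / (ww p q + 1) ^ 2))
    (lin (-(p * q) / (ww p q + 1) ^ 2) ((ww p q + 1 + p ^ 2) / (ww p q + 1) ^ 2))

lemma LM (p q : ℝ) (v : ℂ) : LL p q (MM p q v) = v := by
  have hW := ww_pos p q
  have hW2 := ww_sq p q
  have hq : q ^ 2 = ww p q ^ 2 - 1 - p ^ 2 := by linarith
  apply Complex.ext <;> simp [LL, MM] <;> field_simp <;> ring_nf <;> grind

lemma ML (p q : ℝ) (v : ℂ) : MM p q (LL p q v) = v := by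
  have hW := ww_pos p q
  have hW2 := ww_sq p q
  apply Complex.ext <;> simp [LL, MM] <;> field_simp <;> ring_nf <;> grind

/-- The differential of the Lewy–Nitsche map as an equivalence. -/
noncomputable def LQ (p q : ℝ) : ℂ ≃L[ℝ] ℂ :=
  ContinuousLinearEquiv.equivOfInverse (LL p q) (MM p q) (ML p q) (LM p q)

lemma LQ_coe (p q : ℝ) : (LQ p q : ℂ →L[ℝ] ℂ) = LL p q := rfl
lemma LQ_symm_coe (p q : ℝ) : ((LQ p q).symm : ℂ →L[ℝ] ℂ) = MM p q := rfl

/-- The Gauss map. -/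
noncomputable def gg (p q : ℝ) : ℂ := ⟨p / (1 + ww p q), -q / (1 + ww p q)⟩

lemma gg_norm_le (p q : ℝ) : ‖gg p q‖ ≤ 1 := by
  have hW := ww_pos p q
  have hW2 := ww_sq p q
  refine abs_le_of_sq_le_sq (b := 1) ?_ zero_le_one |>.trans' (le_abs_self _)
  rw [Complex.sq_norm, Complex.normSq_apply]
  simp only [gg]
  rw [show p / (1 + ww p q) * (p / (1 + ww p q)) + -q / (1 + ww p q) * (-q / (1 + ww p q))
    = (p ^ 2 + q ^ 2) / (1 + ww p q) ^ 2 by field_simp, div_le_iff₀ (by positivity)]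
  nlinarith

lemma dH_MM (p q : ℝ) (v : ℂ) :
    C2 (lin p q) (lin (-q / ww p q) (p / ww p q)) (MM p q v) = gg p q * v := by
  have hW := ww_pos p q
  have hW2 := ww_sq p q
  apply Complex.ext <;> simp [gg, MM] <;> field_simp <;> ring_nf <;> grind

lemma MM_I (p q : ℝ) : ‖MM p q Complex.I - Complex.I‖ ≤ ‖gg p q - 1‖ := by
  have hW := ww_pos p q
  have hW2 := ww_sq p q
  have h : MM p q Complex.I - Complex.I
      = Complex.I * ((starRingEnd ℂ) ((gg p q - 1) * (gg p q + 1))) / 2 := by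
    apply Complex.ext <;> simp [gg, MM] <;> field_simp <;> ring_nf <;> grind
  rw [h]
  simp only [norm_div, norm_mul, Complex.norm_I, RCLike.norm_conj, one_mul, Complex.norm_ofNat]
  have : ‖gg p q + 1‖ ≤ 2 := (norm_add_le _ _).trans (by have := gg_norm_le p q; simp; linarith)
  rw [div_le_iff₀ (by norm_num)]
  exact mul_le_mul_of_nonneg_left this (norm_nonneg _)

lemma LL_mono (p q : ℝ) (v : ℂ) :
    ‖v‖ ^ 2 ≤ v.re * (LL p q v).re + v.im * (LL p q v).im := by
  have hW := ww_pos p q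
  rw [Complex.sq_norm, Complex.normSq_apply]
  simp only [LL, C2_re, C2_im, lin_apply]
  have : 0 ≤ (v.re ^ 2 + v.im ^ 2 + (p * v.re + q * v.im) ^ 2) / ww p q := by positivity
  have e : v.re * ((1 + (1 + p ^ 2) / ww p q) * v.re + p * q / ww p q * v.im)
      + v.im * (p * q / ww p q * v.re + (1 + (1 + q ^ 2) / ww p q) * v.im)
      = v.re * v.re + v.im * v.im
        + (v.re ^ 2 + v.im ^ 2 + (p * v.re + q * v.im) ^ 2) / ww p q := by
    field_simp; ring
  linarith

lemma harnack {f : ℂ → ℂ} {c : ℂ} {R : ℝ} (hR : 0 < R)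
    (hf : DifferentiableOn ℂ f (Metric.ball c R))
    (h1 : ∀ z ∈ Metric.ball c R, ‖f z‖ ≤ 1) {w : ℂ} (hw : ‖w‖ < R) :
    ‖f (c + w) - 1‖ ≤ ‖f c - 1‖ * ((R + ‖w‖) / (R - ‖w‖)) := by
  have hmap : MapsTo (fun z => c + z) (Metric.ball 0 R) (Metric.ball c R) := by
    intro z hz; simpa using hz
  have hF : DifferentiableOn ℂ (fun z => f (c + z) - 1) (Metric.ball 0 R) :=
    (hf.comp (by fun_prop) hmap).sub_const 1
  have hpos : 0 < R - ‖w‖ := by linarith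
  have key : ∀ M > 0, ‖f (c + w) - 1‖ ≤ 2 * M * ‖w‖ / (R - ‖w‖)
      + ‖f c - 1‖ * (R + ‖w‖) / (R - ‖w‖) := by
    intro M hM
    have := Complex.borelCaratheodory hM hF (z := w) ?_ hR (by simpa using hw)
    · simpa using this
    · intro z hz
      have a1 := h1 _ (hmap hz)
      have a2 := Complex.re_le_norm (f (c + z))
      simp only [Set.mem_ofPred_eq, Complex.sub_re, Complex.one_re]
      linarith
  have hlim : Tendsto (fun M : ℝ => 2 * M * ‖w‖ / (R - ‖w‖)
      + ‖f c - 1‖ * (R + ‖w‖) / (R - ‖w‖)) (𝓝[>] 0)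
      (𝓝 (2 * 0 * ‖w‖ / (R - ‖w‖) + ‖f c - 1‖ * (R + ‖w‖) / (R - ‖w‖))) := by
    apply Tendsto.mono_left _ nhdsWithin_le_nhds
    apply Continuous.tendsto
    fun_prop
  have := ge_of_tendsto hlim (by filter_upwards [self_mem_nhdsWithin] with M hM using key M hM)
  simpa [mul_div_assoc] using this

lemma expanding_s10 {r : ℝ} {f : ℂ → ℂ} {P Q : ℂ → ℝ}
    (hf : ∀ z ∈ Metric.ball (0:ℂ) r, HasFDerivAt f (LL (P z) (Q z)) z)
    {z w : ℂ} (hz : z ∈ Metric.ball (0:ℂ) r) (hw : w ∈ Metric.ball (0:ℂ) r) :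
    ‖z - w‖ ≤ ‖f z - f w‖ := by
  set d := z - w with hd
  obtain ⟨x, hx, hx2⟩ := domain_mvt (f := fun z => lin d.re d.im (f z))
    (f' := fun z => (lin d.re d.im).comp (LL (P z) (Q z))) (s := Metric.ball (0:ℂ) r)
    (fun z hz => ((lin d.re d.im).hasFDerivAt.comp z (hf z hz)).hasFDerivWithinAt)
    (convex_ball _ _) hw hz
  rw [← map_sub] at hx2
  simp only [ContinuousLinearMap.comp_apply, ← hd] at hx2
  have h1 := LL_mono (P x) (Q x) d
  rw [lin_apply, lin_apply] at hx2
  set e := f z - f w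
  rw [← hx2] at h1
  have h2 : d.re * e.re + d.im * e.im ≤ ‖d‖ * ‖e‖ := by
    refine le_trans (le_abs_self _) (abs_le_of_sq_le_sq ?_ (by positivity))
    rw [mul_pow, Complex.sq_norm, Complex.normSq_apply, Complex.sq_norm, Complex.normSq_apply]
    nlinarith [sq_nonneg (d.re * e.im - d.im * e.re)]
  rcases (norm_nonneg d).eq_or_lt with h0 | h0
  · rw [← h0]; positivity
  · nlinarith

lemma surj_ball_s10 {r ρ : ℝ} (hρ : 0 < ρ) (hρr : ρ < r) {f : ℂ → ℂ}
    (hexp : ∀ z ∈ Metric.ball (0:ℂ) r, ∀ w ∈ Metric.ball (0:ℂ) r, ‖z - w‖ ≤ ‖f z - f w‖)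
    (hc : ContinuousOn f (Metric.ball (0:ℂ) r))
    (hopen : ∀ z ∈ Metric.ball (0:ℂ) r, map f (𝓝 z) = 𝓝 (f z)) :
    Metric.ball (f 0) ρ ⊆ f '' Metric.ball 0 ρ := by
  have hsub : Metric.closedBall (0:ℂ) ρ ⊆ Metric.ball 0 r := Metric.closedBall_subset_ball hρr
  have hsub' : Metric.ball (0:ℂ) ρ ⊆ Metric.ball 0 r := Metric.ball_subset_ball hρr.le
  refine (convex_ball (f 0) ρ).isPreconnected.subset_of_closure_inter_subset ?_ ?_ ?_
  · rw [isOpen_iff_mem_nhds]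
    rintro _ ⟨z, hz, rfl⟩
    rw [← hopen z (hsub' hz)]
    exact image_mem_map (Metric.isOpen_ball.mem_nhds hz)
  · exact ⟨f 0, Metric.mem_ball_self hρ, 0, Metric.mem_ball_self hρ, rfl⟩
  · rintro y ⟨hy, hyb⟩
    have hcl : IsClosed (f '' Metric.closedBall 0 ρ) :=
      ((isCompact_closedBall (0:ℂ) ρ).image_of_continuousOn (hc.mono hsub)).isClosed
    obtain ⟨z, hz, rfl⟩ := closure_minimal (image_mono Metric.ball_subset_closedBall) hcl hy
    refine ⟨z, ?_, rfl⟩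
    have := hexp z (hsub hz) 0 (hsub (Metric.mem_closedBall_self hρ.le))
    rw [mem_ball_iff_norm] at hyb ⊢
    linarith

lemma core {r ρ t : ℝ} (hρ : 0 < ρ) (hρr : ρ < r) (ht : |t| < ρ) {U S X Y P Q : ℂ → ℝ}
    (hU : ∀ z ∈ Metric.ball (0:ℂ) r, HasFDerivAt U (lin (P z) (Q z)) z)
    (hP : ContinuousOn P (Metric.ball (0:ℂ) r)) (hQ : ContinuousOn Q (Metric.ball (0:ℂ) r))
    (hS : ∀ z ∈ Metric.ball (0:ℂ) r,
      HasFDerivAt S (lin (-Q z / ww (P z) (Q z)) (P z / ww (P z) (Q z))) z)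
    (hX : ∀ z ∈ Metric.ball (0:ℂ) r,
      HasFDerivAt X (lin ((1 + P z ^ 2) / ww (P z) (Q z)) (P z * Q z / ww (P z) (Q z))) z)
    (hY : ∀ z ∈ Metric.ball (0:ℂ) r,
      HasFDerivAt Y (lin (P z * Q z / ww (P z) (Q z)) ((1 + Q z ^ 2) / ww (P z) (Q z))) z) :
    |S (Complex.I * t) - S 0 - t| ≤
      2 * |t| * (‖gg (P 0) (Q 0) - 1‖ * ((ρ + |t|) / (ρ - |t|))) := by
  have hr : 0 < r := hρ.trans hρr
  set B := Metric.ball (0:ℂ) r with hB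
  have h0B : (0:ℂ) ∈ B := Metric.mem_ball_self hr
  have hsub' : Metric.ball (0:ℂ) ρ ⊆ B := Metric.ball_subset_ball hρr.le
  -- the Lewy–Nitsche map
  set f : ℂ → ℂ := fun z => ((z.re + X z : ℝ) : ℂ) + Complex.I * ((z.im + Y z : ℝ) : ℂ) with hfdef
  have hf : ∀ z ∈ B, HasFDerivAt f (LL (P z) (Q z)) z := by
    intro z hz
    refine (hasFDerivAt_C2 ((Complex.reCLM.hasFDerivAt (x := z)).add (hX z hz))
      ((Complex.imCLM.hasFDerivAt (x := z)).add (hY z hz))).congr_fderiv ?_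
    ext v
    apply Complex.ext <;> simp [LL] <;> ring
  have hLcont : ContinuousOn (fun z => LL (P z) (Q z)) B := by
    have hw : ContinuousOn (fun z => ww (P z) (Q z)) B := by
      unfold ww; fun_prop
    have hwne : ∀ z ∈ B, ww (P z) (Q z) ≠ 0 := fun z _ => (ww_pos _ _).ne'
    have hlin : ∀ {a b : ℂ → ℝ}, ContinuousOn a B → ContinuousOn b B →
        ContinuousOn (fun z => lin (a z) (b z)) B := by
      intro a b ha hb
      exact (ha.smul continuousOn_const).add (hb.smul continuousOn_const)
    have hC2 : ∀ {a b : ℂ → ℂ →L[ℝ] ℝ}, ContinuousOn a B → ContinuousOn b B →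
        ContinuousOn (fun z => C2 (a z) (b z)) B := by
      intro a b ha hb
      unfold C2
      have h1 : ContinuousOn (fun z => Complex.ofRealCLM.comp (a z)) B :=
        continuousOn_const.clm_comp ha
      have h2 : ContinuousOn (fun z => Complex.ofRealCLM.comp (b z)) B :=
        continuousOn_const.clm_comp hb
      exact h1.add (h2.const_smul Complex.I)
    unfold LL
    apply hC2 <;> apply hlin
    · exact continuousOn_const.add (ContinuousOn.div (by fun_prop) hw hwne)
    · exact ContinuousOn.div (by fun_prop) hw hwne
    · exact ContinuousOn.div (by fun_prop) hw hwne
    · exact continuousOn_const.add (ContinuousOn.div (by fun_prop) hw hwne)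
  have hopen : ∀ z ∈ B, map f (𝓝 z) = 𝓝 (f z) := by
    intro z hz
    have hn : B ∈ 𝓝 z := Metric.isOpen_ball.mem_nhds hz
    have : HasStrictFDerivAt f (LL (P z) (Q z)) z :=
      hasStrictFDerivAt_of_hasFDerivAt_of_continuousAt
        (f' := fun z => LL (P z) (Q z))
        (by filter_upwards [hn] with y hy using hf y hy) (hLcont.continuousAt hn)
    rw [← LQ_coe] at this
    exact this.map_nhds_eq_of_equiv
  have hexp : ∀ z ∈ B, ∀ w ∈ B, ‖z - w‖ ≤ ‖f z - f w‖ := fun z hz w hw => expanding_s10 hf hz hw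
  have hfc : ContinuousOn f B := fun z hz => (hf z hz).continuousAt.continuousWithinAt
  have hsurj := surj_ball_s10 hρ hρr hexp hfc hopen
  -- the inverse map
  have hsurj' : ∀ w ∈ Metric.ball (f 0) ρ, ∃ z, z ∈ Metric.ball (0:ℂ) ρ ∧ f z = w :=
    fun w hw => hsurj hw
  choose! Z hZm hZ using hsurj'
  set c := f 0 with hc
  have hZB : ∀ w ∈ Metric.ball c ρ, Z w ∈ B := fun w hw => hsub' (hZm w hw)
  have hcm : c ∈ Metric.ball c ρ := Metric.mem_ball_self hρ
  have hZc : Z c = 0 := by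
    have h1 := hexp (Z c) (hZB c hcm) 0 h0B
    rw [hZ c hcm, ← hc, sub_self] at h1
    simpa using h1
  have hZlip : ∀ w ∈ Metric.ball c ρ, ∀ w' ∈ Metric.ball c ρ, ‖Z w - Z w'‖ ≤ ‖w - w'‖ := by
    intro w hw w' hw'
    have := hexp (Z w) (hZB w hw) (Z w') (hZB w' hw')
    rwa [hZ w hw, hZ w' hw'] at this
  have hZd : ∀ w ∈ Metric.ball c ρ, HasFDerivAt Z (MM (P (Z w)) (Q (Z w))) w := by
    intro w hw
    have hn : Metric.ball c ρ ∈ 𝓝 w := Metric.isOpen_ball.mem_nhds hw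
    have hcont : ContinuousAt Z w := by
      have : LipschitzOnWith 1 Z (Metric.ball c ρ) := by
        refine LipschitzOnWith.of_dist_le_mul fun x hx y hy => ?_
        simpa [dist_eq_norm] using hZlip x hx y hy
      exact this.continuousOn.continuousAt hn
    have h1 := hf (Z w) (hZB w hw)
    rw [← LQ_coe] at h1
    have := HasFDerivAt.of_local_left_inverse hcont h1
      (by filter_upwards [hn] with y hy using hZ y hy)
    rwa [LQ_symm_coe] at this
  -- the holomorphic function
  set G : ℂ → ℂ := fun w => (U (Z w) : ℂ) + Complex.I * (S (Z w) : ℂ) with hG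
  have hGd : ∀ w ∈ Metric.ball c ρ, HasDerivAt G (gg (P (Z w)) (Q (Z w))) w := by
    intro w hw
    have h1 := (hasFDerivAt_C2 (hU _ (hZB w hw)) (hS _ (hZB w hw))).comp w (hZd w hw)
    rw [hasDerivAt_iff_hasFDerivAt]
    refine hasFDerivAt_of_restrictScalars ℝ h1 ?_
    ext v
    simp
    try rw [dH_MM]
    try simp
    ring
  have hGdiff : DifferentiableOn ℂ G (Metric.ball c ρ) := fun w hw =>
    (hGd w hw).differentiableAt.differentiableWithinAt
  set K := ‖gg (P 0) (Q 0) - 1‖ * ((ρ + |t|) / (ρ - |t|)) with hK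
  have hpos : 0 < ρ - |t| := by linarith
  have hbound : ∀ w : ℂ, ‖w‖ ≤ |t| → ‖gg (P (Z (c + w))) (Q (Z (c + w))) - 1‖ ≤ K := by
    intro w hw
    have hw' : ‖w‖ < ρ := hw.trans_lt ht
    have h1 := harnack hρ (hGdiff.deriv Metric.isOpen_ball) (fun z hz => by
      rw [(hGd z hz).deriv]; exact gg_norm_le _ _) hw'
    have hcw : c + w ∈ Metric.ball c ρ := by simpa using hw'
    rw [(hGd _ hcw).deriv, (hGd _ hcm).deriv, hZc] at h1
    refine h1.trans ?_
    rw [hK]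
    gcongr
  -- path
  have hmem : ∀ s ∈ Icc (0:ℝ) 1, ‖Complex.I * ((s * t : ℝ) : ℂ)‖ ≤ |t| := by
    intro s hs
    rw [norm_mul, Complex.norm_I, one_mul, Complex.norm_real, Real.norm_eq_abs, abs_mul,
      abs_of_nonneg hs.1]
    exact mul_le_of_le_one_left (abs_nonneg _) hs.2
  have hmem' : ∀ s ∈ Icc (0:ℝ) 1, c + Complex.I * ((s * t : ℝ) : ℂ) ∈ Metric.ball c ρ := by
    intro s hs
    have := (hmem s hs).trans_lt ht
    simpa using this
  have hpath : ∀ s : ℝ, HasDerivAt (fun s : ℝ => c + Complex.I * ((s * t : ℝ) : ℂ))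
      (t • Complex.I) s := by
    intro s
    have h1 : HasDerivAt (fun s : ℝ => s * t) (1 * t) s := (hasDerivAt_id s).mul_const t
    have h2 := (h1.ofReal_comp.const_mul Complex.I).const_add c
    refine h2.congr_deriv ?_
    simp [mul_comm]
  have e1 : ‖G (c + Complex.I * t) - G c - Complex.I * t‖ ≤ K * |t| := by
    have hd : ∀ s ∈ Icc (0:ℝ) 1, HasDerivWithinAt
        (fun s : ℝ => G (c + Complex.I * ((s * t : ℝ) : ℂ)) - (c + Complex.I * ((s * t : ℝ) : ℂ)))
        ((gg (P (Z (c + Complex.I * ((s * t : ℝ) : ℂ)))) (Q (Z (c + Complex.I * ((s * t : ℝ) : ℂ)))) - 1)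
          * (t • Complex.I)) (Icc 0 1) s := by
      intro s hs
      have h1 := ((hGd _ (hmem' s hs)).comp s (hpath s)).sub (hpath s)
      refine (h1.congr_deriv ?_).hasDerivWithinAt
      ring
    have := norm_image_sub_le_of_norm_deriv_le_segment_01' hd (C := K * |t|) (by
      intro s hs
      rw [norm_mul, norm_smul, Complex.norm_I, mul_one, Real.norm_eq_abs]
      exact mul_le_mul_of_nonneg_right (hbound _ (hmem s (Ico_subset_Icc_self hs))) (abs_nonneg _))
    refine le_trans (le_of_eq ?_) this
    congr 1
    simp
    ring
  have e2 : ‖Z (c + Complex.I * t) - Complex.I * t‖ ≤ K * |t| := by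
    have hd : ∀ s ∈ Icc (0:ℝ) 1, HasDerivWithinAt
        (fun s : ℝ => Z (c + Complex.I * ((s * t : ℝ) : ℂ)) - (c + Complex.I * ((s * t : ℝ) : ℂ)))
        (t • (MM (P (Z (c + Complex.I * ((s * t : ℝ) : ℂ)))) (Q (Z (c + Complex.I * ((s * t : ℝ) : ℂ))))
          Complex.I - Complex.I)) (Icc 0 1) s := by
      intro s hs
      have h1 := (HasFDerivAt.comp_hasDerivAt s (hZd _ (hmem' s hs)) (hpath s)).sub (hpath s)
      refine (h1.congr_deriv ?_).hasDerivWithinAt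
      rw [map_smul, smul_sub]
    have := norm_image_sub_le_of_norm_deriv_le_segment_01' hd (C := K * |t|) (by
      intro s hs
      rw [norm_smul, Real.norm_eq_abs, mul_comm]
      exact mul_le_mul_of_nonneg_right
        ((MM_I _ _).trans (hbound _ (hmem s (Ico_subset_Icc_self hs)))) (abs_nonneg _))
    refine le_trans (le_of_eq ?_) this
    congr 1
    simp [hZc]
    ring
  have htm : c + Complex.I * (t:ℂ) ∈ Metric.ball c ρ := by simpa using ht
  have htB : Complex.I * (t:ℂ) ∈ B := by
    rw [hB, mem_ball_zero_iff]; simpa using ht.trans hρr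
  have e3 : |S (Complex.I * t) - S (Z (c + Complex.I * t))| ≤ K * |t| := by
    have := (convex_ball (0:ℂ) r).norm_image_sub_le_of_norm_hasFDerivWithin_le
      (f := S) (C := 1) (fun z hz => (hS z hz).hasFDerivWithinAt) (fun z hz => by
        apply lin_norm_le
        have hW := ww_pos (P z) (Q z)
        have hW2 := ww_sq (P z) (Q z)
        rw [div_pow, div_pow, ← add_div, div_le_one (by positivity)]
        nlinarith) (hZB _ htm) htB
    rw [Real.norm_eq_abs, one_mul, norm_sub_rev] at this
    exact this.trans e2
  have e4 : |S (Z (c + Complex.I * t)) - S 0 - t| ≤ K * |t| := by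
    have := (Complex.abs_im_le_norm _).trans e1
    simpa [hG, hZc] using this
  rw [abs_le] at e3 e4 ⊢
  constructor <;> nlinarith

lemma int_bound {u : ℝ × ℝ → ℝ} {r α : ℝ} (hr : 0 < r) (hα : α ∈ Ioo (0:ℝ) 1)
    (hu : IsMSE u (eball 0 r)) :
    ContinuousOn (fun y : ℝ => 1 - pd1 u (0, y) / Wg u (0, y)) (Icc (-(α * r)) (α * r)) ∧
    ∫ y in (-(α * r))..(α * r), (1 - pd1 u (0, y) / Wg u (0, y)) ≤
      ‖gg (pd1 u 0) (pd2 u 0) - 1‖ * (4 * (α * r) *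
        (((1 + α) / 2 * r + α * r) / ((1 + α) / 2 * r - α * r))) := by
  obtain ⟨hα0, hα1⟩ := hα
  have har : 0 < α * r := mul_pos hα0 hr
  have hext := mse_extract hu
  set P : ℂ → ℝ := fun z => pd1 u (z.re, z.im) with hPdef
  set Q : ℂ → ℝ := fun z => pd2 u (z.re, z.im) with hQdef
  obtain ⟨S, X, Y, hSXY⟩ := closed_forms (r := r) (P := P) (Q := Q) (fun z hz => (hext z hz).2)
  have hPc : ContinuousOn P (Metric.ball (0:ℂ) r) := fun z hz => by
    obtain ⟨a, b, c, h1, h2, -⟩ := (hext z hz).2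
    exact h1.continuousAt.continuousWithinAt
  have hQc : ContinuousOn Q (Metric.ball (0:ℂ) r) := fun z hz => by
    obtain ⟨a, b, c, h1, h2, -⟩ := (hext z hz).2
    exact h2.continuousAt.continuousWithinAt
  have hcore : ∀ t : ℝ, |t| = α * r → |S (Complex.I * t) - S 0 - t| ≤
      2 * |t| * (‖gg (P 0) (Q 0) - 1‖ *
        (((1 + α) / 2 * r + |t|) / ((1 + α) / 2 * r - |t|))) := fun t ht =>
    core (ρ := (1 + α) / 2 * r) (by positivity) (by nlinarith) (by rw [ht]; nlinarith)
      (fun z hz => (hext z hz).1) hPc hQc (fun z hz => (hSXY z hz).1)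
      (fun z hz => (hSXY z hz).2.1) (fun z hz => (hSXY z hz).2.2)
  have hmem : ∀ y ∈ Icc (-(α * r)) (α * r), (⟨0, y⟩ : ℂ) ∈ Metric.ball (0:ℂ) r := by
    intro y hy
    rw [← eball_iff]
    simp only [eball, len, Set.mem_ofPred_eq, sub_zero]
    rw [show (0:ℝ) ^ 2 + y ^ 2 = y ^ 2 by ring, Real.sqrt_sq_eq_abs]
    exact (abs_le.2 hy).trans_lt (by nlinarith)
  have hpath : ContinuousOn (fun y : ℝ => (⟨0, y⟩ : ℂ)) (Icc (-(α * r)) (α * r)) := by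
    have : (fun y : ℝ => (⟨0, y⟩ : ℂ)) = fun y : ℝ => Complex.I * (y : ℂ) := by
      funext y; apply Complex.ext <;> simp
    rw [this]
    fun_prop
  have hp : ContinuousOn (fun y : ℝ => pd1 u (0, y)) (Icc (-(α * r)) (α * r)) :=
    hPc.comp hpath hmem
  have hq : ContinuousOn (fun y : ℝ => pd2 u (0, y)) (Icc (-(α * r)) (α * r)) :=
    hQc.comp hpath hmem
  have hw : ContinuousOn (fun y : ℝ => Wg u (0, y)) (Icc (-(α * r)) (α * r)) := by
    unfold Wg; fun_prop
  have hwpos : ∀ z, 0 < Wg u z := fun z => ww_pos _ _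
  have hc : ContinuousOn (fun y : ℝ => 1 - pd1 u (0, y) / Wg u (0, y))
      (Icc (-(α * r)) (α * r)) :=
    continuousOn_const.sub (hp.div hw fun y _ => (hwpos _).ne')
  refine ⟨hc, ?_⟩
  have hle : -(α * r) ≤ α * r := by linarith
  have hd : ∀ y ∈ uIcc (-(α * r)) (α * r), HasDerivAt (fun y : ℝ => y - S ⟨0, y⟩)
      (1 - pd1 u (0, y) / Wg u (0, y)) y := by
    intro y hy
    rw [uIcc_of_le hle] at hy
    have h1 := hasDerivAt_im (x := 0) (y := y) (hSXY _ (hmem y hy)).1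
    refine ((hasDerivAt_id y).sub h1).congr_deriv ?_
    simp
    rfl
  rw [intervalIntegral.integral_eq_sub_of_hasDerivAt hd
    (by apply ContinuousOn.intervalIntegrable; rwa [uIcc_of_le hle])]
  have c1 := hcore (α * r) (abs_of_pos har)
  have c2 := hcore (-(α * r)) (by rw [abs_neg, abs_of_pos har])
  have hI : ∀ t : ℝ, Complex.I * (t : ℂ) = ⟨0, t⟩ := by
    intro t; apply Complex.ext <;> simp
  rw [hI] at c1 c2
  rw [abs_neg] at c2
  rw [abs_of_pos har] at c1 c2
  have hP0 : P 0 = pd1 u 0 := rfl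
  have hQ0 : Q 0 = pd2 u 0 := rfl
  rw [hP0, hQ0] at c1 c2
  rw [abs_le] at c1 c2
  have := c1.1
  have := c2.2
  linarith

lemma gg_tendsto {p q : ℕ → ℝ} (h1 : Tendsto (fun n => p n / ww (p n) (q n)) atTop (𝓝 1))
    (h2 : Tendsto (fun n => q n / ww (p n) (q n)) atTop (𝓝 0))
    (h3 : Tendsto (fun n => -1 / ww (p n) (q n)) atTop (𝓝 0)) :
    Tendsto (fun n => ‖gg (p n) (q n) - 1‖) atTop (𝓝 0) := by
  have e : ∀ n, gg (p n) (q n) = ((p n / ww (p n) (q n) : ℝ) - Complex.I * (q n / ww (p n) (q n) : ℝ))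
      / ((1 - (-1 / ww (p n) (q n)) : ℝ) : ℂ) := by
    intro n
    have hW := ww_pos (p n) (q n)
    have h1 : (1 - (-1 / ww (p n) (q n))) = (1 + ww (p n) (q n)) / ww (p n) (q n) := by
      field_simp; ring
    rw [h1]
    apply Complex.ext
    · rw [Complex.div_ofReal_re]
      simp [gg]
      field_simp
    · rw [Complex.div_ofReal_im]
      simp [gg]
      field_simp
  have c1 := (Complex.continuous_ofReal.tendsto _).comp h1
  have c2 := (Complex.continuous_ofReal.tendsto _).comp h2
  have c3 := (Complex.continuous_ofReal.tendsto _).comp (h3.const_sub 1)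
  have := (((c1.sub (c2.const_mul Complex.I)).div c3 (by simp)).sub_const 1).norm
  simp only [Function.comp_def] at this
  simp only [e]
  simpa using this

lemma N_tendsto {p q : ℕ → ℝ}
    (h1 : Tendsto (fun n => 1 - p n / ww (p n) (q n)) atTop (𝓝 0)) :
    Tendsto (fun n => (p n / ww (p n) (q n), q n / ww (p n) (q n), -1 / ww (p n) (q n)))
      atTop (𝓝 ((1:ℝ), (0:ℝ), (0:ℝ))) := by
  have hp : Tendsto (fun n => p n / ww (p n) (q n)) atTop (𝓝 1) := by
    have := h1.const_sub 1
    simpa using this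
  have hs : Tendsto (fun n => Real.sqrt (1 - (p n / ww (p n) (q n)) ^ 2)) atTop (𝓝 0) := by
    have := ((hp.pow 2).const_sub 1).sqrt
    simpa using this
  have hid : ∀ n, (q n / ww (p n) (q n)) ^ 2 + (-1 / ww (p n) (q n)) ^ 2
      = 1 - (p n / ww (p n) (q n)) ^ 2 := by
    intro n
    have hW := ww_pos (p n) (q n)
    have hW2 := ww_sq (p n) (q n)
    field_simp
    linarith
  refine hp.prodMk_nhds (Tendsto.prodMk_nhds ?_ ?_)
  · refine squeeze_zero_norm (fun n => ?_) hs
    rw [Real.norm_eq_abs]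
    apply Real.abs_le_sqrt
    nlinarith [hid n, sq_nonneg (-1 / ww (p n) (q n))]
  · refine squeeze_zero_norm (fun n => ?_) hs
    rw [Real.norm_eq_abs]
    apply Real.abs_le_sqrt
    nlinarith [hid n, sq_nonneg (q n / ww (p n) (q n))]

/-- Local appearance of a line of divergence: if the downward normals at the origin of
a sequence of solutions of the minimal surfaces equation on the Euclidean disk `D(0,r)`
converge to the horizontal vector `(1,0,0)`, then for every `α ∈ (0,1)` some subsequence
of the normals converges to `(1,0,0)` at almost every point of the vertical segment
`{0} × [−αr, αr]`. -/
theorem line_of_divergence_local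
    (r : ℝ) (hr : 0 < r)
    (u : ℕ → ℝ × ℝ → ℝ) (hu : ∀ n, IsMSE (u n) (eball 0 r))
    (hN0 : Tendsto (fun n => Nvec (u n) 0) atTop (𝓝 (1, 0, 0))) :
    ∀ α ∈ Ioo (0:ℝ) 1, ∃ θ : ℕ → ℕ, StrictMono θ ∧
      ∀ᵐ y ∂(volume.restrict (Icc (-(α * r)) (α * r))),
        Tendsto (fun n => Nvec (u (θ n)) (0, y)) atTop (𝓝 (1, 0, 0)) := by

  intro α hα
  have har : 0 < α * r := mul_pos hα.1 hr
  have hle : -(α * r) ≤ α * r := by linarith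
  have hg : Tendsto (fun n => ‖gg (pd1 (u n) 0) (pd2 (u n) 0) - 1‖) atTop (𝓝 0) := by
    have hb := hN0.snd_nhds
    exact gg_tendsto hN0.fst_nhds hb.fst_nhds hb.snd_nhds
  set F : ℕ → ℝ → ℝ := fun n y => 1 - pd1 (u n) (0, y) / Wg (u n) (0, y) with hF
  have hnn : ∀ n y, 0 ≤ F n y := by
    intro n y
    simp only [hF, sub_nonneg]
    have hW : 0 < Wg (u n) (0, y) := ww_pos _ _
    have hW2 : Wg (u n) (0, y) ^ 2 = _ := ww_sq _ _
    rw [div_le_one hW]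
    refine le_of_sq_le_sq ?_ hW.le
    rw [hW2]
    nlinarith [sq_nonneg (pd2 (u n) (0, y))]
  have hFint : ∀ n, Integrable (F n) (volume.restrict (Icc (-(α * r)) (α * r))) := fun n =>
    (int_bound hr hα (hu n)).1.integrableOn_Icc
  have hlim : Tendsto (fun n => ∫ y in Icc (-(α * r)) (α * r), F n y) atTop (𝓝 0) := by
    refine squeeze_zero (fun n => integral_nonneg (hnn n)) (fun n => ?_)
      (by simpa using hg.mul_const (4 * (α * r) *
        (((1 + α) / 2 * r + α * r) / ((1 + α) / 2 * r - α * r))))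
    rw [integral_Icc_eq_integral_Ioc, ← intervalIntegral.integral_of_le hle]
    exact (int_bound hr hα (hu n)).2
  have hmeas : TendstoInMeasure (volume.restrict (Icc (-(α * r)) (α * r))) F atTop
      (fun _ => (0:ℝ)) := by
    refine tendstoInMeasure_of_tendsto_eLpNorm (p := 1) one_ne_zero
      (fun n => (hFint n).aestronglyMeasurable) aestronglyMeasurable_const ?_
    have : ∀ n, eLpNorm (F n - fun _ => (0:ℝ)) 1 (volume.restrict (Icc (-(α * r)) (α * r)))
        = ENNReal.ofReal (∫ y in Icc (-(α * r)) (α * r), F n y) := by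
      intro n
      have h0 : (F n - fun _ => (0:ℝ)) = F n := by ext y; simp
      rw [h0, eLpNorm_one_eq_lintegral_enorm, ← ofReal_integral_norm_eq_lintegral_enorm (hFint n)]
      congr 2
      ext y
      exact abs_of_nonneg (hnn n y)
    simp only [this]
    simpa using ENNReal.tendsto_ofReal hlim
  obtain ⟨θ, hθ, hae⟩ := hmeas.exists_seq_tendsto_ae
  refine ⟨θ, hθ, ?_⟩
  filter_upwards [hae] with y hy
  exact N_tendsto hy
end
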